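/- Under the standing assumptions, suppose the exponent p from hypothesis (f3) satisfies 2 < p < 2 + 4/N. Then for every c ∈ (0, +∞) there exists λ > −λ₁(Ω) with ∫_Ω u_λ² dx = c. -/

import Mathlib

open MeasureTheory Set Filter Topology

noncomputable section

/-- `N`-dimensional Euclidean space. -/
abbrev Euc (N : ℕ) := EuclideanSpace ℝ (Fin N)

/-- The Laplacian of a real-valued function on Euclidean space, defined as the
sum of the pure second partial derivatives in the coordinate directions. -/
def lap {N : ℕ} (u : Euc N → ℝ) (x : Euc N) : ℝ :=
  ∑ i : Fin N,
    fderiv ℝ (fun y => fderiv ℝ u y (EuclideanSpace.single i 1)) x (EuclideanSpace.single i 1)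

/-- The first Dirichlet eigenvalue of `-Δ` on `Ω`, defined as the infimum of
Rayleigh quotients of nonzero smooth functions with compact support contained in `Ω`. -/
def firstEig {N : ℕ} (Ω : Set (Euc N)) : ℝ :=
  sInf { r : ℝ | ∃ φ : Euc N → ℝ, ContDiff ℝ (⊤ : ℕ∞) φ ∧ HasCompactSupport φ ∧
    tsupport φ ⊆ Ω ∧ φ ≠ 0 ∧
    r = (∫ x, ‖fderiv ℝ φ x‖ ^ 2) / (∫ x, (φ x) ^ 2) }

/-- `u` is a (classical) positive solution of `-Δ u + lam • u = f(x, u)` in `Ω`,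
vanishing on the boundary: `u ∈ C²(Ω) ∩ C(closure Ω)`, `u > 0` in `Ω`, `u = 0` on `∂Ω`. -/
def IsPosSolution {N : ℕ} (Ω : Set (Euc N)) (f : Euc N → ℝ → ℝ) (lam : ℝ)
    (u : Euc N → ℝ) : Prop :=
  ContDiffOn ℝ 2 u Ω ∧ ContinuousOn u (closure Ω) ∧ (∀ x ∈ Ω, 0 < u x) ∧
    (∀ x ∈ frontier Ω, u x = 0) ∧ ∀ x ∈ Ω, - lap u x + lam * u x = f x (u x)

/-- The standing assumptions of the paper: `Ω ⊆ ℝ^N` is a bounded domain with `C¹`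
boundary, convex in every coordinate direction and invariant under a blockwise
orthogonal group `G = O(m₁) × ⋯ × O(m_ℓ)` with every `m_i ≥ 2`; the nonlinearity
`f` satisfies (f1), (f2), (f3) with splitting `f(x,t) = d(x)|t|^{p-2} t + g(x,t)`;
and for every `λ > -λ₁(Ω)` the problem has exactly one positive solution `u λ`. -/
structure Standing (N : ℕ) (Ω : Set (Euc N)) (f : Euc N → ℝ → ℝ)
    (d : Euc N → ℝ) (g : Euc N → ℝ → ℝ) (p : ℝ) (u : ℝ → Euc N → ℝ) : Prop where
  dim : 2 ≤ N
  isOpen : IsOpen Ω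
  conn : IsConnected Ω
  bdd : Bornology.IsBounded Ω
  c1bdry : ∀ x ∈ frontier Ω, ∃ U : Set (Euc N), IsOpen U ∧ x ∈ U ∧
      ∃ F : Euc N → ℝ, ContDiff ℝ 1 F ∧ (∀ y ∈ U, fderiv ℝ F y ≠ 0) ∧
        Ω ∩ U = {y ∈ U | F y < 0}
  conv : ∀ i : Fin N, ∀ x ∈ Ω, ∀ y ∈ Ω, (∀ j, j ≠ i → x j = y j) → segment ℝ x y ⊆ Ω
  symm : ∃ ℓ : ℕ, 1 ≤ ℓ ∧ ∃ β : Fin N → Fin ℓ, Monotone β ∧ Function.Surjective β ∧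
      (∀ j, 2 ≤ (Finset.univ.filter (fun i => β i = j)).card) ∧
      ∀ e : Euc N ≃ₗᵢ[ℝ] Euc N,
        (∀ j : Fin ℓ, ∀ x : Euc N, (∀ i, β i ≠ j → x i = 0) → ∀ i, β i ≠ j → e x i = 0) →
          e '' Ω = Ω ∧ (∀ x t, f (e x) t = f x t) ∧ ∀ x, d (e x) = d x
  f_c1 : ContDiffOn ℝ 1 (Function.uncurry f) (Ω ×ˢ (univ : Set ℝ))
  f_zero : ∀ x ∈ Ω, f x 0 = 0 ∧ deriv (f x) 0 = 0
  f_ar : ∃ a b : ℝ, 2 < a ∧ a ≤ b ∧ (3 ≤ N → b < 2 * N / ((N : ℝ) - 2)) ∧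
      ∀ᵐ x ∂(volume : Measure (Euc N)).restrict Ω, ∀ t : ℝ, t ≠ 0 →
        0 < (a - 1) * f x t * t ∧ (a - 1) * f x t * t ≤ deriv (f x) t * t ^ 2 ∧
          deriv (f x) t * t ^ 2 ≤ (b - 1) * f x t * t
  f_bdd : ∃ M : ℝ, 0 < M ∧ ∀ x ∈ Ω, |f x 1| < M ∧ |f x (-1)| < M
  hp : 2 < p ∧ (3 ≤ N → p < 2 * N / ((N : ℝ) - 2))
  f_split : ∀ x t, f x t = d x * |t| ^ (p - 2) * t + g x t
  d_c1 : ContDiffOn ℝ 1 d (closure Ω)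
  d_bdd : ∃ C : ℝ, ∀ x ∈ Ω, |d x| ≤ C
  d_nonneg : ∀ x ∈ closure Ω, 0 ≤ d x
  d_zero : d 0 = 1
  g_top : ∀ x ∈ Ω, Tendsto (fun t : ℝ => g x t / t ^ (p - 1)) atTop (𝓝 0)
  g_zero : ∀ x ∈ Ω, Tendsto (fun t : ℝ => g x t / t) (𝓝[≠] (0 : ℝ)) (𝓝 0)
  mono : ∀ i : Fin N, ∀ x ∈ Ω, ∀ y ∈ Ω, (∀ j, j ≠ i → x j = y j) → |x i| ≤ |y i| →
      (∀ t, f y t ≤ f x t) ∧ d y ≤ d x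
  sol : ∀ lam : ℝ, - firstEig Ω < lam →
      IsPosSolution Ω f lam (u lam) ∧
        ∀ v, IsPosSolution Ω f lam v → EqOn v (u lam) (closure Ω)

section Laplacian

variable {N : ℕ}

/-- Smooth functions whose support is a compact subset of `U`. -/
structure IsTest (U : Set (Euc N)) (φ : Euc N → ℝ) : Prop where
  smooth : ContDiff ℝ (⊤ : ℕ∞) φ
  cpt : HasCompactSupport φ
  supp : tsupport φ ⊆ U

theorem norm_sq_eq_sum_apply_single (L : Euc N →L[ℝ] ℝ) :
    ‖L‖ ^ 2 = ∑ i, L (EuclideanSpace.single i 1) ^ 2 := by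
  obtain ⟨v, rfl⟩ := (InnerProductSpace.toDual ℝ (Euc N)).surjective L
  rw [LinearIsometryEquiv.norm_map, EuclideanSpace.norm_sq_eq]
  simp [InnerProductSpace.toDual_apply_apply, EuclideanSpace.inner_single_right]

theorem lap_const_mul_comp (φ : Euc N → ℝ) (hφ : ContDiff ℝ 2 φ) (a b : ℝ) (x y : Euc N) :
    lap (fun y => a * φ (b • (y - x))) y = a * b ^ 2 * lap φ (b • (y - x)) := by
  have hd : ∀ (χ : Euc N → ℝ), Differentiable ℝ χ → ∀ (a : ℝ) (y : Euc N) (v : Euc N),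
      fderiv ℝ (fun y => a * χ (b • (y - x))) y v = a * b * fderiv ℝ χ (b • (y - x)) v := by
    intro χ hχ a y v
    have h1 : HasFDerivAt (fun y : Euc N => b • (y - x)) (b • ContinuousLinearMap.id ℝ (Euc N)) y :=
      ((hasFDerivAt_id y).sub_const x).const_smul b
    have h2 := ((hχ (b • (y - x))).hasFDerivAt.comp y h1).const_mul a
    rw [HasFDerivAt.fderiv (f := fun y => a * χ (b • (y - x))) h2]
    simp
    ring
  have hφ1 : Differentiable ℝ φ := hφ.differentiable (by norm_num)
  unfold lap
  rw [Finset.mul_sum]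
  refine Finset.sum_congr rfl fun i _ => ?_
  have : (fun y => fderiv ℝ (fun y => a * φ (b • (y - x))) y (EuclideanSpace.single i 1)) =
      fun y => (a * b) * (fun z => fderiv ℝ φ z (EuclideanSpace.single i 1)) (b • (y - x)) := by
    funext y; exact hd φ hφ1 a y _
  rw [this, hd (fun z => fderiv ℝ φ z (EuclideanSpace.single i 1))]
  · ring
  · exact ((hφ.fderiv_right (m := 1) (by norm_num)).clm_apply contDiff_const).differentiable
      (by norm_num)

theorem contDiff_partial {φ : Euc N → ℝ} {m n : WithTop ℕ∞} (hφ : ContDiff ℝ n φ)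
    (h : m + 1 ≤ n) (v : Euc N) : ContDiff ℝ m fun y => fderiv ℝ φ y v :=
  (hφ.fderiv_right h).clm_apply contDiff_const

theorem continuous_lap {φ : Euc N → ℝ} (hφ : ContDiff ℝ 2 φ) : Continuous (lap φ) := by
  unfold lap
  refine continuous_finsetSum _ fun i _ => ?_
  exact (contDiff_partial (m := 0) (contDiff_partial (m := 1) hφ (by norm_num) _)
    (by norm_num) _).continuous

theorem hasCompactSupport_partial {φ : Euc N → ℝ} (hφ : HasCompactSupport φ) (v : Euc N) :
    HasCompactSupport fun y => fderiv ℝ φ y v :=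
  hφ.fderiv_apply (𝕜 := ℝ) v

theorem lap_eq_zero_of_notMem_tsupport {φ : Euc N → ℝ} {x : Euc N} (hx : x ∉ tsupport φ) :
    lap φ x = 0 := by
  unfold lap
  refine Finset.sum_eq_zero fun i _ => ?_
  have h1 : φ =ᶠ[𝓝 x] fun _ => 0 := notMem_tsupport_iff_eventuallyEq.1 hx
  have h2 : (fun y => fderiv ℝ φ y (EuclideanSpace.single i 1)) =ᶠ[𝓝 x] fun _ => 0 := by
    filter_upwards [h1.eventuallyEq_nhds] with y hy
    rw [hy.fderiv_eq]; simp
  rw [h2.fderiv_eq]; simp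

theorem hasCompactSupport_lap {φ : Euc N → ℝ} (hφ : HasCompactSupport φ) :
    HasCompactSupport (lap φ) :=
  HasCompactSupport.intro hφ fun _ hx => lap_eq_zero_of_notMem_tsupport hx

theorem integral_mul_lap {φ w : Euc N → ℝ} (hφ : ContDiff ℝ 1 φ) (hw : ContDiff ℝ 2 w)
    (hw' : HasCompactSupport w) :
    ∫ x, φ x * lap w x = -∫ x, ∑ i, fderiv ℝ φ x (EuclideanSpace.single i 1) *
      fderiv ℝ w x (EuclideanSpace.single i 1) := by
  have hw1 : ∀ i : Fin N, ContDiff ℝ 1 fun y => fderiv ℝ w y (EuclideanSpace.single i 1) :=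
    fun i => contDiff_partial hw (by norm_num) _
  have hw2 : ∀ i : Fin N, Continuous fun x =>
      fderiv ℝ (fun y => fderiv ℝ w y (EuclideanSpace.single i 1)) x (EuclideanSpace.single i 1) :=
    fun i => (contDiff_partial (m := 0) (hw1 i) (by norm_num) _).continuous
  have hφ1 : ∀ i : Fin N, Continuous fun y => fderiv ℝ φ y (EuclideanSpace.single i 1) :=
    fun i => (contDiff_partial (m := 0) hφ (by norm_num) _).continuous
  have c1 : ∀ i : Fin N, HasCompactSupport fun y => fderiv ℝ w y (EuclideanSpace.single i 1) :=
    fun i => hasCompactSupport_partial hw' _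
  have c2 : ∀ i : Fin N, HasCompactSupport fun x =>
      fderiv ℝ (fun y => fderiv ℝ w y (EuclideanSpace.single i 1)) x (EuclideanSpace.single i 1) :=
    fun i => hasCompactSupport_partial (c1 i) _
  have i1 : ∀ i : Fin N, Integrable fun x => fderiv ℝ φ x (EuclideanSpace.single i 1) *
      fderiv ℝ w x (EuclideanSpace.single i 1) := fun i =>
    ((hφ1 i).mul (hw1 i).continuous).integrable_of_hasCompactSupport (c1 i).mul_left
  have i2 : ∀ i : Fin N, Integrable fun x => φ x * fderiv ℝ (fun y => fderiv ℝ w y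
      (EuclideanSpace.single i 1)) x (EuclideanSpace.single i 1) := fun i =>
    (hφ.continuous.mul (hw2 i)).integrable_of_hasCompactSupport (c2 i).mul_left
  unfold lap
  simp_rw [Finset.mul_sum]
  rw [integral_finsetSum _ fun i _ => i2 i, integral_finsetSum _ fun i _ => i1 i,
    ← Finset.sum_neg_distrib]
  refine Finset.sum_congr rfl fun i _ => ?_
  exact integral_mul_fderiv_eq_neg_fderiv_mul_of_integrable (i1 i) (i2 i)
    ((hφ.continuous.mul (hw1 i).continuous).integrable_of_hasCompactSupport (c1 i).mul_left)
    (fun x _ => hφ.differentiable (by norm_num) x)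
    (fun x _ => (hw1 i).differentiable (by norm_num) x)

theorem integral_mul_lap_comm {φ w : Euc N → ℝ} (hφ : ContDiff ℝ 2 φ) (hφ' : HasCompactSupport φ)
    (hw : ContDiff ℝ 2 w) (hw' : HasCompactSupport w) :
    ∫ x, φ x * lap w x = ∫ x, lap φ x * w x := by
  rw [integral_mul_lap (hφ.of_le (by norm_num)) hw hw']
  have := integral_mul_lap (hw.of_le (by norm_num)) hφ hφ'
  simp_rw [mul_comm (lap φ _), this, mul_comm (fderiv ℝ w _ _)]

theorem integrable_norm_fderiv_sq {φ : Euc N → ℝ} (hφ : ContDiff ℝ 1 φ)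
    (hφ' : HasCompactSupport φ) : Integrable fun x => ‖fderiv ℝ φ x‖ ^ 2 := by
  have h : HasCompactSupport fun x => ‖fderiv ℝ φ x‖ ^ 2 :=
    (hφ'.fderiv (𝕜 := ℝ)).comp_left (g := fun L => ‖L‖ ^ 2) (by simp)
  exact ((hφ.continuous_fderiv (by norm_num)).norm.pow 2).integrable_of_hasCompactSupport h

/-- Expansion of the Dirichlet energy along a smooth direction. -/
theorem integral_norm_fderiv_add_sq {φ w : Euc N → ℝ} (hφ : ContDiff ℝ 1 φ)
    (hφ' : HasCompactSupport φ) (hw : ContDiff ℝ 2 w) (hw' : HasCompactSupport w) (t : ℝ) :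
    ∫ x, ‖fderiv ℝ (fun y => φ y + t * w y) x‖ ^ 2 =
      (∫ x, ‖fderiv ℝ φ x‖ ^ 2) - 2 * t * (∫ x, φ x * lap w x) +
        t ^ 2 * ∫ x, ‖fderiv ℝ w x‖ ^ 2 := by
  have i1 := integrable_norm_fderiv_sq hφ hφ'
  have i2 := integrable_norm_fderiv_sq (hw.of_le (by norm_num)) hw'
  have i3 : Integrable fun x => ∑ i, fderiv ℝ φ x (EuclideanSpace.single i 1) *
      fderiv ℝ w x (EuclideanSpace.single i 1) := by
    refine integrable_finsetSum _ fun i _ => ?_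
    exact ((contDiff_partial (m := 0) hφ (by norm_num) _).continuous.mul
      (contDiff_partial (m := 0) hw (by norm_num) _).continuous).integrable_of_hasCompactSupport
      (hasCompactSupport_partial hw' _).mul_left
  rw [integral_mul_lap hφ hw hw']
  have key : ∀ x, ‖fderiv ℝ (fun y => φ y + t * w y) x‖ ^ 2 = ‖fderiv ℝ φ x‖ ^ 2 +
      (2 * t) * (∑ i, fderiv ℝ φ x (EuclideanSpace.single i 1) *
      fderiv ℝ w x (EuclideanSpace.single i 1)) + t ^ 2 * ‖fderiv ℝ w x‖ ^ 2 := by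
    intro x
    have h : fderiv ℝ (fun y => φ y + t * w y) x = fderiv ℝ φ x + t • fderiv ℝ w x :=
      HasFDerivAt.fderiv (((hφ.differentiable (by norm_num) x).hasFDerivAt).add
        ((hw.differentiable (by norm_num) x).hasFDerivAt.const_mul t))
    rw [h]
    simp_rw [norm_sq_eq_sum_apply_single, Finset.mul_sum, ← Finset.sum_add_distrib]
    refine Finset.sum_congr rfl fun i _ => ?_
    simp
    ring
  simp_rw [key]
  have i4 : Integrable fun x => ‖fderiv ℝ φ x‖ ^ 2 + (2 * t) * (∑ i, fderiv ℝ φ x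
      (EuclideanSpace.single i 1) * fderiv ℝ w x (EuclideanSpace.single i 1)) :=
    i1.add (i3.const_mul _)
  rw [integral_add i4 (i2.const_mul _), integral_add i1 (i3.const_mul _), integral_const_mul, integral_const_mul]
  ring

end Laplacian

section Kernel

variable {N : ℕ}

/-- A smooth radial bump function supported in the closed unit ball. -/
def bumpP (z : Euc N) : ℝ := expNegInvGlue (1 - ‖z‖ ^ 2)

/-- The radial function with `∇ bumpP z = - bumpR z • z`. -/
def bumpR (z : Euc N) : ℝ := 2 * (((1 - ‖z‖ ^ 2)⁻¹) ^ 2 * expNegInvGlue (1 - ‖z‖ ^ 2))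

theorem bumpP_nonneg (z : Euc N) : 0 ≤ bumpP z := expNegInvGlue.nonneg _

theorem bumpR_nonneg (z : Euc N) : 0 ≤ bumpR z := by
  unfold bumpR; have := expNegInvGlue.nonneg (1 - ‖z‖ ^ 2); positivity

theorem bumpP_eq_zero {z : Euc N} (hz : 1 ≤ ‖z‖) : bumpP z = 0 :=
  expNegInvGlue.zero_of_nonpos (by nlinarith)

theorem bumpR_eq_zero {z : Euc N} (hz : 1 ≤ ‖z‖) : bumpR z = 0 := by
  unfold bumpR; rw [expNegInvGlue.zero_of_nonpos (by nlinarith)]; simp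

theorem bumpR_pos {z : Euc N} (hz : ‖z‖ < 1) : 0 < bumpR z := by
  have h : 0 < 1 - ‖z‖ ^ 2 := by nlinarith [norm_nonneg z]
  unfold bumpR; have := expNegInvGlue.pos_of_pos h; positivity

theorem two_mul_bumpP_le_bumpR (z : Euc N) : 2 * bumpP z ≤ bumpR z := by
  rcases le_or_gt 1 ‖z‖ with hz | hz
  · rw [bumpP_eq_zero hz, bumpR_eq_zero hz]; simp
  · have h : 0 < 1 - ‖z‖ ^ 2 := by nlinarith [norm_nonneg z]
    unfold bumpP bumpR
    have h1 : 1 ≤ (1 - ‖z‖ ^ 2)⁻¹ := (one_le_inv₀ h).2 (by nlinarith [sq_nonneg ‖z‖])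
    have := expNegInvGlue.nonneg (1 - ‖z‖ ^ 2)
    have h2 : 1 ≤ ((1 - ‖z‖ ^ 2)⁻¹) ^ 2 := one_le_pow₀ h1
    nlinarith

theorem contDiff_bumpP {n : ℕ∞} : ContDiff ℝ n (bumpP : Euc N → ℝ) :=
  expNegInvGlue.contDiff.comp (contDiff_const.sub (contDiff_norm_sq ℝ))

theorem contDiff_bumpR {n : ℕ∞} : ContDiff ℝ n (bumpR : Euc N → ℝ) := by
  have h := (expNegInvGlue.contDiff_polynomial_eval_inv_mul (n := n)
    (Polynomial.X ^ 2 : Polynomial ℝ)).comp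
    (contDiff_const.sub (contDiff_norm_sq ℝ) : ContDiff ℝ n fun z : Euc N => 1 - ‖z‖ ^ 2)
  have e : (bumpR : Euc N → ℝ) = fun z => 2 * ((fun s : ℝ =>
      (Polynomial.X ^ 2 : Polynomial ℝ).eval s⁻¹ * expNegInvGlue s) ∘
        fun z : Euc N => 1 - ‖z‖ ^ 2) z := by
    funext z
    simp [bumpR]
  rw [e]
  exact contDiff_const.mul h

theorem hasFDerivAt_bumpP (z : Euc N) :
    HasFDerivAt (bumpP : Euc N → ℝ) (-(bumpR z) • innerSL ℝ z) z := by
  have h := expNegInvGlue.hasDerivAt_polynomial_eval_inv_mul 1 (1 - ‖z‖ ^ 2)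
  simp only [Polynomial.eval_one, one_mul, Polynomial.derivative_one, sub_zero, mul_one,
    Polynomial.eval_pow, Polynomial.eval_X] at h
  have h2 : HasFDerivAt (fun z : Euc N => 1 - ‖z‖ ^ 2) (-(2 • innerSL ℝ z)) z := by
    simpa using (hasStrictFDerivAt_norm_sq z).hasFDerivAt.const_sub 1
  have h3 := h.comp_hasFDerivAt z h2
  refine h3.congr_fderiv ?_
  ext v
  simp [bumpR]
  ring

theorem lap_bumpP (z : Euc N) :
    lap (bumpP : Euc N → ℝ) z = -(N * bumpR z + fderiv ℝ bumpR z z) := by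
  unfold lap
  have h1 : ∀ i : Fin N, fderiv ℝ (fun y => fderiv ℝ (bumpP : Euc N → ℝ) y
      (EuclideanSpace.single i 1)) z (EuclideanSpace.single i 1) =
      -(bumpR z + z i * fderiv ℝ bumpR z (EuclideanSpace.single i 1)) := by
    intro i
    have e : (fun y => fderiv ℝ (bumpP : Euc N → ℝ) y (EuclideanSpace.single i 1)) =
        fun y => -(bumpR y * y i) := by
      funext y
      rw [(hasFDerivAt_bumpP y).fderiv]
      simp [EuclideanSpace.inner_single_right]
    rw [e]
    have hR : HasFDerivAt (bumpR : Euc N → ℝ) (fderiv ℝ bumpR z) z :=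
      ((contDiff_bumpR (n := 1)).differentiable (by norm_num) z).hasFDerivAt
    have hi : HasFDerivAt (fun y : Euc N => y i) (EuclideanSpace.proj (𝕜 := ℝ) i) z :=
      (EuclideanSpace.proj (𝕜 := ℝ) i : Euc N →L[ℝ] ℝ).hasFDerivAt
    rw [HasFDerivAt.fderiv (f := fun y => -(bumpR y * y i)) (hR.mul hi).neg]
    simp
  simp_rw [h1]
  have h2 : z = ∑ i, z i • EuclideanSpace.single i (1 : ℝ) := by
    ext j; simp [Finset.sum_apply, Pi.single_apply]
  have h3 : fderiv ℝ bumpR z z = ∑ i, z i * fderiv ℝ bumpR z (EuclideanSpace.single i 1) := by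
    calc fderiv ℝ bumpR z z = fderiv ℝ bumpR z (∑ i, z i • EuclideanSpace.single i (1 : ℝ)) :=
          congrArg _ h2
      _ = _ := by rw [map_sum]; simp
  rw [h3, Finset.sum_neg_distrib, Finset.sum_add_distrib]
  simp

theorem hasCompactSupport_bumpP : HasCompactSupport (bumpP : Euc N → ℝ) :=
  HasCompactSupport.intro (isCompact_closedBall 0 1) fun z hz =>
    bumpP_eq_zero (by simpa using (not_le.1 (by simpa using hz)).le)

theorem hasCompactSupport_bumpR : HasCompactSupport (bumpR : Euc N → ℝ) :=
  HasCompactSupport.intro (isCompact_closedBall 0 1) fun z hz =>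
    bumpR_eq_zero (by simpa using (not_le.1 (by simpa using hz)).le)

theorem continuous_bumpP : Continuous (bumpP : Euc N → ℝ) :=
  (contDiff_bumpP (n := 0)).continuous

theorem continuous_bumpR : Continuous (bumpR : Euc N → ℝ) :=
  (contDiff_bumpR (n := 0)).continuous

theorem integral_bumpR_pos : 0 < ∫ z : Euc N, bumpR z :=
  continuous_bumpR.integral_pos_of_hasCompactSupport_nonneg_nonzero hasCompactSupport_bumpR
    bumpR_nonneg (x := 0) (bumpR_pos (by simp)).ne'

/-- The normalising constant of the mollifier. -/
def bumpC (N : ℕ) : ℝ := (∫ z : Euc N, bumpR z)⁻¹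

theorem bumpC_pos : 0 < bumpC N := inv_pos.2 integral_bumpR_pos

/-- The normalised mollifier of radius `r` centred at `x`. -/
def kerR (r : ℝ) (x y : Euc N) : ℝ :=
  bumpC N * r⁻¹ ^ N * bumpR (r⁻¹ • (y - x))

/-- The companion kernel of `kerR`, satisfying `∂ᵣ kerR = r Δ kerP`. -/
def kerP (r : ℝ) (x y : Euc N) : ℝ :=
  bumpC N * r⁻¹ ^ N * bumpP (r⁻¹ • (y - x))

theorem kerR_nonneg {r : ℝ} (hr : 0 < r) (x y : Euc N) : 0 ≤ kerR r x y := by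
  unfold kerR
  exact mul_nonneg (mul_nonneg bumpC_pos.le (by positivity)) (bumpR_nonneg _)

theorem kerP_nonneg {r : ℝ} (hr : 0 < r) (x y : Euc N) : 0 ≤ kerP r x y := by
  unfold kerP
  exact mul_nonneg (mul_nonneg bumpC_pos.le (by positivity)) (bumpP_nonneg _)

theorem two_mul_kerP_le_kerR {r : ℝ} (hr : 0 < r) (x y : Euc N) :
    2 * kerP r x y ≤ kerR r x y := by
  have h := two_mul_bumpP_le_bumpR (r⁻¹ • (y - x))
  have h2 : 0 ≤ bumpC N * r⁻¹ ^ N := mul_nonneg bumpC_pos.le (by positivity)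
  unfold kerP kerR
  nlinarith [mul_le_mul_of_nonneg_left h h2]

theorem one_le_norm_inv_smul {r : ℝ} (hr : 0 < r) {x y : Euc N} (h : r ≤ dist y x) :
    1 ≤ ‖r⁻¹ • (y - x)‖ := by
  rw [norm_smul, Real.norm_of_nonneg (by positivity), ← dist_eq_norm, inv_mul_eq_div,
    one_le_div hr]
  exact h

theorem kerR_eq_zero {r : ℝ} (hr : 0 < r) {x y : Euc N} (h : r ≤ dist y x) : kerR r x y = 0 := by
  unfold kerR; rw [bumpR_eq_zero (one_le_norm_inv_smul hr h), mul_zero]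

theorem kerP_eq_zero {r : ℝ} (hr : 0 < r) {x y : Euc N} (h : r ≤ dist y x) : kerP r x y = 0 := by
  unfold kerP; rw [bumpP_eq_zero (one_le_norm_inv_smul hr h), mul_zero]

theorem contDiff_kerR {n : ℕ∞} (r : ℝ) (x : Euc N) : ContDiff ℝ n (kerR r x) :=
  contDiff_const.mul (contDiff_bumpR.comp ((contDiff_id.sub contDiff_const).const_smul _))

theorem contDiff_kerP {n : ℕ∞} (r : ℝ) (x : Euc N) : ContDiff ℝ n (kerP r x) :=
  contDiff_const.mul (contDiff_bumpP.comp ((contDiff_id.sub contDiff_const).const_smul _))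

theorem tsupport_kerP_subset {r : ℝ} (hr : 0 < r) (x : Euc N) :
    tsupport (kerP r x) ⊆ Metric.closedBall x r := by
  refine closure_minimal (fun y hy => ?_) Metric.isClosed_closedBall
  by_contra h
  exact hy (kerP_eq_zero hr (not_le.1 (by simpa using h)).le)

theorem isTest_kerP {r : ℝ} (hr : 0 < r) {x : Euc N} {U : Set (Euc N)}
    (hU : Metric.closedBall x r ⊆ U) : IsTest U (kerP r x) where
  smooth := contDiff_kerP r x
  cpt := HasCompactSupport.of_support_subset_isCompact (isCompact_closedBall x r)
    (subset_tsupport _ |>.trans (tsupport_kerP_subset hr x))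
  supp := (tsupport_kerP_subset hr x).trans hU

theorem hasCompactSupport_kerR {r : ℝ} (hr : 0 < r) (x : Euc N) :
    HasCompactSupport (kerR r x) :=
  HasCompactSupport.intro (isCompact_closedBall x r) fun y hy =>
    kerR_eq_zero hr (not_le.1 (by simpa using hy)).le

theorem integral_comp_inv_smul_sub {r : ℝ} (hr : 0 < r) (x : Euc N) (G : Euc N → ℝ) :
    ∫ y, r⁻¹ ^ N * G (r⁻¹ • (y - x)) = ∫ z, G z := by
  rw [integral_const_mul, integral_sub_right_eq_self (fun y => G (r⁻¹ • y)) x,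
    Measure.integral_comp_smul]
  simp [abs_of_pos hr]
  field_simp

theorem integral_kerR {r : ℝ} (hr : 0 < r) (x : Euc N) : ∫ y, kerR r x y = 1 := by
  unfold kerR
  simp_rw [mul_assoc]
  rw [integral_const_mul, integral_comp_inv_smul_sub hr]
  exact inv_mul_cancel₀ integral_bumpR_pos.ne'

theorem integrable_kerR {r : ℝ} (hr : 0 < r) (x : Euc N) : Integrable (kerR r x) :=
  (contDiff_kerR (n := 0) r x).continuous.integrable_of_hasCompactSupport
    (hasCompactSupport_kerR hr x)

theorem integrable_kerP {r : ℝ} (hr : 0 < r) (x : Euc N) : Integrable (kerP r x) :=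
  (contDiff_kerP (n := 0) r x).continuous.integrable_of_hasCompactSupport
    (isTest_kerP hr (subset_univ _)).cpt

theorem integral_kerP_le {r : ℝ} (hr : 0 < r) (x : Euc N) : ∫ y, kerP r x y ≤ 1 / 2 := by
  have h : ∫ y, 2 * kerP r x y ≤ ∫ y, kerR r x y :=
    integral_mono ((integrable_kerP hr x).const_mul 2) (integrable_kerR hr x)
      (two_mul_kerP_le_kerR hr x)
  rw [integral_const_mul, integral_kerR hr] at h
  linarith

theorem integral_kerR_sq {r : ℝ} (hr : 0 < r) (x : Euc N) :
    ∫ y, kerR r x y ^ 2 =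
      r⁻¹ ^ N * (bumpC N ^ 2 * ∫ z : Euc N, bumpR z ^ 2) := by
  have h := integral_comp_inv_smul_sub hr x fun z : Euc N => bumpR z ^ 2
  rw [← h, ← integral_const_mul, ← integral_const_mul]
  congr 1; funext y; unfold kerR; ring

theorem lap_kerP {r : ℝ} (x y : Euc N) : lap (kerP r x) y =
    bumpC N * r⁻¹ ^ N * r⁻¹ ^ 2 * lap bumpP (r⁻¹ • (y - x)) :=
  lap_const_mul_comp bumpP (contDiff_bumpP (n := 2)) _ _ x y

theorem hasDerivAt_kerR {r : ℝ} (hr : 0 < r) (x y : Euc N) :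
    HasDerivAt (fun r => kerR r x y) (r * lap (kerP r x) y) r := by
  have h0 : HasDerivAt (fun r : ℝ => r⁻¹) (-(r⁻¹ ^ 2)) r := by
    simpa using hasDerivAt_inv hr.ne'
  have h1 : HasDerivAt (fun r : ℝ => r⁻¹ • (y - x)) (-(r⁻¹ ^ 2) • (y - x)) r := h0.smul_const _
  have hR : HasFDerivAt (bumpR : Euc N → ℝ) (fderiv ℝ bumpR (r⁻¹ • (y - x))) (r⁻¹ • (y - x)) :=
    ((contDiff_bumpR (n := 1)).differentiable (by norm_num) _).hasFDerivAt
  have h2 := ((h0.pow N).const_mul (bumpC N)).mul (hR.comp_hasDerivAt r h1)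
  refine h2.congr_deriv ?_
  rw [lap_kerP, lap_bumpP]
  simp only [map_smul, smul_eq_mul, Function.comp, Pi.pow_apply]
  rcases N with _ | n
  · have : y - x = 0 := Subsingleton.elim _ _
    simp [this]
  · have : r * r⁻¹ = 1 := mul_inv_cancel₀ hr.ne'
    generalize hs : r⁻¹ = s at *
    have e1 : s ^ (n + 1) = s ^ n * s := pow_succ _ _
    simp only [Nat.add_sub_cancel, e1]
    linear_combination (-bumpC (n + 1) * s ^ n * s * -(((n + 1 : ℕ) : ℝ) * bumpR (s • (y - x)) * s
      + s ^ 2 * fderiv ℝ bumpR (s • (y - x)) (y - x))) * this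

end Kernel

section Mean

variable {N : ℕ}

theorem kerR_comm (r : ℝ) (x y : Euc N) : kerR r x y = kerR r y x := by
  unfold kerR bumpR
  rw [← neg_sub x y, smul_neg, norm_neg]

theorem exists_bumpR_le : ∃ C : ℝ, 0 < C ∧ ∀ z : Euc N, bumpR z ≤ C := by
  obtain ⟨C, hC⟩ := hasCompactSupport_bumpR.exists_bound_of_continuous
    (continuous_bumpR (N := N))
  exact ⟨C, (bumpR_pos (by simp)).trans_le ((le_abs_self _).trans (hC (0 : Euc N))),
    fun z => (le_abs_self _).trans (hC z)⟩

/-- The uniform bound of the mollifier of radius one. -/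
theorem exists_kerR_le : ∃ C : ℝ, 0 < C ∧ ∀ r > 0, ∀ x y : Euc N, kerR r x y ≤ C * r⁻¹ ^ N := by
  obtain ⟨C, hC0, hC⟩ := exists_bumpR_le (N := N)
  refine ⟨bumpC N * C, mul_pos bumpC_pos hC0, fun r hr x y => ?_⟩
  calc kerR r x y ≤ bumpC N * r⁻¹ ^ N * C :=
        mul_le_mul_of_nonneg_left (hC _) (mul_nonneg bumpC_pos.le (by positivity))
    _ = _ := by ring

theorem continuous_kerR (r : ℝ) (x : Euc N) : Continuous (kerR r x) :=
  (contDiff_kerR (n := 0) r x).continuous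

theorem continuous_kerP (r : ℝ) (x : Euc N) : Continuous (kerP r x) :=
  (contDiff_kerP (n := 0) r x).continuous

theorem integrable_kerR_mul {u : Euc N → ℝ} (hu : Integrable u) {r : ℝ} (hr : 0 < r) (x : Euc N) :
    Integrable fun y => kerR r x y * u y := by
  obtain ⟨C, hC0, hC⟩ := exists_kerR_le (N := N)
  refine hu.bdd_mul (c := C * r⁻¹ ^ N) (continuous_kerR r x).aestronglyMeasurable
    (Eventually.of_forall fun y => ?_)
  rw [Real.norm_of_nonneg (kerR_nonneg hr x y)]
  exact hC r hr x y

theorem integrable_kerP_mul {u : Euc N → ℝ} (hu : Integrable u) {r : ℝ} (hr : 0 < r) (x : Euc N) :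
    Integrable fun y => kerP r x y * u y := by
  obtain ⟨C, hC0, hC⟩ := exists_kerR_le (N := N)
  refine hu.bdd_mul (c := C * r⁻¹ ^ N) (continuous_kerP r x).aestronglyMeasurable
    (Eventually.of_forall fun y => ?_)
  rw [Real.norm_of_nonneg (kerP_nonneg hr x y)]
  linarith [hC r hr x y, two_mul_kerP_le_kerR hr x y, kerP_nonneg hr x y]

/-- The weighted mean of `u` over the ball of radius `r` around `x`. -/
def avg (u : Euc N → ℝ) (r : ℝ) (x : Euc N) : ℝ := ∫ y, kerR r x y * u y

theorem hasDerivAt_avg {u : Euc N → ℝ} (hu : Integrable u) {r : ℝ} (hr : 0 < r) (x : Euc N) :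
    HasDerivAt (fun s => avg u s x) (r * ∫ y, u y * lap (kerP r x) y) r := by
  obtain ⟨M, hM⟩ := (hasCompactSupport_lap hasCompactSupport_bumpP).exists_bound_of_continuous
    (continuous_lap (contDiff_bumpP (N := N) (n := 2)))
  have hM0 : 0 ≤ M := (norm_nonneg _).trans (hM 0)
  have key := hasDerivAt_integral_of_dominated_loc_of_deriv_le (μ := volume)
    (F := fun s y => kerR s x y * u y) (F' := fun s y => s * lap (kerP s x) y * u y)
    (bound := fun y => 2 * r * (bumpC N * (2 / r) ^ N * (2 / r) ^ 2 * M) * ‖u y‖)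
    (Ioo_mem_nhds (half_lt_self hr) (by linarith : r < 2 * r))
    (Eventually.of_forall fun s => (continuous_kerR s x).aestronglyMeasurable.mul
      hu.aestronglyMeasurable) (integrable_kerR_mul hu hr x)
    (((continuous_const.mul (continuous_lap (contDiff_kerP (n := 2) r x))).aestronglyMeasurable).mul
      hu.aestronglyMeasurable)
    (Eventually.of_forall fun y s hs => ?_) (hu.norm.const_mul _)
    (Eventually.of_forall fun y s hs => (hasDerivAt_kerR (by linarith [hs.1]) x y).mul_const _)
  · refine key.2.congr_deriv ?_
    rw [← integral_const_mul]
    congr 1; funext y; ring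
  · have hs0 : 0 < s := by linarith [hs.1]
    have h1 : s⁻¹ ≤ 2 / r := by
      rw [inv_le_comm₀ hs0 (by positivity), inv_div]; exact hs.1.le
    rw [norm_mul, norm_mul, lap_kerP, norm_mul, Real.norm_of_nonneg hs0.le]
    rw [Real.norm_of_nonneg
      (mul_nonneg (mul_nonneg bumpC_pos.le (by positivity)) (by positivity))]
    have := bumpC_pos (N := N)
    have h2 := hM (s⁻¹ • (y - x))
    have h3 := hs.2.le
    gcongr

theorem avg_nonneg {u : Euc N → ℝ} (hu : ∀ y, 0 ≤ u y) {r : ℝ} (hr : 0 < r) (x : Euc N) :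
    0 ≤ avg u r x := integral_nonneg fun y => mul_nonneg (kerR_nonneg hr x y) (hu y)

theorem ae_tendsto_avg {u : Euc N → ℝ} (hu : Integrable u) :
    ∀ᵐ x, Tendsto (fun r => avg u r x) (𝓝[>] 0) (𝓝 (u x)) := by
  obtain ⟨C, hC0, hC⟩ := exists_kerR_le (N := N)
  filter_upwards [(Besicovitch.vitaliFamily (volume : Measure (Euc N))).ae_tendsto_average_norm_sub
    hu.locallyIntegrable] with x hx
  have h1 := hx.comp (Besicovitch.tendsto_filterAt volume x)
  have h2 := h1.const_mul (C * volume.real (Metric.closedBall (0 : Euc N) 1))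
  rw [mul_zero] at h2
  rw [tendsto_iff_norm_sub_tendsto_zero]
  refine squeeze_zero' (Eventually.of_forall fun _ => norm_nonneg _) ?_ h2
  filter_upwards [self_mem_nhdsWithin] with r (hr : 0 < r)
  have e1 : avg u r x - u x = ∫ y, kerR r x y * (u y - u x) := by
    simp_rw [mul_sub]
    rw [integral_sub (integrable_kerR_mul hu hr x) ((integrable_kerR hr x).mul_const _),
      integral_mul_const, integral_kerR hr, one_mul, avg]
  have hI : IntegrableOn (fun y => ‖u y - u x‖) (Metric.closedBall x r) :=
    (hu.integrableOn.sub (integrableOn_const (by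
      exact (isCompact_closedBall x r).measure_lt_top.ne))).norm
  have e2 : ∫ y, kerR r x y * ‖u y - u x‖ ≤
      ∫ y in Metric.closedBall x r, C * r⁻¹ ^ N * ‖u y - u x‖ := by
    rw [← setIntegral_eq_integral_of_forall_compl_eq_zero (s := Metric.closedBall x r)
      (fun y hy => by rw [kerR_eq_zero hr (not_le.1 (by simpa using hy)).le, zero_mul])]
    refine integral_mono_of_nonneg
      (Eventually.of_forall fun y => mul_nonneg (kerR_nonneg hr x y) (norm_nonneg _))
      (hI.const_mul _)
      (Eventually.of_forall fun y => mul_le_mul_of_nonneg_right (hC r hr x y) (norm_nonneg _))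
  rw [e1]
  calc ‖∫ y, kerR r x y * (u y - u x)‖ ≤ ∫ y, ‖kerR r x y * (u y - u x)‖ :=
        norm_integral_le_integral_norm _
    _ = ∫ y, kerR r x y * ‖u y - u x‖ := by
        congr 1; funext y; rw [norm_mul, Real.norm_of_nonneg (kerR_nonneg hr x y)]
    _ ≤ _ := e2
    _ = _ := by
        rw [integral_const_mul, Function.comp, setAverage_eq, Measure.addHaar_real_closedBall'
          _ _ hr.le]
        have : volume.real (Metric.closedBall (0 : Euc N) 1) ≠ 0 := by
          have := Metric.measure_closedBall_pos (volume : Measure (Euc N)) 0 one_pos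
          exact (ENNReal.toReal_pos this.ne' (isCompact_closedBall _ _).measure_lt_top.ne).ne'
        simp only [smul_eq_mul, finrank_euclideanSpace, Fintype.card_fin]
        field_simp
        rw [mul_right_comm, ← mul_pow, one_div_mul_cancel hr.ne', one_pow, one_mul]

theorem sq_integral_mul_le {f g : Euc N → ℝ} (hf : MemLp f 2) (hg : MemLp g 2) :
    (∫ y, f y * g y) ^ 2 ≤ (∫ y, f y ^ 2) * ∫ y, g y ^ 2 := by
  have i1 := hf.integrable_sq
  have i2 := hg.integrable_sq
  have i3 : Integrable fun y => f y * g y := hf.integrable_mul hg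
  have key : ∀ t : ℝ, 0 ≤ (∫ y, g y ^ 2) * (t * t) + (2 * ∫ y, f y * g y) * t + ∫ y, f y ^ 2 := by
    intro t
    have e : (∫ y, g y ^ 2) * (t * t) + (2 * ∫ y, f y * g y) * t + ∫ y, f y ^ 2 =
        ∫ y, (t * g y + f y) ^ 2 := by
      have e1 : ∀ y, (t * g y + f y) ^ 2 = t * t * g y ^ 2 + (2 * t * (f y * g y) + f y ^ 2) :=
        fun y => by ring
      simp_rw [e1]
      have i4 : Integrable fun y => 2 * t * (f y * g y) + f y ^ 2 := (i3.const_mul _).add i1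
      rw [integral_add (i2.const_mul _) i4, integral_add (i3.const_mul _) i1, integral_const_mul,
        integral_const_mul]
      ring
    rw [e]
    exact integral_nonneg fun y => sq_nonneg _
  have := discrim_le_zero key
  unfold discrim at this
  nlinarith

theorem memLp_kerR {r : ℝ} (hr : 0 < r) (x : Euc N) : MemLp (kerR r x) 2 :=
  (continuous_kerR r x).memLp_of_hasCompactSupport (hasCompactSupport_kerR hr x)

theorem exists_avg_sq_le : ∃ A : ℝ, 0 < A ∧ ∀ u : Euc N → ℝ, MemLp u 2 → ∀ r > 0,
    ∀ x, (avg u r x) ^ 2 ≤ A * r⁻¹ ^ N * ∫ y, u y ^ 2 := by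
  refine ⟨bumpC N ^ 2 * (∫ z : Euc N, bumpR z ^ 2) + 1, ?_, fun u hu r hr x => ?_⟩
  · have : 0 ≤ ∫ z : Euc N, bumpR z ^ 2 := integral_nonneg fun z => sq_nonneg _
    have := sq_nonneg (bumpC N)
    positivity
  · refine (sq_integral_mul_le (memLp_kerR hr x) hu).trans ?_
    rw [integral_kerR_sq hr]
    have : 0 ≤ ∫ y, u y ^ 2 := integral_nonneg fun z => sq_nonneg _
    have h2 : 0 ≤ r⁻¹ ^ N := by positivity
    have h3 := mul_nonneg h2 this
    nlinarith

end Mean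

section Potential

variable {N : ℕ}

/-- The derivative of `x ↦ kerP s x y`. -/
def dkerP (s : ℝ) (x y : Euc N) : Euc N →L[ℝ] ℝ :=
  (s⁻¹ * kerR s x y) • innerSL ℝ (s⁻¹ • (y - x))

theorem hasFDerivAt_kerP_left (s : ℝ) (x y : Euc N) :
    HasFDerivAt (fun x => kerP s x y) (dkerP s x y) x := by
  have h1 : HasFDerivAt (fun x : Euc N => s⁻¹ • (y - x))
      (s⁻¹ • (-ContinuousLinearMap.id ℝ (Euc N))) x :=
    HasFDerivAt.const_smul (f := fun x : Euc N => y - x) ((hasFDerivAt_id x).const_sub y) s⁻¹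
  have h2 := ((hasFDerivAt_bumpP (s⁻¹ • (y - x))).comp x h1).const_mul (bumpC N * s⁻¹ ^ N)
  refine h2.congr_fderiv ?_
  ext v
  simp [dkerP, kerR]
  ring

theorem norm_dkerP_le {s : ℝ} (hs : 0 < s) (x y : Euc N) :
    ‖dkerP s x y‖ ≤ s⁻¹ * kerR s x y := by
  have h0 : 0 ≤ s⁻¹ * kerR s x y := mul_nonneg (by positivity) (kerR_nonneg hs x y)
  rw [dkerP, norm_smul, Real.norm_of_nonneg h0, innerSL_apply_norm]
  rcases le_or_gt s (dist y x) with h | h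
  · rw [kerR_eq_zero hs h]; simp
  · refine mul_le_of_le_one_right h0 ?_
    rw [norm_smul, Real.norm_of_nonneg (by positivity), ← dist_eq_norm, inv_mul_le_one₀ hs]
    exact h.le

theorem continuous_dkerP (s : ℝ) : Continuous (Function.uncurry (dkerP (N := N) s)) := by
  unfold dkerP kerR Function.uncurry
  have := continuous_bumpR (N := N)
  fun_prop

theorem measurable_kerP : Measurable fun q : ℝ × Euc N × Euc N => kerP q.1 q.2.1 q.2.2 := by
  unfold kerP
  have := (continuous_bumpP (N := N)).measurable
  fun_prop

theorem measurable_kerR : Measurable fun q : ℝ × Euc N × Euc N => kerR q.1 q.2.1 q.2.2 := by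
  unfold kerR
  have := (continuous_bumpR (N := N)).measurable
  fun_prop

/-- The weighted integral of `G` against the companion kernel at scale `s`. -/
def potK (G : Euc N → ℝ) (s : ℝ) (x : Euc N) : ℝ := ∫ y, kerP s x y * G y

/-- The derivative of `potK G s`. -/
def dpotK (G : Euc N → ℝ) (s : ℝ) (x : Euc N) : Euc N →L[ℝ] ℝ := ∫ y, G y • dkerP s x y

/-- The local potential of `G`, at scale `r`. -/
def pot (G : Euc N → ℝ) (r : ℝ) (x : Euc N) : ℝ := ∫ s in Ioc 0 r, s * potK G s x

theorem abs_potK_le {G : Euc N → ℝ} {B : ℝ} (hB : ∀ y, |G y| ≤ B) {s : ℝ}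
    (hs : 0 < s) (x : Euc N) : |potK G s x| ≤ B / 2 := by
  have hB0 : 0 ≤ B := (abs_nonneg _).trans (hB 0)
  calc |potK G s x| ≤ ∫ y, kerP s x y * B := by
        rw [← Real.norm_eq_abs]
        refine norm_integral_le_of_norm_le ((integrable_kerP hs x).mul_const B)
          (Eventually.of_forall fun y => ?_)
        rw [norm_mul, Real.norm_of_nonneg (kerP_nonneg hs x y)]
        exact mul_le_mul_of_nonneg_left (hB y) (kerP_nonneg hs x y)
    _ ≤ 1 / 2 * B := by
        rw [integral_mul_const]
        exact mul_le_mul_of_nonneg_right (integral_kerP_le hs x) hB0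
    _ = _ := by ring

theorem norm_dpotK_le {G : Euc N → ℝ} {B : ℝ} (hB : ∀ y, |G y| ≤ B) {s : ℝ}
    (hs : 0 < s) (x : Euc N) : ‖dpotK G s x‖ ≤ B * s⁻¹ := by
  have hB0 : 0 ≤ B := (abs_nonneg _).trans (hB 0)
  calc ‖dpotK G s x‖ ≤ ∫ y, B * (s⁻¹ * kerR s x y) := by
        refine norm_integral_le_of_norm_le (((integrable_kerR hs x).const_mul _).const_mul _)
          (Eventually.of_forall fun y => ?_)
        rw [norm_smul]
        exact mul_le_mul (hB y) (norm_dkerP_le hs x y) (norm_nonneg _) hB0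
    _ = B * s⁻¹ := by
        rw [integral_const_mul, integral_const_mul, integral_kerR hs, mul_one]

theorem stronglyMeasurable_potK {G : Euc N → ℝ} (hG : Measurable G) (x : Euc N) :
    StronglyMeasurable fun s => potK G s x := by
  refine StronglyMeasurable.integral_prod_right (f := fun s y => kerP s x y * G y)
    (Measurable.stronglyMeasurable ?_)
  have := measurable_kerP (N := N)
  exact (this.comp (by fun_prop : Measurable fun q : ℝ × Euc N => (q.1, x, q.2))).mul
    (hG.comp measurable_snd)

theorem stronglyMeasurable_dpotK {G : Euc N → ℝ} (hG : Measurable G) (x : Euc N) :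
    StronglyMeasurable fun s => dpotK G s x := by
  refine StronglyMeasurable.integral_prod_right (f := fun s y => G y • dkerP s x y)
    (Measurable.stronglyMeasurable ?_)
  have := measurable_kerR (N := N)
  have h1 := this.comp (by fun_prop : Measurable fun q : ℝ × Euc N => (q.1, x, q.2))
  refine (hG.comp measurable_snd).smul ((measurable_fst.inv.mul h1).smul ?_)
  exact (innerSL ℝ : Euc N →L⋆[ℝ] _).continuous.measurable.comp (by fun_prop)

theorem hasFDerivAt_potK {G : Euc N → ℝ} (hG : Integrable G) {s : ℝ} (hs : 0 < s) (x : Euc N) :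
    HasFDerivAt (potK G s) (dpotK G s x) x := by
  obtain ⟨C, hC0, hC⟩ := exists_kerR_le (N := N)
  refine hasFDerivAt_integral_of_dominated_of_fderiv_le (μ := volume) (s := univ)
    (F := fun x y => kerP s x y * G y) (F' := fun x y => G y • dkerP s x y)
    (bound := fun y => ‖G y‖ * (s⁻¹ * (C * s⁻¹ ^ N))) univ_mem
    (Eventually.of_forall fun x => (integrable_kerP_mul hG hs x).aestronglyMeasurable)
    (integrable_kerP_mul hG hs x) ?_ (Eventually.of_forall fun y x _ => ?_) (hG.norm.mul_const _)
    (Eventually.of_forall fun y x _ => ?_)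
  · exact hG.aestronglyMeasurable.smul ((continuous_dkerP s).comp
      (by fun_prop : Continuous fun y : Euc N => (x, y))).aestronglyMeasurable
  · rw [norm_smul]
    exact mul_le_mul_of_nonneg_left ((norm_dkerP_le hs x y).trans
      (mul_le_mul_of_nonneg_left (hC s hs x y) (by positivity))) (norm_nonneg _)
  · exact (hasFDerivAt_kerP_left s x y).mul_const (G y)

theorem continuous_dpotK {G : Euc N → ℝ} (hG : Integrable G) {s : ℝ} (hs : 0 < s) :
    Continuous (dpotK G s) := by
  obtain ⟨C, hC0, hC⟩ := exists_kerR_le (N := N)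
  refine continuous_of_dominated (F := fun x y => G y • dkerP s x y)
    (bound := fun y => ‖G y‖ * (s⁻¹ * (C * s⁻¹ ^ N))) (fun x => ?_)
    (fun x => Eventually.of_forall fun y => ?_) (hG.norm.mul_const _)
    (Eventually.of_forall fun y => ?_)
  · exact hG.aestronglyMeasurable.smul ((continuous_dkerP s).comp
      (by fun_prop : Continuous fun y : Euc N => (x, y))).aestronglyMeasurable
  · rw [norm_smul]
    exact mul_le_mul_of_nonneg_left ((norm_dkerP_le hs x y).trans
      (mul_le_mul_of_nonneg_left (hC s hs x y) (by positivity))) (norm_nonneg _)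
  · have h := (continuous_dkerP s).comp (by fun_prop : Continuous fun x : Euc N => (x, y))
    exact h.const_smul (G y)

theorem integrableOn_potK {G : Euc N → ℝ} (hG : Measurable G) {B : ℝ} (hB : ∀ y, |G y| ≤ B)
    (r : ℝ) (x : Euc N) : IntegrableOn (fun s => s * potK G s x) (Ioc 0 r) := by
  refine Measure.integrableOn_of_bounded (M := r * (B / 2)) (by simp)
    ((continuous_id.stronglyMeasurable.mul
      (stronglyMeasurable_potK hG x)).aestronglyMeasurable) ?_
  filter_upwards [ae_restrict_mem measurableSet_Ioc] with s hs
  rw [norm_mul, Real.norm_of_nonneg hs.1.le]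
  exact mul_le_mul hs.2 (abs_potK_le hB hs.1 x) (norm_nonneg _) (hs.1.le.trans hs.2)

theorem hasFDerivAt_pot {G : Euc N → ℝ} (hG : Measurable G) (hGi : Integrable G) {B : ℝ}
    (hB : ∀ y, |G y| ≤ B) (r : ℝ) (x : Euc N) :
    HasFDerivAt (pot G r) (∫ s in Ioc 0 r, s • dpotK G s x) x := by
  refine hasFDerivAt_integral_of_dominated_of_fderiv_le (μ := volume.restrict (Ioc 0 r))
    (s := univ) (F := fun x s => s * potK G s x) (F' := fun x s => s • dpotK G s x)
    (bound := fun s => B) univ_mem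
    (Eventually.of_forall fun x => (integrableOn_potK hG hB r x).aestronglyMeasurable)
    (integrableOn_potK hG hB r x)
    (continuous_id.stronglyMeasurable.smul (stronglyMeasurable_dpotK hG x)).aestronglyMeasurable
    ?_ (integrable_const _) ?_
  · filter_upwards [ae_restrict_mem measurableSet_Ioc] with s hs x _
    rw [norm_smul, Real.norm_of_nonneg hs.1.le]
    calc s * ‖dpotK G s x‖ ≤ s * (B * s⁻¹) :=
          mul_le_mul_of_nonneg_left (norm_dpotK_le hB hs.1 x) hs.1.le
      _ = B := by field_simp [hs.1.ne']
  · filter_upwards [ae_restrict_mem measurableSet_Ioc] with s hs x _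
    exact (hasFDerivAt_potK hGi hs.1 x).const_mul s

theorem contDiff_pot {G : Euc N → ℝ} (hG : Measurable G) (hGi : Integrable G) {B : ℝ}
    (hB : ∀ y, |G y| ≤ B) (r : ℝ) : ContDiff ℝ 1 (pot G r) := by
  refine contDiff_one_iff_hasFDerivAt.2 ⟨_, ?_, hasFDerivAt_pot hG hGi hB r⟩
  refine continuous_of_dominated (F := fun x s => s • dpotK G s x)
    (bound := fun s => B)
    (fun x => (continuous_id.stronglyMeasurable.smul
      (stronglyMeasurable_dpotK hG x)).aestronglyMeasurable) (fun x => ?_) (integrable_const _) ?_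
  · filter_upwards [ae_restrict_mem measurableSet_Ioc] with s hs
    rw [norm_smul, Real.norm_of_nonneg hs.1.le]
    calc s * ‖dpotK G s x‖ ≤ s * (B * s⁻¹) :=
          mul_le_mul_of_nonneg_left (norm_dpotK_le hB hs.1 x) hs.1.le
      _ = B := by field_simp [hs.1.ne']
  · filter_upwards [ae_restrict_mem measurableSet_Ioc] with s hs
    exact (continuous_dpotK hGi hs.1).const_smul s

theorem potK_eq_integral_add (G : Euc N → ℝ) (s : ℝ) (x : Euc N) :
    potK G s x = ∫ z, kerP s 0 z * G (x + z) := by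
  rw [potK, ← integral_add_left_eq_self _ x]
  congr 1; funext z
  simp [kerP]

theorem dpotK_apply {G : Euc N → ℝ} (hG : ContDiff ℝ 1 G) (hc : HasCompactSupport G) {s : ℝ}
    (hs : 0 < s) (x v : Euc N) :
    dpotK G s x v = potK (fun y => fderiv ℝ G y v) s x := by
  have hcont := hG.continuous_fderiv (by norm_num)
  obtain ⟨M, hM⟩ := (hc.fderiv (𝕜 := ℝ)).exists_bound_of_continuous hcont
  have hGi := hG.continuous.integrable_of_hasCompactSupport hc (μ := volume)
  have hP := integrable_kerP hs (0 : Euc N)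
  have key : HasFDerivAt (potK G s) (∫ z, kerP s 0 z • fderiv ℝ G (x + z)) x := by
    have e : potK G s = fun x => ∫ z, kerP s 0 z * G (x + z) :=
      funext fun x => potK_eq_integral_add G s x
    rw [e]
    refine hasFDerivAt_integral_of_dominated_of_fderiv_le (μ := volume) (s := univ)
      (F := fun x z => kerP s 0 z * G (x + z)) (F' := fun x z => kerP s 0 z • fderiv ℝ G (x + z))
      (bound := fun z => kerP s 0 z * M) univ_mem
      (Eventually.of_forall fun x => ?_) ?_ ?_ (Eventually.of_forall fun y x _ => ?_)
      (hP.mul_const _) (Eventually.of_forall fun z x _ => ?_)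
    · exact ((continuous_kerP s 0).mul
        (hG.continuous.comp (continuous_const.add continuous_id))).aestronglyMeasurable
    · exact ((continuous_kerP s 0).mul
        (hG.continuous.comp (continuous_const.add continuous_id))).integrable_of_hasCompactSupport
        (isTest_kerP hs (subset_univ _)).cpt.mul_right
    · exact ((continuous_kerP s 0).smul
        (hcont.comp (continuous_const.add continuous_id))).aestronglyMeasurable
    · rw [norm_smul, Real.norm_of_nonneg (kerP_nonneg hs _ _)]
      exact mul_le_mul_of_nonneg_left (hM _) (kerP_nonneg hs _ _)
    · have h1 := (hG.differentiable (by norm_num) (x + z)).hasFDerivAt.comp x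
        ((hasFDerivAt_id x).add_const z)
      exact (h1.const_mul (kerP s 0 z))
  rw [(hasFDerivAt_potK hGi hs x).unique key, potK_eq_integral_add,
    ContinuousLinearMap.integral_apply]
  · rfl
  · exact ((continuous_kerP s 0).smul
      (hcont.comp (continuous_const.add continuous_id))).integrable_of_hasCompactSupport
      (isTest_kerP hs (subset_univ _)).cpt.smul_right

end Potential

section Regularity

variable {N : ℕ}

theorem continuous_fderiv_apply_of_contDiff {G : Euc N → ℝ} (hG : ContDiff ℝ 1 G) (v : Euc N) :
    Continuous fun y => fderiv ℝ G y v :=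
  (hG.continuous_fderiv (by norm_num)).clm_apply continuous_const

theorem contDiff_two_pot {G : Euc N → ℝ} (hG : ContDiff ℝ 1 G) (hc : HasCompactSupport G)
    (r : ℝ) : ContDiff ℝ 2 (pot G r) := by
  have hGi := hG.continuous.integrable_of_hasCompactSupport hc (μ := volume)
  obtain ⟨B, hB⟩ := hc.exists_bound_of_continuous hG.continuous
  have e2 : (2 : WithTop ℕ∞) = 1 + 1 := by norm_num
  rw [e2, contDiff_succ_iff_fderiv_apply]
  refine ⟨(contDiff_pot hG.continuous.measurable hGi hB r).differentiable (by norm_num),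
    fun h => by simp at h, fun v => ?_⟩
  have hcv := hasCompactSupport_partial hc v
  have hcont := continuous_fderiv_apply_of_contDiff hG v
  obtain ⟨M, hM⟩ := hcv.exists_bound_of_continuous hcont
  have e : (fun x => fderiv ℝ (pot G r) x v) = pot (fun y => fderiv ℝ G y v) r := by
    funext x
    rw [(hasFDerivAt_pot hG.continuous.measurable hGi hB r x).fderiv,
      ContinuousLinearMap.integral_apply]
    · refine setIntegral_congr_fun measurableSet_Ioc fun s hs => ?_
      simp only [smul_apply, smul_eq_mul]
      rw [dpotK_apply hG hc hs.1]
    · refine Measure.integrableOn_of_bounded (M := B) (by simp)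
        ((continuous_id.stronglyMeasurable.smul
        (stronglyMeasurable_dpotK hG.continuous.measurable x)).aestronglyMeasurable) ?_
      filter_upwards [ae_restrict_mem measurableSet_Ioc] with s hs
      rw [norm_smul, Real.norm_of_nonneg hs.1.le]
      calc s * ‖dpotK G s x‖ ≤ s * (B * s⁻¹) :=
            mul_le_mul_of_nonneg_left (norm_dpotK_le hB hs.1 x) hs.1.le
        _ = B := by field_simp [hs.1.ne']
  rw [e]
  exact contDiff_pot hcont.measurable (hcont.integrable_of_hasCompactSupport hcv) hM r

theorem contDiff_avg {u : Euc N → ℝ} (hu : Integrable u) {r : ℝ} (hr : 0 < r) {n : ℕ∞} :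
    ContDiff ℝ n (avg u r) := by
  have h := (hasCompactSupport_kerR hr (0 : Euc N)).contDiff_convolution_right (n := n)
    (ContinuousLinearMap.mul ℝ ℝ) hu.locallyIntegrable (contDiff_kerR r 0)
  convert h using 1
  funext x
  simp only [avg, convolution, ContinuousLinearMap.mul_apply']
  congr 1; funext y
  rw [kerR_comm, mul_comm]
  simp [kerR]

/-- The precise representative of `u`, as the limit of its weighted means. -/
def rep (u : Euc N → ℝ) (x : Euc N) : ℝ := limUnder (𝓝[>] (0 : ℝ)) fun r => avg u r x

theorem rep_ae_eq {u : Euc N → ℝ} (hu : Integrable u) : rep u =ᵐ[volume] u := by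
  filter_upwards [ae_tendsto_avg hu] with x hx using hx.limUnder_eq

variable {Ω : Set (Euc N)} {u G : Euc N → ℝ} {B : ℝ}

theorem tendsto_avg_of_weak (hu : Integrable u) (hG : Measurable G)
    (hB : ∀ y, |G y| ≤ B)
    (weak : ∀ φ, IsTest Ω φ → ∫ y, u y * lap φ y = ∫ y, φ y * G y) {x : Euc N} {r : ℝ} (hr : 0 < r)
    (hx : Metric.closedBall x r ⊆ Ω) :
    Tendsto (fun s => avg u s x) (𝓝[>] 0) (𝓝 (avg u r x - pot G r x)) := by
  have h_int : ∀ a b : ℝ, 0 ≤ a → a ≤ b → b ≤ r →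
      IntervalIntegrable (fun s => s * potK G s x) volume a b := fun a b ha hab hb =>
    (intervalIntegrable_iff_integrableOn_Ioc_of_le hab).2
      ((integrableOn_potK hG hB r x).mono_set (Ioc_subset_Ioc ha hb))
  have hB0 : 0 ≤ B := (abs_nonneg _).trans (hB 0)
  have e : ∀ s, 0 < s → s ≤ r →
      avg u s x = avg u r x - pot G r x + ∫ t in (0 : ℝ)..s, t * potK G t x := by
    intro s hs hsr
    have h1 := intervalIntegral.integral_eq_sub_of_hasDerivAt (a := s) (b := r)
      (f := fun t => avg u t x) (f' := fun t => t * potK G t x) (fun t ht => by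
        rw [uIcc_of_le hsr] at ht
        have ht0 : 0 < t := hs.trans_le ht.1
        have := hasDerivAt_avg hu ht0 x
        rwa [weak _ (isTest_kerP ht0 ((Metric.closedBall_subset_closedBall ht.2).trans hx))]
          at this) (h_int s r hs.le hsr le_rfl)
    have h2 := intervalIntegral.integral_add_adjacent_intervals (h_int 0 s le_rfl hs.le hsr)
      (h_int s r hs.le hsr le_rfl)
    rw [intervalIntegral.integral_of_le hr.le] at h2
    change _ = pot G r x at h2
    linarith
  have h0 : Tendsto (fun s : ℝ => ∫ t in (0 : ℝ)..s, t * potK G t x) (𝓝[>] 0) (𝓝 0) := by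
    have hb : Tendsto (fun s : ℝ => r * (B / 2) * s) (𝓝[>] 0) (𝓝 0) := by
      have : Tendsto (fun s : ℝ => r * (B / 2) * s) (𝓝 0) (𝓝 (r * (B / 2) * 0)) :=
        tendsto_id.const_mul _
      rw [mul_zero] at this
      exact this.mono_left nhdsWithin_le_nhds
    refine squeeze_zero_norm' ?_ hb
    filter_upwards [Ioc_mem_nhdsGT hr] with s hs
    have := intervalIntegral.norm_integral_le_of_norm_le_const (a := 0) (b := s) (C := r * (B / 2))
      (f := fun t => t * potK G t x) (fun t ht => by
        rw [uIoc_of_le hs.1.le] at ht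
        rw [norm_mul, Real.norm_of_nonneg ht.1.le]
        exact mul_le_mul (ht.2.trans hs.2) (abs_potK_le hB ht.1 x) (norm_nonneg _) hr.le)
    rwa [sub_zero, abs_of_pos hs.1] at this
  have h1 := h0.const_add (avg u r x - pot G r x)
  rw [add_zero] at h1
  refine h1.congr' ?_
  filter_upwards [Ioc_mem_nhdsGT hr] with s hs using (e s hs.1 hs.2).symm

theorem rep_eq_of_weak (hu : Integrable u) (hG : Measurable G)
    (hB : ∀ y, |G y| ≤ B)
    (weak : ∀ φ, IsTest Ω φ → ∫ y, u y * lap φ y = ∫ y, φ y * G y) {x : Euc N} {r : ℝ} (hr : 0 < r)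
    (hx : Metric.closedBall x r ⊆ Ω) : rep u x = avg u r x - pot G r x :=
  (tendsto_avg_of_weak hu hG hB weak hr hx).limUnder_eq

theorem rep_eventuallyEq (hu : Integrable u) (hG : Measurable G)
    (hB : ∀ y, |G y| ≤ B)
    (weak : ∀ φ, IsTest Ω φ → ∫ y, u y * lap φ y = ∫ y, φ y * G y) {x : Euc N} {r : ℝ} (hr : 0 < r)
    (hx : Metric.closedBall x (3 * r) ⊆ Ω) :
    rep u =ᶠ[𝓝 x] fun y => avg u r y - pot G r y := by
  filter_upwards [Metric.ball_mem_nhds x hr] with y hy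
  refine rep_eq_of_weak hu hG hB weak hr (subset_trans ?_ hx)
  exact Metric.closedBall_subset_closedBall' (by linarith [Metric.mem_ball.1 hy])

theorem exists_closedBall_three_mul (hΩ : IsOpen Ω) {x : Euc N} (hx : x ∈ Ω) :
    ∃ r > 0, Metric.closedBall x (3 * r) ⊆ Ω := by
  obtain ⟨r, hr, h⟩ := Metric.nhds_basis_closedBall.mem_iff.1 (hΩ.mem_nhds hx)
  exact ⟨r / 3, by positivity, by rwa [mul_div_cancel₀ _ (by norm_num)]⟩

theorem contDiffOn_one_rep (hΩ : IsOpen Ω) (hu : Integrable u) (hG : Measurable G)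
    (hGi : Integrable G) (hB : ∀ y, |G y| ≤ B)
    (weak : ∀ φ, IsTest Ω φ → ∫ y, u y * lap φ y = ∫ y, φ y * G y) :
    ContDiffOn ℝ 1 (rep u) Ω := by
  intro x hx
  obtain ⟨r, hr, h⟩ := exists_closedBall_three_mul hΩ hx
  exact (((contDiff_avg hu hr (n := 1)).sub (contDiff_pot hG hGi hB r)).contDiffAt.congr_of_eventuallyEq
    (rep_eventuallyEq hu hG hB weak hr h)).contDiffWithinAt

/-- Multiplication by a smooth cutoff turns a local function into a global one. -/
theorem contDiff_bump_mul (hΩ : IsOpen Ω) {n : ℕ∞} (hG : ContDiffOn ℝ n G Ω) {x : Euc N}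
    (χ : ContDiffBump x) (hχ : Metric.closedBall x χ.rOut ⊆ Ω) :
    ContDiff ℝ n fun y => χ y * G y := by
  refine contDiff_iff_contDiffAt.2 fun y => ?_
  by_cases hy : y ∈ Metric.closedBall x χ.rOut
  · exact χ.contDiff.contDiffAt.mul (hG.contDiffAt (hΩ.mem_nhds (hχ hy)))
  · refine (contDiffAt_const (c := (0 : ℝ))).congr_of_eventuallyEq ?_
    filter_upwards [Metric.isClosed_closedBall.isOpen_compl.mem_nhds hy] with z hz
    rw [← χ.tsupport_eq] at hz
    rw [image_eq_zero_of_notMem_tsupport hz, zero_mul]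

theorem pot_congr {G' : Euc N → ℝ} {x : Euc N} {r : ℝ} (h : ∀ y ∈ Metric.ball x r, G y = G' y) :
    pot G r x = pot G' r x := by
  refine setIntegral_congr_fun measurableSet_Ioc fun s hs => ?_
  simp only [potK]
  congr 2; funext y
  rcases lt_or_ge (dist y x) s with hy | hy
  · rw [h y (hy.trans_le hs.2)]
  · rw [kerP_eq_zero hs.1 hy, zero_mul, zero_mul]

theorem contDiffOn_two_rep (hΩ : IsOpen Ω) (hu : Integrable u) (hG : Measurable G)
    (hB : ∀ y, |G y| ≤ B) (hG1 : ContDiffOn ℝ 1 G Ω)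
    (weak : ∀ φ, IsTest Ω φ → ∫ y, u y * lap φ y = ∫ y, φ y * G y) :
    ContDiffOn ℝ 2 (rep u) Ω := by
  intro x hx
  obtain ⟨r, hr, h⟩ := exists_closedBall_three_mul hΩ hx
  let χ : ContDiffBump x := ⟨2 * r, 3 * r, by positivity, by linarith⟩
  have h1 := contDiff_two_pot (contDiff_bump_mul hΩ (n := 1) hG1 χ h) χ.hasCompactSupport.mul_right r
  refine (((contDiff_avg hu hr (n := 2)).sub h1).contDiffAt.congr_of_eventuallyEq
    ?_).contDiffWithinAt
  filter_upwards [rep_eventuallyEq hu hG hB weak hr h, Metric.ball_mem_nhds x hr] with y hy hy2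
  rw [hy, pot_congr]
  intro z hz
  rw [χ.one_of_mem_closedBall, one_mul]
  have h3 := Metric.mem_ball.1 hz
  have h4 := Metric.mem_ball.1 hy2
  have h5 := dist_triangle z y x
  simp only [χ, Metric.mem_closedBall]
  linarith

theorem lap_congr_of_eventuallyEq {v w : Euc N → ℝ} {x : Euc N} (h : v =ᶠ[𝓝 x] w) :
    lap v x = lap w x := by
  unfold lap
  refine Finset.sum_congr rfl fun i _ => ?_
  have h1 : (fun y => fderiv ℝ v y (EuclideanSpace.single i 1)) =ᶠ[𝓝 x]
      fun y => fderiv ℝ w y (EuclideanSpace.single i 1) := by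
    filter_upwards [h.eventuallyEq_nhds] with y hy
    rw [hy.fderiv_eq]
  rw [h1.fderiv_eq]

theorem lap_rep (hΩ : IsOpen Ω) (hu : Integrable u) (hGi : Integrable G)
    (hG1 : ContinuousOn G Ω) (hr2 : ContDiffOn ℝ 2 (rep u) Ω)
    (weak : ∀ φ, IsTest Ω φ → ∫ y, u y * lap φ y = ∫ y, φ y * G y) {x : Euc N} (hx : x ∈ Ω) :
    lap (rep u) x = G x := by
  obtain ⟨r, hr, h⟩ := exists_closedBall_three_mul hΩ hx
  let χ : ContDiffBump x := ⟨2 * r, 3 * r, by positivity, by linarith⟩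
  set w : Euc N → ℝ := fun y => χ y * rep u y with hw_def
  have hw : ContDiff ℝ 2 w := contDiff_bump_mul hΩ (n := 2) hr2 χ h
  have hwc : HasCompactSupport w := χ.hasCompactSupport.mul_right
  have hwe : ∀ y ∈ Metric.ball x (2 * r), w y = rep u y := fun y hy => by
    rw [hw_def]; simp only
    rw [χ.one_of_mem_closedBall (Metric.ball_subset_closedBall hy), one_mul]
  have hsub : Metric.ball x (2 * r) ⊆ Ω := Metric.ball_subset_closedBall.trans
    ((Metric.closedBall_subset_closedBall (by linarith)).trans h)
  have hl : Continuous (lap w) := continuous_lap hw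
  have hae := Metric.isOpen_ball.ae_eq_zero_of_integral_contDiff_smul_eq_zero (μ := volume)
    (U := Metric.ball x (2 * r)) (f := fun y => lap w y - G y)
    ((hl.locallyIntegrable.sub hGi.locallyIntegrable).locallyIntegrableOn _) (by
      intro φ h1 h2 h3
      have h4 := weak φ ⟨h1, h2, h3.trans hsub⟩
      have h5 := integral_mul_lap_comm (contDiff_infty.1 h1 2) h2 hw hwc
      have h6 : ∫ y, lap φ y * w y = ∫ y, u y * lap φ y := by
        refine integral_congr_ae ?_
        filter_upwards [rep_ae_eq hu] with y hy
        by_cases hy2 : y ∈ tsupport φ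
        · rw [hwe y (h3 hy2), hy, mul_comm]
        · rw [lap_eq_zero_of_notMem_tsupport hy2, zero_mul, mul_zero]
      simp only [smul_eq_mul, mul_sub]
      rw [integral_sub, h5, h6, h4, sub_self]
      · exact (h1.continuous.mul hl).integrable_of_hasCompactSupport h2.mul_right
      · obtain ⟨M, hM⟩ := h2.exists_bound_of_continuous h1.continuous
        exact hGi.bdd_mul h1.continuous.aestronglyMeasurable (Eventually.of_forall hM))
  have h7 : lap w =ᵐ[volume.restrict (Metric.ball x (2 * r))] G := by
    rw [Filter.EventuallyEq, ae_restrict_iff' Metric.isOpen_ball.measurableSet]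
    filter_upwards [hae] with y hy hy2 using sub_eq_zero.1 (hy hy2)
  have h8 := Measure.eqOn_open_of_ae_eq h7 Metric.isOpen_ball hl.continuousOn (hG1.mono hsub)
  have hxb : x ∈ Metric.ball x (2 * r) := Metric.mem_ball_self (by linarith)
  rw [← h8 hxb]
  refine lap_congr_of_eventuallyEq ?_
  filter_upwards [Metric.isOpen_ball.mem_nhds hxb] with y hy using (hwe y hy).symm

end Regularity

section MeanInequalities

variable {N : ℕ} {Ω : Set (Euc N)} {u H : Euc N → ℝ}

theorem hasDerivAt_exp_sq (b s : ℝ) :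
    HasDerivAt (fun s : ℝ => Real.exp (b * s ^ 2 / 4)) (Real.exp (b * s ^ 2 / 4) * (b * s / 2)) s := by
  have h : HasDerivAt (fun s : ℝ => b * s ^ 2 / 4) (b * s / 2) s := by
    have := ((hasDerivAt_pow 2 s).const_mul b).div_const 4
    refine this.congr_deriv ?_
    push_cast; ring
  exact h.exp

theorem kerP_mul_ge (hu : Integrable u) (hu0 : ∀ y, 0 ≤ u y) {s : ℝ}
    (hs : 0 < s) (x : Euc N) : ∫ y, kerP s x y * u y ≤ 1 / 2 * avg u s x := by
  rw [avg, ← integral_const_mul]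
  refine integral_mono (integrable_kerP_mul hu hs x) ((integrable_kerR_mul hu hs x).const_mul _)
    fun y => ?_
  have := mul_le_mul_of_nonneg_right (two_mul_kerP_le_kerR hs x y) (hu0 y)
  simp only
  linarith

theorem avg_mul_exp_mono (hu : Integrable u) (hu0 : ∀ y, 0 ≤ u y) (hH : Integrable H) {B : ℝ}
    (hB : 0 ≤ B) (hHu : ∀ y, -(B * u y) ≤ H y)
    (weak : ∀ φ, IsTest univ φ → (∀ y, 0 ≤ φ y) → ∫ y, φ y * H y ≤ ∫ y, u y * lap φ y)
    (x : Euc N) : MonotoneOn (fun s => avg u s x * Real.exp (B * s ^ 2 / 4)) (Ioi 0) := by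
  have hd : ∀ s > 0, HasDerivAt (fun s => avg u s x * Real.exp (B * s ^ 2 / 4)) _ s :=
    fun s hs => (hasDerivAt_avg hu hs x).mul (hasDerivAt_exp_sq B s)
  refine monotoneOn_of_deriv_nonneg (convex_Ioi 0)
    (fun s hs => (hd s hs).continuousAt.continuousWithinAt)
    (fun s hs => (hd s (interior_subset hs)).differentiableAt.differentiableWithinAt) ?_
  intro s hs
  replace hs : 0 < s := interior_subset hs
  rw [(hd s hs).deriv]
  have h1 := weak _ (isTest_kerP hs (subset_univ _)) (kerP_nonneg hs x)
  have h2 : ∫ y, kerP s x y * -(B * u y) ≤ ∫ y, kerP s x y * H y :=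
    integral_mono (integrable_kerP_mul (hu.const_mul B).neg hs x) (integrable_kerP_mul hH hs x)
      fun y => mul_le_mul_of_nonneg_left (hHu y) (kerP_nonneg hs x y)
  have h3 : ∫ y, kerP s x y * -(B * u y) = -B * ∫ y, kerP s x y * u y := by
    rw [← integral_const_mul]; congr 1; funext y; ring
  have h4 := mul_le_mul_of_nonneg_left (kerP_mul_ge hu hu0 hs x) hB
  have h5 : -(B * (1 / 2 * avg u s x)) ≤ ∫ y, u y * lap (kerP s x) y := by linarith
  have h6 := mul_le_mul_of_nonneg_left h5 hs.le
  have h7 := (Real.exp_pos (B * s ^ 2 / 4)).le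
  have h8 : 0 ≤ s * (∫ y, u y * lap (kerP s x) y) + avg u s x * (B * s / 2) := by linarith
  nlinarith [mul_nonneg h7 h8]

theorem ae_le_avg_mul_exp (hu : Integrable u) (hu0 : ∀ y, 0 ≤ u y) (hH : Integrable H) {B : ℝ}
    (hB : 0 ≤ B) (hHu : ∀ y, -(B * u y) ≤ H y)
    (weak : ∀ φ, IsTest univ φ → (∀ y, 0 ≤ φ y) → ∫ y, φ y * H y ≤ ∫ y, u y * lap φ y) :
    ∀ᵐ x, ∀ r > 0, u x ≤ avg u r x * Real.exp (B * r ^ 2 / 4) := by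
  filter_upwards [ae_tendsto_avg hu] with x hx r hr
  have h1 : Tendsto (fun s : ℝ => Real.exp (B * s ^ 2 / 4)) (𝓝[>] 0) (𝓝 1) := by
    have := (hasDerivAt_exp_sq B 0).continuousAt.tendsto
    simp only [ne_eq, OfNat.ofNat_ne_zero, not_false_eq_true, zero_pow, mul_zero, zero_div,
      Real.exp_zero] at this
    exact this.mono_left nhdsWithin_le_nhds
  have h2 := hx.mul h1
  rw [mul_one] at h2
  refine le_of_tendsto h2 ?_
  filter_upwards [Ioc_mem_nhdsGT hr] with s hs
  exact avg_mul_exp_mono hu hu0 hH hB hHu weak x hs.1 hr hs.2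

theorem exists_sup_bound : ∃ A : ℝ, 0 < A ∧ ∀ u H : Euc N → ℝ, Integrable u → MemLp u 2 →
    (∀ y, 0 ≤ u y) → Integrable H → ∀ B : ℝ, 0 < B → (∀ y, -(B * u y) ≤ H y) →
    (∀ φ, IsTest univ φ → (∀ y, 0 ≤ φ y) → ∫ y, φ y * H y ≤ ∫ y, u y * lap φ y) →
    ∀ᵐ x, u x ^ 2 ≤ A * (√B) ^ N * ∫ y, u y ^ 2 := by
  obtain ⟨A, hA0, hA⟩ := exists_avg_sq_le (N := N)
  refine ⟨A * Real.exp (1 / 4) ^ 2, by positivity, fun u H hu hu2 hu0 hH B hB hHu weak => ?_⟩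
  filter_upwards [ae_le_avg_mul_exp hu hu0 hH hB.le hHu weak] with x hx
  have hsB : 0 < √B := Real.sqrt_pos.2 hB
  have h1 := hx (√B)⁻¹ (by positivity)
  have h2 := hA u hu2 (√B)⁻¹ (by positivity) x
  have e : B * (√B)⁻¹ ^ 2 / 4 = 1 / 4 := by
    rw [inv_pow, Real.sq_sqrt hB.le, mul_inv_cancel₀ hB.ne']
  rw [e] at h1
  rw [inv_inv] at h2
  calc u x ^ 2 ≤ (avg u (√B)⁻¹ x * Real.exp (1 / 4)) ^ 2 := pow_le_pow_left₀ (hu0 x) h1 2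
    _ = avg u (√B)⁻¹ x ^ 2 * Real.exp (1 / 4) ^ 2 := mul_pow _ _ _
    _ ≤ _ := mul_le_mul_of_nonneg_right h2 (by positivity)
    _ = _ := by ring

theorem avg_add_sq_mono (hu : Integrable u) (hH : Integrable H) {M : ℝ}
    (hM : 0 ≤ M) (hHu : ∀ y, -M ≤ H y)
    (weak : ∀ φ, IsTest univ φ → (∀ y, 0 ≤ φ y) → ∫ y, φ y * H y ≤ ∫ y, u y * lap φ y)
    (x : Euc N) : MonotoneOn (fun s => avg u s x + M * s ^ 2) (Ioi 0) := by
  have hd : ∀ s > 0, HasDerivAt (fun s => avg u s x + M * s ^ 2) _ s :=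
    fun s hs => (hasDerivAt_avg hu hs x).add ((hasDerivAt_pow 2 s).const_mul M)
  refine monotoneOn_of_deriv_nonneg (convex_Ioi 0)
    (fun s hs => (hd s hs).continuousAt.continuousWithinAt)
    (fun s hs => (hd s (interior_subset hs)).differentiableAt.differentiableWithinAt) ?_
  intro s hs
  replace hs : 0 < s := interior_subset hs
  rw [(hd s hs).deriv]
  have h1 := weak _ (isTest_kerP hs (subset_univ _)) (kerP_nonneg hs x)
  have h2 : ∫ y, kerP s x y * -M ≤ ∫ y, kerP s x y * H y :=
    integral_mono ((integrable_kerP hs x).mul_const _) (integrable_kerP_mul hH hs x)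
      fun y => mul_le_mul_of_nonneg_left (hHu y) (kerP_nonneg hs x y)
  rw [integral_mul_const] at h2
  have h3 := mul_le_mul_of_nonneg_right (integral_kerP_le hs x) hM
  have h5 : -(M / 2) ≤ ∫ y, u y * lap (kerP s x) y := by linarith
  have h6 := mul_le_mul_of_nonneg_left h5 hs.le
  have h7 := mul_nonneg hM hs.le
  push_cast
  rw [pow_one]
  linarith

theorem rep_le_avg_add_sq (hu : Integrable u) (hH : Integrable H) {M : ℝ}
    (hM : 0 ≤ M) (hHu : ∀ y, -M ≤ H y)
    (weak : ∀ φ, IsTest univ φ → (∀ y, 0 ≤ φ y) → ∫ y, φ y * H y ≤ ∫ y, u y * lap φ y)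
    {x : Euc N} (hx : Tendsto (fun s => avg u s x) (𝓝[>] 0) (𝓝 (rep u x))) {r : ℝ} (hr : 0 < r) :
    rep u x ≤ avg u r x + M * r ^ 2 := by
  refine le_of_tendsto hx ?_
  filter_upwards [Ioc_mem_nhdsGT hr] with s hs
  have h1 : avg u s x + M * s ^ 2 ≤ avg u r x + M * r ^ 2 :=
    avg_add_sq_mono hu hH hM hHu weak x hs.1 hr hs.2
  have h2 : 0 ≤ M * s ^ 2 := by positivity
  linarith

theorem tendsto_rep_of_weak {G : Euc N → ℝ} {B : ℝ} (hΩ : IsOpen Ω) (hu : Integrable u)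
    (hG : Measurable G) (hB : ∀ y, |G y| ≤ B)
    (weak : ∀ φ, IsTest Ω φ → ∫ y, u y * lap φ y = ∫ y, φ y * G y) {x : Euc N} (hx : x ∈ Ω) :
    Tendsto (fun s => avg u s x) (𝓝[>] 0) (𝓝 (rep u x)) := by
  obtain ⟨r, hr, h⟩ := Metric.nhds_basis_closedBall.mem_iff.1 (hΩ.mem_nhds hx)
  rw [rep_eq_of_weak hu hG hB weak hr h]
  exact tendsto_avg_of_weak hu hG hB weak hr h

/-- Local vanishing at an interior zero. -/
theorem ae_eq_zero_of_rep_eq_zero {G : Euc N → ℝ} {B Λ : ℝ} (hu : Integrable u)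
    (hu0 : ∀ y, 0 ≤ u y) (hG : Measurable G) (hGi : Integrable G) (hB : ∀ y, |G y| ≤ B)
    (weak : ∀ φ, IsTest Ω φ → ∫ y, u y * lap φ y = ∫ y, φ y * G y)
    (hΛ : 0 ≤ Λ) (hGu : ∀ y, G y ≤ Λ * u y) {x : Euc N} {r : ℝ} (hr : 0 < r)
    (hx : Metric.closedBall x r ⊆ Ω) (h0 : rep u x = 0) :
    ∀ᵐ y, y ∈ Metric.ball x r → u y = 0 := by
  have hd : ∀ s > 0, HasDerivAt (fun s => avg u s x * Real.exp (-Λ * s ^ 2 / 4)) _ s :=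
    fun s hs => (hasDerivAt_avg hu hs x).mul (hasDerivAt_exp_sq (-Λ) s)
  have anti : AntitoneOn (fun s => avg u s x * Real.exp (-Λ * s ^ 2 / 4)) (Ioc 0 r) := by
    refine antitoneOn_of_deriv_nonpos (convex_Ioc 0 r)
      (fun s hs => (hd s hs.1).continuousAt.continuousWithinAt)
      (fun s hs => (hd s (interior_subset hs).1).differentiableAt.differentiableWithinAt) ?_
    intro s hs
    replace hs := interior_subset hs
    rw [(hd s hs.1).deriv]
    have h1 := weak _ (isTest_kerP hs.1 ((Metric.closedBall_subset_closedBall hs.2).trans hx))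
    have h2 : ∫ y, kerP s x y * G y ≤ ∫ y, kerP s x y * (Λ * u y) :=
      integral_mono (integrable_kerP_mul hGi hs.1 x) (integrable_kerP_mul (hu.const_mul Λ) hs.1 x)
        fun y => mul_le_mul_of_nonneg_left (hGu y) (kerP_nonneg hs.1 x y)
    have h3 : ∫ y, kerP s x y * (Λ * u y) = Λ * ∫ y, kerP s x y * u y := by
      rw [← integral_const_mul]; congr 1; funext y; ring
    have h4 := mul_le_mul_of_nonneg_left (kerP_mul_ge hu hu0 hs.1 x) hΛ
    have h5 : ∫ y, u y * lap (kerP s x) y ≤ Λ * (1 / 2 * avg u s x) := by linarith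
    have h6 := mul_le_mul_of_nonneg_left h5 hs.1.le
    have h7 := (Real.exp_pos (-Λ * s ^ 2 / 4)).le
    have h8 : 0 ≤ -(s * (∫ y, u y * lap (kerP s x) y)) - avg u s x * (-Λ * s / 2) := by linarith
    nlinarith [mul_nonneg h7 h8]
  have ht := tendsto_avg_of_weak hu hG hB weak hr hx
  rw [← rep_eq_of_weak hu hG hB weak hr hx, h0] at ht
  have h1 : avg u r x * Real.exp (-Λ * r ^ 2 / 4) ≤ 0 := by
    refine ge_of_tendsto ht ?_
    filter_upwards [Ioc_mem_nhdsGT hr] with s hs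
    refine (anti hs ⟨hr, le_rfl⟩ hs.2).trans ?_
    refine mul_le_of_le_one_right (avg_nonneg hu0 hs.1 x) (Real.exp_le_one_iff.2 ?_)
    have : 0 ≤ Λ * s ^ 2 := by positivity
    linarith
  have h2 : avg u r x = 0 := le_antisymm (nonpos_of_mul_nonpos_left h1 (Real.exp_pos _))
    (avg_nonneg hu0 hr x)
  have h3 := (integral_eq_zero_iff_of_nonneg
    (fun y => mul_nonneg (kerR_nonneg hr x y) (hu0 y)) (integrable_kerR_mul hu hr x)).1 h2
  filter_upwards [h3] with y hy hyr
  refine (mul_eq_zero.1 hy).resolve_left (ne_of_gt ?_)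
  unfold kerR
  refine mul_pos (mul_pos bumpC_pos (by positivity)) (bumpR_pos ?_)
  rw [norm_smul, Real.norm_of_nonneg (by positivity), ← dist_eq_norm, inv_mul_lt_one₀ hr]
  exact hyr

theorem rep_eq_zero_of_ae {x : Euc N} {r : ℝ} (hr : 0 < r)
    (h : ∀ᵐ y, y ∈ Metric.ball x r → u y = 0) : rep u x = 0 := by
  refine (tendsto_const_nhds.congr' ?_ : Tendsto (fun s => avg u s x) (𝓝[>] 0) (𝓝 0)).limUnder_eq
  filter_upwards [Ioc_mem_nhdsGT hr] with s hs
  refine (integral_eq_zero_of_ae ?_).symm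
  filter_upwards [h] with y hy
  rcases lt_or_ge (dist y x) s with h1 | h1
  · simp [hy (h1.trans_le hs.2)]
  · simp [kerR_eq_zero hs.1 h1]

theorem strong_maximum {G : Euc N → ℝ} {B Λ : ℝ} (hΩ : IsOpen Ω) (hc : IsPreconnected Ω)
    (hu : Integrable u)
    (hu0 : ∀ y, 0 ≤ u y) (hG : Measurable G) (hGi : Integrable G) (hB : ∀ y, |G y| ≤ B)
    (weak : ∀ φ, IsTest Ω φ → ∫ y, u y * lap φ y = ∫ y, φ y * G y)
    (hΛ : 0 ≤ Λ) (hGu : ∀ y, G y ≤ Λ * u y) (hcont : ContinuousOn (rep u) Ω) :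
    (∀ x ∈ Ω, rep u x ≠ 0) ∨ ∀ x ∈ Ω, rep u x = 0 := by
  have o1 : IsOpen (Ω ∩ rep u ⁻¹' {0}ᶜ) :=
    hcont.isOpen_inter_preimage hΩ isOpen_compl_singleton
  have o2 : IsOpen (Ω ∩ rep u ⁻¹' {0}) := by
    refine isOpen_iff_mem_nhds.2 fun x hx => ?_
    obtain ⟨r, hr, h⟩ := Metric.nhds_basis_closedBall.mem_iff.1 (hΩ.mem_nhds hx.1)
    have h1 := ae_eq_zero_of_rep_eq_zero hu hu0 hG hGi hB weak hΛ hGu hr h hx.2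
    filter_upwards [Metric.ball_mem_nhds x hr] with y hy
    refine ⟨h (Metric.ball_subset_closedBall hy), ?_⟩
    obtain ⟨δ, hδ, hδ'⟩ := Metric.isOpen_iff.1 Metric.isOpen_ball y hy
    exact rep_eq_zero_of_ae hδ (h1.mono fun z hz hz' => hz (hδ' hz'))
  by_contra! hcon
  obtain ⟨⟨x, hx, hx0⟩, y, hy, hy0⟩ := hcon
  obtain ⟨z, hz, hz1, hz2⟩ := hc _ _ o1 o2 (fun z hz => by
    by_cases h : rep u z = 0
    · exact Or.inr ⟨hz, h⟩
    · exact Or.inl ⟨hz, h⟩) ⟨y, hy, hy, hy0⟩ ⟨x, hx, hx, hx0⟩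
  exact hz1.2 hz2.2

end MeanInequalities

section Boundary

variable {N : ℕ} {Ω : Set (Euc N)}

theorem exists_le_bumpR : ∃ b : ℝ, 0 < b ∧ ∀ z : Euc N, ‖z‖ ≤ 3 / 4 → b ≤ bumpR z := by
  obtain ⟨z, hz, hmin⟩ := (isCompact_closedBall (0 : Euc N) (3 / 4)).exists_isMinOn
    ⟨0, Metric.mem_closedBall_self (by norm_num)⟩ continuous_bumpR.continuousOn
  refine ⟨bumpR z, bumpR_pos ?_, fun w hw => hmin (by simpa using hw)⟩
  have : ‖z‖ ≤ 3 / 4 := by simpa using hz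
  linarith

/-- A function satisfying a mean value inequality and vanishing on a ball of size comparable to the
distance near `x₀` loses a fixed proportion of its supremum at each scale. -/
theorem exists_avg_decay {θ : ℝ} (h0 : 0 < θ) (h1 : θ < 1) : ∃ κ : ℝ, 0 < κ ∧
    ∀ (v : Euc N → ℝ) (x₀ z x : Euc N) (ε a : ℝ), Integrable v → 0 < ε → 0 ≤ a →
      (∀ y ∈ Metric.ball x₀ (5 * ε), v y ≤ a) → dist z x₀ ≤ ε →
      (∀ y ∈ Metric.ball z (θ * ε), v y = 0) → dist x x₀ < ε →
      avg v (4 * ε) x ≤ (1 - κ) * a := by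
  obtain ⟨b, hb0, hb⟩ := exists_le_bumpR (N := N)
  have hV : 0 < volume.real (Metric.ball (0 : Euc N) 1) :=
    ENNReal.toReal_pos (Metric.measure_ball_pos volume _ one_pos).ne' measure_ball_lt_top.ne
  refine ⟨bumpC N * b * (θ / 4) ^ N * volume.real (Metric.ball (0 : Euc N) 1), ?_, ?_⟩
  · have := bumpC_pos (N := N)
    positivity
  intro v x₀ z x ε a hv hε ha hva hz hvz hx
  set m := bumpC N * (4 * ε)⁻¹ ^ N * b with hm
  have hε4 : 0 < 4 * ε := by positivity
  have hker : ∀ y ∈ Metric.ball z (θ * ε), m ≤ kerR (4 * ε) x y := by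
    intro y hy
    refine mul_le_mul_of_nonneg_left (hb _ ?_) (mul_nonneg bumpC_pos.le (by positivity))
    rw [norm_smul, Real.norm_of_nonneg (by positivity), ← dist_eq_norm, inv_mul_le_iff₀ hε4]
    have h2 := Metric.mem_ball.1 hy
    have h3 := dist_triangle y z x
    have h4 := dist_triangle_right z x x₀
    nlinarith
  have hind : Integrable ((Metric.ball z (θ * ε)).indicator fun _ => m) :=
    (integrable_indicator_iff measurableSet_ball).2 (integrableOn_const measure_ball_lt_top.ne)
  have key : avg v (4 * ε) x ≤
      ∫ y, (kerR (4 * ε) x y - (Metric.ball z (θ * ε)).indicator (fun _ => m) y) * a := by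
    refine integral_mono (integrable_kerR_mul hv hε4 x)
      (((integrable_kerR hε4 x).sub hind).mul_const a) fun y => ?_
    simp only
    by_cases hy : y ∈ Metric.ball z (θ * ε)
    · rw [hvz y hy, mul_zero, indicator_of_mem hy]
      exact mul_nonneg (sub_nonneg.2 (hker y hy)) ha
    · rw [indicator_of_notMem hy, sub_zero]
      rcases lt_or_ge (dist y x) (4 * ε) with h | h
      · refine mul_le_mul_of_nonneg_left (hva y ?_) (kerR_nonneg hε4 x y)
        have h3 := dist_triangle y x x₀
        rw [Metric.mem_ball]; linarith
      · rw [kerR_eq_zero hε4 h]; simp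
  rw [integral_mul_const, integral_sub (integrable_kerR hε4 x) hind, integral_kerR hε4,
    integral_indicator_const _ measurableSet_ball,
    measureReal_def, Measure.addHaar_ball_of_pos _ _ (by positivity : 0 < θ * ε),
    ENNReal.toReal_mul, ENNReal.toReal_ofReal (by positivity), ← measureReal_def] at key
  refine key.trans_eq ?_
  simp only [finrank_euclideanSpace, Fintype.card_fin, smul_eq_mul, hm]
  have e : (θ * ε) ^ N * (4 * ε)⁻¹ ^ N = (θ / 4) ^ N := by
    rw [← mul_pow]; congr 1; field_simp
  rw [← e]; ring

theorem tendsto_zero_of_avg_decay {v : Euc N → ℝ} (hv0 : ∀ y, 0 ≤ v y) {K : ℝ}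
    (hvK : ∀ y, v y ≤ K) (hvi : Integrable v) (hoff : ∀ y ∉ Ω, v y = 0) {x₀ : Euc N} {θ : ℝ}
    (h0 : 0 < θ) (h1 : θ < 1)
    (hcone : ∀ ε > 0, ∃ z, dist z x₀ ≤ ε ∧ ∀ y ∈ Metric.ball z (θ * ε), y ∉ Ω) {M : ℝ}
    (hsub : ∀ x ∈ Ω, ∀ r > 0, v x ≤ avg v r x + M * r ^ 2) :
    Tendsto v (𝓝 x₀) (𝓝 0) := by
  obtain ⟨κ, hκ, hdecay⟩ := exists_avg_decay (N := N) h0 h1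
  let A : Set ℝ := {a | ∃ ε > 0, ∀ x ∈ Metric.ball x₀ ε, v x ≤ a}
  have hA0 : ∀ a ∈ A, 0 ≤ a := fun a ⟨ε, hε, h⟩ =>
    (hv0 x₀).trans (h x₀ (Metric.mem_ball_self hε))
  have hAne : A.Nonempty := ⟨K, 1, one_pos, fun x _ => hvK x⟩
  have hbdd : BddBelow A := ⟨0, hA0⟩
  have step : ∀ a ∈ A, ∀ δ > 0, max ((1 - κ) * a) 0 + δ ∈ A := by
    rintro a ⟨ε, hε, h⟩ δ hδ
    have ha := hA0 a ⟨ε, hε, h⟩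
    obtain ⟨η, hη, hη1, hη2⟩ : ∃ η > 0, 5 * η ≤ ε ∧ M * (4 * η) ^ 2 ≤ δ := by
      have h2 : Tendsto (fun η : ℝ => M * (4 * η) ^ 2) (𝓝 0) (𝓝 (M * (4 * 0) ^ 2)) := by
        apply Continuous.tendsto; fun_prop
      rw [mul_zero, zero_pow two_ne_zero, mul_zero] at h2
      have h3 := (h2.mono_left (nhdsWithin_le_nhds (s := Ioi (0 : ℝ)))).eventually_le_const hδ
      obtain ⟨η, h4, h5⟩ := (h3.and (Ioc_mem_nhdsGT (by positivity : 0 < ε / 5))).exists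
      exact ⟨η, h5.1, by linarith [h5.2], h4⟩
    refine ⟨η, hη, fun x hx => ?_⟩
    by_cases hxΩ : x ∈ Ω
    · obtain ⟨z, hz, hz'⟩ := hcone η hη
      have h5 := hdecay v x₀ z x η a hvi hη ha
        (fun y hy => h y (Metric.ball_subset_ball hη1 hy)) hz (fun y hy => hoff y (hz' y hy))
        (Metric.mem_ball.1 hx)
      have h6 := hsub x hxΩ (4 * η) (by positivity)
      have h7 := le_max_left ((1 - κ) * a) 0
      linarith
    · rw [hoff x hxΩ]
      have := le_max_right ((1 - κ) * a) 0
      linarith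
  have hL0 : 0 ≤ sInf A := le_csInf hAne hA0
  have hL : sInf A ≤ 0 := by
    by_contra! hpos
    obtain ⟨a, haA, ha⟩ := exists_lt_of_csInf_lt hAne
      (show sInf A < sInf A + κ * sInf A by nlinarith)
    have hae := hA0 a haA
    have h2 : sInf A ≤ a := csInf_le hbdd haA
    have h3 : max ((1 - κ) * a) 0 < sInf A := by
      refine max_lt ?_ hpos
      nlinarith
    have h4 := csInf_le hbdd (step a haA ((sInf A - max ((1 - κ) * a) 0) / 2) (by linarith))
    linarith
  refine Metric.tendsto_nhds.2 fun δ hδ => ?_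
  obtain ⟨a, ⟨ε, hε, h⟩, ha⟩ := exists_lt_of_csInf_lt hAne (hL.trans_lt hδ)
  filter_upwards [Metric.ball_mem_nhds x₀ hε] with x hx
  rw [Real.dist_eq, sub_zero, abs_of_nonneg (hv0 x)]
  exact (h x hx).trans_lt ha

end Boundary

section Domain

variable {N : ℕ} {Ω : Set (Euc N)} {f : Euc N → ℝ → ℝ} {d : Euc N → ℝ} {g : Euc N → ℝ → ℝ} {p : ℝ}
  {u : ℝ → Euc N → ℝ}

/-- The reflection in the `i`-th coordinate. -/
def coordRefl (i : Fin N) : Euc N ≃ₗᵢ[ℝ] Euc N :=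
  LinearIsometryEquiv.piLpCongrRight 2 fun j =>
    if j = i then LinearIsometryEquiv.neg ℝ else LinearIsometryEquiv.refl ℝ ℝ

theorem coordRefl_apply (i : Fin N) (x : Euc N) (j : Fin N) :
    coordRefl i x j = if j = i then - x j else x j := by
  simp only [coordRefl, LinearIsometryEquiv.piLpCongrRight_apply]
  split_ifs <;> simp

theorem Standing.coordRefl_mem (h : Standing N Ω f d g p u) (i : Fin N) {x : Euc N} (hx : x ∈ Ω) :
    coordRefl i x ∈ Ω := by
  obtain ⟨ℓ, -, β, -, -, -, hβ⟩ := h.symm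
  have := (hβ (coordRefl i) fun j x hx k hk => by
    rw [coordRefl_apply, hx k hk]; simp).1
  rw [← this]
  exact mem_image_of_mem _ hx

/-- Replace the `i`-th coordinate of `x` by `s`. -/
def setCoord (x : Euc N) (i : Fin N) (s : ℝ) : Euc N := WithLp.toLp 2 (Function.update x.ofLp i s)

theorem setCoord_same (x : Euc N) (i : Fin N) (s : ℝ) : setCoord x i s i = s := by
  simp [setCoord]

theorem setCoord_ne (x : Euc N) {i j : Fin N} (s : ℝ) (h : j ≠ i) : setCoord x i s j = x j := by
  simp [setCoord, h]

theorem Standing.setCoord_mem (h : Standing N Ω f d g p u) {x : Euc N} (hx : x ∈ Ω) (i : Fin N)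
    {s : ℝ} (hs : |s| ≤ |x i|) : setCoord x i s ∈ Ω ∧ ∀ t, f x t ≤ f (setCoord x i s) t := by
  have hmem : setCoord x i s ∈ Ω := by
    refine h.conv i x hx _ (h.coordRefl_mem i hx)
      (fun j hj => by rw [coordRefl_apply, if_neg hj]) ?_
    rcases eq_or_ne (x i) 0 with h0 | h0
    · have : setCoord x i s = x := by
        ext j
        rcases eq_or_ne j i with rfl | hj
        · rw [setCoord_same, h0]; simpa [h0] using hs
        · rw [setCoord_ne _ _ hj]
      rw [this]; exact left_mem_segment _ _ _
    · have h1 : |s / x i| ≤ 1 := by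
        rw [abs_div]; exact div_le_one_of_le₀ hs (abs_nonneg _)
      obtain ⟨h2, h3⟩ := abs_le.1 h1
      refine ⟨(1 + s / x i) / 2, (1 - s / x i) / 2, by linarith, by linarith, by ring, ?_⟩
      ext j
      simp only [PiLp.add_apply, PiLp.smul_apply, coordRefl_apply, smul_eq_mul]
      rcases eq_or_ne j i with rfl | hj
      · rw [setCoord_same, if_pos rfl]; field_simp; ring
      · rw [setCoord_ne _ _ hj, if_neg hj]; ring
  refine ⟨hmem, (h.mono i _ hmem x hx (fun j hj => setCoord_ne _ _ hj) ?_).1⟩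
  rwa [setCoord_same]

theorem Standing.mem_of_abs_le (h : Standing N Ω f d g p u) {x y : Euc N} (hx : x ∈ Ω)
    (hxy : ∀ i, |y i| ≤ |x i|) : y ∈ Ω ∧ ∀ t, f x t ≤ f y t := by
  have key : ∀ S : Finset (Fin N), ∃ z ∈ Ω, (∀ i ∈ S, z i = y i) ∧ (∀ i ∉ S, z i = x i) ∧
      ∀ t, f x t ≤ f z t := by
    intro S
    induction S using Finset.induction_on with
    | empty => exact ⟨x, hx, by simp, by simp, fun _ => le_rfl⟩
    | insert i S hi ih =>
      obtain ⟨z, hz, h1, h2, h3⟩ := ih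
      obtain ⟨h4, h5⟩ := h.setCoord_mem hz i (s := y i) (by rw [h2 i hi]; exact hxy i)
      refine ⟨_, h4, fun j hj => ?_, fun j hj => ?_, fun t => (h3 t).trans (h5 t)⟩
      · rcases eq_or_ne j i with rfl | hj'
        · exact setCoord_same _ _ _
        · rw [setCoord_ne _ _ hj', h1 j (Finset.mem_of_mem_insert_of_ne hj hj')]
      · rw [Finset.mem_insert, not_or] at hj
        rw [setCoord_ne _ _ hj.1, h2 j hj.2]
  obtain ⟨z, hz, h1, -, h3⟩ := key Finset.univ
  obtain rfl : z = y := by ext i; exact h1 i (Finset.mem_univ i)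
  exact ⟨hz, h3⟩

theorem Standing.zero_mem (h : Standing N Ω f d g p u) : (0 : Euc N) ∈ Ω := by
  obtain ⟨x, hx⟩ := h.conn.nonempty
  exact (h.mem_of_abs_le hx fun i => by simp).1

theorem Standing.le_zero (h : Standing N Ω f d g p u) {x : Euc N} (hx : x ∈ Ω) (t : ℝ) :
    f x t ≤ f 0 t :=
  (h.mem_of_abs_le hx fun i => by simp).2 t

theorem norm_le_of_forall_abs_le {x : Euc N} {a : ℝ} (ha : 0 ≤ a) (h : ∀ i, |x i| ≤ a) :
    ‖x‖ ≤ √N * a := by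
  rw [EuclideanSpace.norm_eq, ← Real.sqrt_sq ha, ← Real.sqrt_mul (by positivity)]
  refine Real.sqrt_le_sqrt ?_
  calc ∑ i, ‖x i‖ ^ 2 ≤ ∑ _i : Fin N, a ^ 2 :=
        Finset.sum_le_sum fun i _ => pow_le_pow_left₀ (norm_nonneg _) (h i) 2
    _ = _ := by simp

/-- The domain has an exterior cone at each point of its complement. -/
theorem Standing.exterior_cone (h : Standing N Ω f d g p u) : ∃ θ : ℝ, 0 < θ ∧ θ < 1 ∧
    ∀ x₀ ∉ Ω, ∀ ε > 0, ∃ z, dist z x₀ ≤ ε ∧ ∀ y ∈ Metric.ball z (θ * ε), y ∉ Ω := by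
  have hN : (1 : ℝ) < √N := by
    rw [Real.lt_sqrt (by norm_num)]
    have : (2 : ℝ) ≤ N := by exact_mod_cast h.dim
    linarith
  have hN0 : 0 < √(N : ℝ) := by linarith
  refine ⟨(√N)⁻¹, by positivity, inv_lt_one_of_one_lt₀ hN, fun x₀ hx₀ ε hε => ?_⟩
  let σ : Euc N := WithLp.toLp 2 fun i => if 0 ≤ x₀ i then ε / √N else -(ε / √N)
  have hσ : ∀ i, σ i = if 0 ≤ x₀ i then ε / √N else -(ε / √N) := fun i => rfl
  have hε' : 0 < ε / √N := by positivity
  refine ⟨x₀ + σ, ?_, fun y hy hyΩ => hx₀ (h.mem_of_abs_le hyΩ fun i => ?_).1⟩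
  · rw [dist_eq_norm, add_sub_cancel_left]
    refine (norm_le_of_forall_abs_le hε'.le fun i => ?_).trans_eq (by field_simp)
    rw [hσ]; split_ifs
    · rw [abs_of_pos hε']
    · rw [abs_neg, abs_of_pos hε']
  · have h1 : |y i - (x₀ i + σ i)| ≤ ε / √N := by
      have h2 := PiLp.norm_apply_le (y - (x₀ + σ)) i
      rw [Metric.mem_ball, dist_eq_norm] at hy
      have h3 : (√(N : ℝ))⁻¹ * ε = ε / √N := by field_simp
      rw [h3] at hy
      exact h2.trans hy.le
    rw [hσ] at h1
    obtain ⟨h2, h3⟩ := abs_le.1 h1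
    split_ifs at h2 h3 with h4
    · rw [abs_of_nonneg h4]
      exact le_trans (by linarith) (le_abs_self _)
    · rw [abs_of_neg (not_le.1 h4)]
      exact le_trans (by linarith) (neg_le_abs _)

theorem nonneg_of_ae_nonneg {w : Euc N → ℝ} (hΩ : IsOpen Ω) (hw : ContinuousOn w Ω)
    (h : ∀ᵐ x ∂(volume : Measure (Euc N)).restrict Ω, 0 ≤ w x) : ∀ x ∈ Ω, 0 ≤ w x := by
  intro x hx
  by_contra! hneg
  have ho : IsOpen (Ω ∩ w ⁻¹' Iio 0) := hw.isOpen_inter_preimage hΩ isOpen_Iio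
  have hpos : 0 < volume (Ω ∩ w ⁻¹' Iio 0) := ho.measure_pos volume ⟨x, hx, hneg⟩
  rw [ae_restrict_iff' hΩ.measurableSet] at h
  refine hpos.ne' (measure_mono_null ?_ h)
  intro y hy hy'
  exact absurd (hy' hy.1) (not_le.2 hy.2)

theorem Standing.continuousOn_uncurry (h : Standing N Ω f d g p u) :
    ContinuousOn (Function.uncurry f) (Ω ×ˢ univ) := h.f_c1.continuousOn

theorem Standing.continuousOn_left (h : Standing N Ω f d g p u) (t : ℝ) :
    ContinuousOn (fun x => f x t) Ω :=
  h.continuousOn_uncurry.comp (f := fun x => (x, t)) (by fun_prop) fun _ hx => ⟨hx, mem_univ _⟩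

theorem Standing.contDiff_right (h : Standing N Ω f d g p u) {x : Euc N} (hx : x ∈ Ω) :
    ContDiff ℝ 1 (f x) := by
  rw [← contDiffOn_univ]
  exact h.f_c1.comp (f := fun t => (x, t)) (by fun_prop) fun _ _ => ⟨hx, mem_univ _⟩

theorem Standing.ae_ratio_strictMono (h : Standing N Ω f d g p u) :
    ∀ᵐ x ∂(volume : Measure (Euc N)).restrict Ω, (∀ t > 0, 0 < f x t) ∧
      ∀ s t, 0 < s → s < t → f x s / s < f x t / t := by
  obtain ⟨a, b, ha, -, -, hae⟩ := h.f_ar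
  filter_upwards [hae, ae_restrict_mem h.isOpen.measurableSet] with x hx hxΩ
  have hpos : ∀ t > 0, 0 < f x t := by
    intro t ht
    have h1 := (hx t ht.ne').1
    have h2 : 0 < ((a - 1) * t) * f x t := by linarith [h1]
    exact pos_of_mul_pos_right h2 (mul_pos (by linarith) ht).le
  refine ⟨hpos, fun s t hs hst => ?_⟩
  have hd : Differentiable ℝ (f x) := (h.contDiff_right hxΩ).differentiable one_ne_zero
  refine strictMonoOn_of_deriv_pos (convex_Ioi (0 : ℝ)) (f := fun t => f x t / t)
    (hd.continuous.continuousOn.div continuousOn_id fun r hr => (mem_Ioi.1 hr).ne') ?_ hs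
    (hs.trans hst) hst
  intro r hr
  rw [interior_Ioi, mem_Ioi] at hr
  have hdv : HasDerivAt (fun t => f x t / t) ((deriv (f x) r * r - f x r * 1) / r ^ 2) r :=
    (hd r).hasDerivAt.div (hasDerivAt_id r) hr.ne'
  rw [hdv.deriv]
  have h1 := (hx r hr.ne').2.1
  have h2 := mul_pos (hpos r hr) hr
  have h3 : f x r * r < deriv (f x) r * r ^ 2 := by nlinarith
  have h4 : f x r < deriv (f x) r * r := by
    have : f x r * r < (deriv (f x) r * r) * r := by linarith
    exact lt_of_mul_lt_mul_right this hr.le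
  apply div_pos _ (by positivity)
  linarith

theorem Standing.nonneg (h : Standing N Ω f d g p u) {x : Euc N} (hx : x ∈ Ω) {t : ℝ} (ht : 0 ≤ t) :
    0 ≤ f x t := by
  rcases ht.eq_or_lt with rfl | ht
  · rw [(h.f_zero x hx).1]
  · refine nonneg_of_ae_nonneg h.isOpen (h.continuousOn_left t) ?_ x hx
    filter_upwards [h.ae_ratio_strictMono] with x hx using (hx.1 t ht).le

theorem Standing.ratio_mono (h : Standing N Ω f d g p u) {x : Euc N} (hx : x ∈ Ω) {s t : ℝ}
    (hs : 0 < s) (hst : s ≤ t) : f x s / s ≤ f x t / t := by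
  rcases hst.eq_or_lt with rfl | hst
  · exact le_rfl
  · refine sub_nonneg.1 (nonneg_of_ae_nonneg (w := fun x => f x t / t - f x s / s) h.isOpen
      (((h.continuousOn_left t).div_const _).sub ((h.continuousOn_left s).div_const _)) ?_ x hx)
    filter_upwards [h.ae_ratio_strictMono] with x hx using sub_nonneg.2 (hx.2 s t hs hst).le

/-- A truncation of the nonlinearity that grows linearly beyond `K`. -/
theorem Standing.exists_trunc (h : Standing N Ω f d g p u) {K : ℝ} (hK : 0 < K) :
    ∃ k : Euc N → ℝ → ℝ, Measurable (Function.uncurry k) ∧ (∀ x, Monotone (k x)) ∧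
      (∀ x t, t ≤ 0 → k x t = 0) ∧ (∀ x t, 0 ≤ t → k x t ≤ f 0 K / K * t) ∧
      (∀ x s t, 0 < s → s ≤ t → k x s * t ≤ k x t * s) ∧
      (∀ x ∉ Ω, ∀ t, k x t = 0) ∧ ∀ x ∈ Ω, ∀ t, 0 ≤ t → t ≤ K → k x t = f x t := by
  classical
  let fΩ : Euc N × ℝ → ℝ := (Ω ×ˢ univ).indicator (Function.uncurry f)
  have hfm : Measurable fΩ := by
    have := h.continuousOn_uncurry.measurable_piecewise (g := 0)
      continuousOn_const (h.isOpen.measurableSet.prod MeasurableSet.univ)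
    rwa [piecewise_eq_indicator] at this
  have hin : ∀ x ∈ Ω, ∀ t, fΩ (x, t) = f x t := fun x hx t =>
    indicator_of_mem (s := Ω ×ˢ univ) (a := (x, t)) ⟨hx, mem_univ _⟩ _
  have hout : ∀ x ∉ Ω, ∀ t, fΩ (x, t) = 0 := fun x hx t =>
    indicator_of_notMem (s := Ω ×ˢ univ) (a := (x, t)) (fun h => hx h.1) _
  refine ⟨fun x t => max t 0 * (fΩ (x, min t K) / min t K), ?_, ?_, ?_, ?_, ?_, ?_, ?_⟩
  · refine (measurable_snd.max measurable_const).mul ((hfm.comp ?_).div ?_)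
    · exact measurable_fst.prodMk (measurable_snd.min measurable_const)
    · exact measurable_snd.min measurable_const
  · intro x s t hst
    by_cases hx : x ∈ Ω
    · simp only [hin x hx]
      rcases le_or_gt s 0 with hs | hs
      · rw [max_eq_right hs, zero_mul]
        rcases le_or_gt t 0 with ht | ht
        · rw [max_eq_right ht, zero_mul]
        · exact mul_nonneg (le_max_right _ _)
            (div_nonneg (h.nonneg hx (lt_min ht hK).le) (lt_min ht hK).le)
      · have hms := lt_min hs hK
        refine mul_le_mul (max_le_max_right _ hst)
          (h.ratio_mono hx hms (min_le_min_right _ hst))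
          (div_nonneg (h.nonneg hx hms.le) hms.le) (le_max_right _ _)
    · simp [hout x hx]
  · intro x t ht
    simp only [max_eq_right ht, zero_mul]
  · intro x t ht
    simp only [max_eq_left ht]
    rcases ht.eq_or_lt with rfl | ht
    · simp
    rw [mul_comm]
    refine mul_le_mul_of_nonneg_right ?_ ht.le
    by_cases hx : x ∈ Ω
    · rw [hin x hx]
      refine (h.ratio_mono hx (lt_min ht hK) (min_le_right _ _)).trans ?_
      exact div_le_div_of_nonneg_right (h.le_zero hx K) hK.le
    · rw [hout x hx, zero_div]
      exact div_nonneg (h.nonneg h.zero_mem hK.le) hK.le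
  · intro x s t hs hst
    by_cases hx : x ∈ Ω
    · simp only [hin x hx, max_eq_left hs.le, max_eq_left (hs.le.trans hst)]
      have h1 := mul_le_mul_of_nonneg_left (h.ratio_mono hx (lt_min hs hK)
        (min_le_min_right K hst)) (mul_nonneg hs.le (hs.le.trans hst))
      linarith
    · simp [hout x hx]
  · intro x hx t
    simp [hout x hx]
  · intro x hx t ht htK
    simp only [hin x hx, max_eq_left ht, min_eq_left htK]
    rcases ht.eq_or_lt with rfl | ht
    · rw [(h.f_zero x hx).1]; simp
    · field_simp

theorem Standing.eventually_ratio_le (h : Standing N Ω f d g p u) :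
    ∀ᶠ K in atTop, f 0 K / K ≤ 2 * K ^ (p - 2) := by
  filter_upwards [(h.g_top 0 h.zero_mem).eventually_le_const one_pos, eventually_gt_atTop 0]
    with K h1 hK
  have h2 : K ^ (p - 1) = K ^ (p - 2) * K := by
    rw [← Real.rpow_add_one hK.ne']; congr 1; ring
  rw [div_le_one (by positivity), h2] at h1
  rw [div_le_iff₀ hK, h.f_split, h.d_zero, abs_of_pos hK]
  linarith

theorem Standing.eventually_growth (h : Standing N Ω f d g p u) (hp : p < 2 + 4 / N) {A L c : ℝ}
    (hA : 0 < A) (hL : 0 ≤ L) (hc : 0 < c) :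
    ∀ᶠ K : ℝ in atTop, A * √(2 * K ^ (p - 2) + L) ^ N * c < K ^ 2 := by
  have hN : (0 : ℝ) < N := by
    have := h.dim
    exact_mod_cast (by omega : 0 < N)
  have hexp : (p - 2) / 2 * N < 2 := by
    have : (p - 2) * N < 4 := by
      rw [← lt_div_iff₀ hN]; linarith
    linarith
  have h2 := h.hp.1
  have hlim := (tendsto_rpow_neg_atTop (sub_pos.2 hexp)).const_mul (A * √(2 + L) ^ N * c)
  rw [mul_zero] at hlim
  filter_upwards [hlim.eventually_lt_const one_pos, eventually_ge_atTop 1] with K h3 hK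
  have hK0 : 0 < K := by linarith
  have h4 : 1 ≤ K ^ (p - 2) := Real.one_le_rpow hK (by linarith)
  have h5 : √(2 * K ^ (p - 2) + L) ≤ √(2 + L) * K ^ ((p - 2) / 2) := by
    rw [Real.sqrt_le_iff]
    refine ⟨by positivity, ?_⟩
    rw [mul_pow, Real.sq_sqrt (by positivity), ← Real.rpow_natCast (K ^ _), ← Real.rpow_mul hK0.le]
    norm_num
    nlinarith
  have h6 : (K ^ ((p - 2) / 2)) ^ N = K ^ (-(2 - (p - 2) / 2 * N)) * K ^ 2 := by
    rw [← Real.rpow_natCast, ← Real.rpow_natCast, ← Real.rpow_mul hK0.le, ← Real.rpow_add hK0]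
    congr 1; push_cast; ring
  calc A * √(2 * K ^ (p - 2) + L) ^ N * c
      ≤ A * (√(2 + L) * K ^ ((p - 2) / 2)) ^ N * c := by gcongr
    _ = A * √(2 + L) ^ N * c * K ^ (-(2 - (p - 2) / 2 * N)) * K ^ 2 := by
        rw [mul_pow, h6]; ring
    _ < 1 * K ^ 2 := by gcongr
    _ = K ^ 2 := one_mul _

end Domain

section Rellich

variable {N : ℕ} {Ω : Set (Euc N)}

theorem sq_integral_weight_mul_le {α : Type*} [MeasurableSpace α] {μ : Measure α} {K g : α → ℝ}
    (hK : ∀ x, 0 ≤ K x) (iK : Integrable K μ) (h1 : ∫ x, K x ∂μ = 1)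
    (i1 : Integrable (fun x => K x * g x) μ) (i2 : Integrable (fun x => K x * g x ^ 2) μ) :
    (∫ x, K x * g x ∂μ) ^ 2 ≤ ∫ x, K x * g x ^ 2 ∂μ := by
  set m := ∫ x, K x * g x ∂μ with hm
  have h2 : 0 ≤ ∫ x, (K x * g x ^ 2 - 2 * m * (K x * g x) + m ^ 2 * K x) ∂μ :=
    integral_nonneg fun x => by
      have := mul_nonneg (hK x) (sq_nonneg (g x - m))
      simp only [Pi.zero_apply]
      linarith
  have i3 : Integrable (fun x => K x * g x ^ 2 - 2 * m * (K x * g x)) μ := i2.sub (i1.const_mul _)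
  rw [integral_add i3 (iK.const_mul _), integral_sub i2 (i1.const_mul _), integral_const_mul,
    integral_const_mul, h1, ← hm] at h2
  linarith

theorem integral_translate_sub_sq_le {φ : Euc N → ℝ} (hφ : ContDiff ℝ 1 φ)
    (hφ' : HasCompactSupport φ) (z : Euc N) :
    ∫ x, (φ (x + z) - φ x) ^ 2 ≤ ‖z‖ ^ 2 * ∫ x, ‖fderiv ℝ φ x‖ ^ 2 := by
  have hcont : Continuous (fderiv ℝ φ) := hφ.continuous_fderiv one_ne_zero
  have hgi := integrable_norm_fderiv_sq hφ hφ'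
  let ψ : Euc N → ℝ → ℝ := fun x t => ‖fderiv ℝ φ (x + t • z)‖ ^ 2
  have hψc : Continuous (Function.uncurry ψ) := by
    have : Continuous fun q : Euc N × ℝ => q.1 + q.2 • z := by fun_prop
    exact (hcont.comp this).norm.pow 2
  have h_int : Integrable (Function.uncurry ψ) (volume.prod (volume.restrict (Ioc (0 : ℝ) 1))) := by
    rw [integrable_prod_iff' hψc.aestronglyMeasurable]
    refine ⟨Eventually.of_forall fun t => hgi.comp_add_right (t • z), ?_⟩
    have : (fun t : ℝ => ∫ x, ‖Function.uncurry ψ (x, t)‖) =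
        fun _ => ∫ x, ‖fderiv ℝ φ x‖ ^ 2 := by
      ext t
      simp only [Function.uncurry, ψ, norm_pow, norm_norm]
      exact integral_add_right_eq_self (fun x => ‖fderiv ℝ φ x‖ ^ 2) (t • z)
    rw [this]
    exact integrable_const _
  have hpt : ∀ x, (φ (x + z) - φ x) ^ 2 ≤ ‖z‖ ^ 2 * ∫ t in Ioc (0 : ℝ) 1, ψ x t := by
    intro x
    have hd : ∀ t : ℝ, HasDerivAt (fun t : ℝ => φ (x + t • z)) (fderiv ℝ φ (x + t • z) z) t := by
      intro t
      have h1 : HasDerivAt (fun t : ℝ => x + t • z) z t := by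
        simpa using ((hasDerivAt_id t).smul_const z).const_add x
      exact ((hφ.differentiable one_ne_zero _).hasFDerivAt).comp_hasDerivAt t h1
    have hline : Continuous fun t : ℝ => x + t • z := by fun_prop
    have hc : Continuous fun t : ℝ => fderiv ℝ φ (x + t • z) z :=
      (hcont.comp hline).clm_apply continuous_const
    have h2 := intervalIntegral.integral_eq_sub_of_hasDerivAt (a := 0) (b := 1)
      (fun t _ => hd t) (hc.intervalIntegrable _ _)
    rw [intervalIntegral.integral_of_le zero_le_one, one_smul, zero_smul, add_zero] at h2
    have hI : ∀ w : ℝ → ℝ, Continuous w → Integrable w (volume.restrict (Ioc (0 : ℝ) 1)) :=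
      fun w hw => (hw.integrableOn_Icc (a := 0) (b := 1)).mono_set Ioc_subset_Icc_self
    have h3 := sq_integral_weight_mul_le (μ := volume.restrict (Ioc (0 : ℝ) 1)) (K := fun _ => 1)
      (g := fun t : ℝ => fderiv ℝ φ (x + t • z) z) (fun _ => zero_le_one) (integrable_const _)
      (by simp) (hI _ (by fun_prop)) (hI _ (by fun_prop))
    simp only [one_mul] at h3
    rw [h2] at h3
    refine h3.trans ?_
    rw [← integral_const_mul]
    refine integral_mono (hI _ (by fun_prop)) (hI _ ?_) fun t => ?_
    · exact continuous_const.mul ((hcont.comp hline).norm.pow 2)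
    · have h4 := (fderiv ℝ φ (x + t • z)).le_opNorm z
      rw [Real.norm_eq_abs] at h4
      simp only [ψ]
      rw [← mul_pow, ← sq_abs, mul_comm ‖z‖]
      exact pow_le_pow_left₀ (abs_nonneg _) h4 2
  have hcs : HasCompactSupport fun x => φ (x + z) := hφ'.comp_homeomorph (Homeomorph.addRight z)
  have hcl : Continuous fun x => φ (x + z) := hφ.continuous.comp (by fun_prop)
  have hm : MemLp (fun x => φ (x + z) - φ x) 2 :=
    (hcl.memLp_of_hasCompactSupport hcs).sub (hφ.continuous.memLp_of_hasCompactSupport hφ')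
  calc ∫ x, (φ (x + z) - φ x) ^ 2 ≤ ∫ x, ‖z‖ ^ 2 * ∫ t in Ioc (0 : ℝ) 1, ψ x t :=
        integral_mono hm.integrable_sq (h_int.integral_prod_left.const_mul _) hpt
    _ = ‖z‖ ^ 2 * ∫ x, ∫ t in Ioc (0 : ℝ) 1, ψ x t := integral_const_mul _ _
    _ = ‖z‖ ^ 2 * ∫ t in Ioc (0 : ℝ) 1, ∫ x, ψ x t := by rw [integral_integral_swap h_int]
    _ = ‖z‖ ^ 2 * ∫ t in Ioc (0 : ℝ) 1, ∫ x, ‖fderiv ℝ φ x‖ ^ 2 := by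
        congr 2 with t
        exact integral_add_right_eq_self (fun x => ‖fderiv ℝ φ x‖ ^ 2) (t • z)
    _ = _ := by simp

theorem kerR_add_right (r : ℝ) (x z : Euc N) : kerR r x (x + z) = kerR r 0 z := by
  unfold kerR; rw [add_sub_cancel_left, sub_zero]

theorem continuous_avg {φ : Euc N → ℝ} (hφ : Integrable φ) {r : ℝ} (hr : 0 < r) :
    Continuous (avg φ r) := by
  obtain ⟨C, hC0, hC⟩ := exists_kerR_le (N := N)
  refine continuous_of_dominated (bound := fun y => C * r⁻¹ ^ N * ‖φ y‖)
    (fun x => (integrable_kerR_mul hφ hr x).aestronglyMeasurable)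
    (fun x => Eventually.of_forall fun y => ?_) (hφ.norm.const_mul _)
    (Eventually.of_forall fun y => ?_)
  · rw [norm_mul, Real.norm_of_nonneg (kerR_nonneg hr x y)]
    exact mul_le_mul_of_nonneg_right (hC r hr x y) (norm_nonneg _)
  · have : (fun x => kerR r x y * φ y) = fun x => kerR r y x * φ y := by
      ext x; rw [kerR_comm]
    rw [this]
    exact (continuous_kerR r y).mul continuous_const

theorem avg_eq_zero {φ : Euc N → ℝ} {r R : ℝ} (hr : 0 < r)
    (hφ : ∀ y ∉ Metric.ball (0 : Euc N) R, φ y = 0) {x : Euc N}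
    (hx : x ∉ Metric.closedBall (0 : Euc N) (R + r)) : avg φ r x = 0 := by
  refine integral_eq_zero_of_ae (Eventually.of_forall fun y => ?_)
  simp only [Pi.zero_apply, mul_eq_zero]
  by_cases hy : y ∈ Metric.ball (0 : Euc N) R
  · left
    refine kerR_eq_zero hr ?_
    rw [Metric.mem_closedBall, not_le] at hx
    rw [Metric.mem_ball] at hy
    have := dist_triangle_left x 0 y
    linarith
  · exact Or.inr (hφ y hy)

theorem integral_avg_sub_sq_le {φ : Euc N → ℝ} (hφ : ContDiff ℝ 1 φ)
    (hφ' : HasCompactSupport φ) {r : ℝ} (hr : 0 < r) :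
    ∫ x, (avg φ r x - φ x) ^ 2 ≤ r ^ 2 * ∫ x, ‖fderiv ℝ φ x‖ ^ 2 := by
  have hφi : Integrable φ := hφ.continuous.integrable_of_hasCompactSupport hφ'
  obtain ⟨R, hR⟩ := hφ'.isCompact.isBounded.subset_ball (0 : Euc N)
  have hφ0 : ∀ y ∉ Metric.ball (0 : Euc N) R, φ y = 0 :=
    fun y hy => image_eq_zero_of_notMem_tsupport fun h => hy (hR h)
  set G := ∫ x, ‖fderiv ℝ φ x‖ ^ 2 with hG
  have hG0 : 0 ≤ G := integral_nonneg fun _ => by positivity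
  let k : Euc N → ℝ := kerR r 0
  have hk : Continuous k := continuous_kerR r 0
  have hkc : HasCompactSupport k := hasCompactSupport_kerR hr 0
  have hk0 : ∀ z, 0 ≤ k z := kerR_nonneg hr 0
  have ik : Integrable k := integrable_kerR hr 0
  have hk1 : ∫ z, k z = 1 := integral_kerR hr 0
  have hval : ∀ x, avg φ r x - φ x = ∫ z, k z * (φ (x + z) - φ x) := by
    intro x
    have i1 : Integrable fun z => k z * φ (x + z) :=
      (hk.mul (hφ.continuous.comp (by fun_prop))).integrable_of_hasCompactSupport hkc.mul_right
    simp only [mul_sub]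
    rw [integral_sub i1 (ik.mul_const _), integral_mul_const, hk1, one_mul]
    congr 1
    unfold avg
    rw [← integral_add_left_eq_self (fun y => kerR r x y * φ y) x]
    simp only [kerR_add_right, k]
  let ψ : Euc N → Euc N → ℝ := fun x z => k z * (φ (x + z) - φ x) ^ 2
  have hcd : Continuous fun q : Euc N × Euc N => φ (q.1 + q.2) - φ q.1 :=
    (hφ.continuous.comp (by fun_prop)).sub (hφ.continuous.comp (by fun_prop))
  have hψc : Continuous (Function.uncurry ψ) := (hk.comp continuous_snd).mul (hcd.pow 2)
  have hψs : HasCompactSupport (Function.uncurry ψ) := by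
    refine HasCompactSupport.intro
      ((isCompact_closedBall (0 : Euc N) (R + r)).prod (isCompact_closedBall (0 : Euc N) r)) ?_
    rintro ⟨x, z⟩ hxz
    simp only [Function.uncurry, ψ, mul_eq_zero, pow_eq_zero_iff, ne_eq, OfNat.ofNat_ne_zero,
      not_false_eq_true]
    by_cases hz : z ∈ Metric.closedBall (0 : Euc N) r
    · right
      have hx : x ∉ Metric.closedBall (0 : Euc N) (R + r) := fun h => hxz ⟨h, hz⟩
      simp only [Metric.mem_closedBall, dist_zero_right, not_le] at hx hz
      have h1 : ‖x‖ ≤ ‖x + z‖ + ‖z‖ := by simpa using norm_sub_le (x + z) z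
      rw [hφ0, hφ0, sub_zero]
      · simp only [Metric.mem_ball, dist_zero_right, not_lt]; linarith
      · simp only [Metric.mem_ball, dist_zero_right, not_lt]; linarith
    · left
      rw [Metric.mem_closedBall, not_le] at hz
      exact kerR_eq_zero hr hz.le
  have hψi : Integrable (Function.uncurry ψ) (volume.prod volume) :=
    hψc.integrable_of_hasCompactSupport hψs
  have hacs : HasCompactSupport (avg φ r) :=
    HasCompactSupport.intro (isCompact_closedBall (0 : Euc N) (R + r))
      fun x hx => avg_eq_zero hr hφ0 hx
  have hm : MemLp (fun x => avg φ r x - φ x) 2 :=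
    ((continuous_avg hφi hr).memLp_of_hasCompactSupport hacs).sub
      (hφ.continuous.memLp_of_hasCompactSupport hφ')
  calc ∫ x, (avg φ r x - φ x) ^ 2 ≤ ∫ x, ∫ z, ψ x z := by
        refine integral_mono hm.integrable_sq hψi.integral_prod_left fun x => ?_
        simp only [hval]
        have hcx : Continuous fun z => φ (x + z) - φ x :=
          (hφ.continuous.comp (by fun_prop)).sub continuous_const
        exact sq_integral_weight_mul_le hk0 ik hk1
          ((hk.mul hcx).integrable_of_hasCompactSupport hkc.mul_right)
          ((hk.mul (hcx.pow 2)).integrable_of_hasCompactSupport hkc.mul_right)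
    _ = ∫ z, ∫ x, ψ x z := integral_integral_swap hψi
    _ ≤ ∫ z, k z * (r ^ 2 * G) := by
        refine integral_mono hψi.integral_prod_right (ik.mul_const _) fun z => ?_
        simp only [ψ]
        rw [integral_const_mul]
        rcases lt_or_ge (dist z 0) r with h | h
        · refine mul_le_mul_of_nonneg_left ((integral_translate_sub_sq_le hφ hφ' z).trans ?_) (hk0 z)
          rw [dist_zero_right] at h
          gcongr
        · have : k z = 0 := kerR_eq_zero hr h
          simp [this]
    _ = r ^ 2 * G := by rw [integral_mul_const, hk1, one_mul]

end Rellich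

section Compactness

variable {N : ℕ} {Ω : Set (Euc N)}

theorem norm_toLp_sq {w : Euc N → ℝ} (hw : MemLp w 2) : ‖hw.toLp w‖ ^ 2 = ∫ x, w x ^ 2 := by
  rw [← real_inner_self_eq_norm_sq, L2.inner_def]
  refine integral_congr_ae ?_
  filter_upwards [hw.coeFn_toLp] with x hx
  rw [hx]; simp [sq]

theorem inner_toLp {v w : Euc N → ℝ} (hv : MemLp v 2) (hw : MemLp w 2) :
    inner ℝ (hv.toLp v) (hw.toLp w) = ∫ x, v x * w x := by
  rw [L2.inner_def]
  refine integral_congr_ae ?_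
  filter_upwards [hv.coeFn_toLp, hw.coeFn_toLp] with x hx hx'
  rw [hx, hx']; simp [mul_comm]

theorem exists_weak_subseq {φ : ℕ → Euc N → ℝ} (hφ : ∀ n, MemLp (φ n) 2) {C : ℝ}
    (hC : ∀ n, ∫ x, φ n x ^ 2 ≤ C) : ∃ σ : ℕ → ℕ, StrictMono σ ∧
      ∀ w : Euc N → ℝ, MemLp w 2 → ∃ l, Tendsto (fun n => ∫ x, φ (σ n) x * w x) atTop (𝓝 l) := by
  have : Fact ((2 : ENNReal) ≠ ⊤) := ⟨by simp⟩
  have : TopologicalSpace.SeparableSpace (Lp ℝ 2 (volume : Measure (Euc N))) := inferInstance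
  let ℓ : ℕ → WeakDual ℝ (Lp ℝ 2 (volume : Measure (Euc N))) := fun n =>
    WeakDual.toStrongDual.symm (InnerProductSpace.toDual ℝ _ ((hφ n).toLp (φ n)))
  obtain ⟨l, -, σ, hσ, hlim⟩ := WeakDual.isSeqCompact_closedBall ℝ
    (Lp ℝ 2 (volume : Measure (Euc N))) 0 (√C) (x := ℓ) fun n => by
      simp only [mem_preimage, Metric.mem_closedBall, dist_zero_right, ℓ,
        LinearEquiv.apply_symm_apply, LinearIsometryEquiv.norm_map]
      exact Real.le_sqrt_of_sq_le (by rw [norm_toLp_sq]; exact hC n)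
  refine ⟨σ, hσ, fun w hw => ⟨l (hw.toLp w), ?_⟩⟩
  have h1 := tendsto_iff_forall_eval_tendsto_topDualPairing.1 hlim (hw.toLp w)
  refine h1.congr fun n => ?_
  rw [← inner_toLp (hφ _) hw]
  rfl

theorem exists_limit_of_cauchy_sq {φ : ℕ → Euc N → ℝ} (hφ : ∀ n, MemLp (φ n) 2)
    (h : ∀ ε > 0, ∃ n₀, ∀ m ≥ n₀, ∀ n ≥ n₀, ∫ x, (φ m x - φ n x) ^ 2 < ε) :
    ∃ w : Euc N → ℝ, MemLp w 2 ∧ Tendsto (fun n => ∫ x, (φ n x - w x) ^ 2) atTop (𝓝 0) := by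
  let a : ℕ → Lp ℝ 2 (volume : Measure (Euc N)) := fun n => (hφ n).toLp (φ n)
  have ha : CauchySeq a := by
    refine Metric.cauchySeq_iff.2 fun ε hε => ?_
    obtain ⟨n₀, h0⟩ := h (ε ^ 2) (by positivity)
    refine ⟨n₀, fun m hm n hn => ?_⟩
    rw [dist_eq_norm]
    refine lt_of_pow_lt_pow_left₀ 2 hε.le ?_
    simp only [a]
    rw [← MemLp.toLp_sub, norm_toLp_sq]
    exact h0 m hm n hn
  obtain ⟨b, hb⟩ := cauchySeq_tendsto_of_complete ha
  have hbm : MemLp b 2 := Lp.memLp b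
  refine ⟨b, hbm, ?_⟩
  have h1 := (tendsto_iff_norm_sub_tendsto_zero.1 hb).pow 2
  rw [zero_pow two_ne_zero] at h1
  refine h1.congr fun n => ?_
  have h2 : a n - b = ((hφ n).sub hbm).toLp (φ n - (b : Euc N → ℝ)) := by
    rw [MemLp.toLp_sub (hφ n) hbm, Lp.toLp_coeFn b hbm]
  rw [h2, norm_toLp_sq]
  rfl

theorem add_sq_le_two (a b : ℝ) : (a + b) ^ 2 ≤ 2 * a ^ 2 + 2 * b ^ 2 := by
  nlinarith [sq_nonneg (a - b)]

theorem integral_sub_sq_le {a b c : Euc N → ℝ} (ha : MemLp a 2) (hb : MemLp b 2)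
    (hc : MemLp c 2) :
    ∫ x, (a x - c x) ^ 2 ≤ 2 * (∫ x, (a x - b x) ^ 2) + 2 * ∫ x, (b x - c x) ^ 2 := by
  have i1 : Integrable fun x => (a x - b x) ^ 2 := (ha.sub hb).integrable_sq
  have i2 : Integrable fun x => (b x - c x) ^ 2 := (hb.sub hc).integrable_sq
  rw [← integral_const_mul, ← integral_const_mul, ← integral_add (i1.const_mul _) (i2.const_mul _)]
  refine integral_mono (ha.sub hc).integrable_sq ((i1.const_mul _).add (i2.const_mul _)) fun x => ?_
  have := add_sq_le_two (a x - b x) (b x - c x)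
  rw [sub_add_sub_cancel] at this
  exact this

theorem IsTest.memLp {U : Set (Euc N)} {φ : Euc N → ℝ} (h : IsTest U φ) : MemLp φ 2 :=
  h.smooth.continuous.memLp_of_hasCompactSupport h.cpt

theorem IsTest.integrable {U : Set (Euc N)} {φ : Euc N → ℝ} (h : IsTest U φ) : Integrable φ :=
  h.smooth.continuous.integrable_of_hasCompactSupport h.cpt

/-- Rellich's compactness theorem for test functions. -/
theorem exists_strong_subseq (hΩ : Bornology.IsBounded Ω) {φ : ℕ → Euc N → ℝ}
    (hφ : ∀ n, IsTest Ω (φ n)) {C D : ℝ} (hC : ∀ n, ∫ x, φ n x ^ 2 ≤ C)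
    (hD : ∀ n, ∫ x, ‖fderiv ℝ (φ n) x‖ ^ 2 ≤ D) :
    ∃ σ : ℕ → ℕ, StrictMono σ ∧ ∃ w : Euc N → ℝ, MemLp w 2 ∧
      Tendsto (fun n => ∫ x, (φ (σ n) x - w x) ^ 2) atTop (𝓝 0) := by
  obtain ⟨σ, hσ, hw⟩ := exists_weak_subseq (fun n => (hφ n).memLp) hC
  refine ⟨σ, hσ, exists_limit_of_cauchy_sq (φ := fun n => φ (σ n)) (fun n => (hφ _).memLp)
    fun ε hε => ?_⟩
  have hD0 : 0 ≤ D := (integral_nonneg fun _ => by positivity).trans (hD 0)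
  have hC0 : 0 ≤ C := (integral_nonneg fun _ => by positivity).trans (hC 0)
  obtain ⟨r, hr, hrε⟩ : ∃ r > 0, r ^ 2 * D ≤ ε / 16 := by
    have h2 : Tendsto (fun r : ℝ => r ^ 2 * D) (𝓝 0) (𝓝 (0 ^ 2 * D)) := by
      apply Continuous.tendsto; fun_prop
    rw [zero_pow two_ne_zero, zero_mul] at h2
    have h3 := (h2.mono_left (nhdsWithin_le_nhds (s := Ioi (0 : ℝ)))).eventually_le_const
      (by positivity : 0 < ε / 16)
    obtain ⟨r, h4, h5⟩ := (h3.and self_mem_nhdsWithin).exists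
    exact ⟨r, h5, h4⟩
  obtain ⟨R, hR⟩ := hΩ.subset_ball (0 : Euc N)
  have hφ0 : ∀ n, ∀ y ∉ Metric.ball (0 : Euc N) R, φ n y = 0 :=
    fun n y hy => image_eq_zero_of_notMem_tsupport fun h => hy (hR ((hφ n).supp h))
  let a : ℕ → Euc N → ℝ := fun n => avg (φ (σ n)) r
  have hac : ∀ n, Continuous (a n) := fun n => continuous_avg (hφ _).integrable hr
  have ham : ∀ n, MemLp (a n) 2 := fun n =>
    (hac n).memLp_of_hasCompactSupport (HasCompactSupport.intro
      (isCompact_closedBall (0 : Euc N) (R + r)) fun x hx => avg_eq_zero hr (hφ0 _) hx)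
  obtain ⟨A, hA, hAle⟩ := exists_avg_sq_le (N := N)
  set B := A * r⁻¹ ^ N * C with hB
  have hB0 : 0 ≤ B := by positivity
  have hab : ∀ n x, a n x ^ 2 ≤ B := fun n x =>
    (hAle _ (hφ _).memLp r hr x).trans (mul_le_mul_of_nonneg_left (hC _) (by positivity))
  have hlim : Tendsto (fun q : ℕ × ℕ => ∫ x, (a q.1 x - a q.2 x) ^ 2) (atTop ×ˢ atTop) (𝓝 0) := by
    have h0 : (0 : ℝ) = ∫ _x : Euc N, (0 : ℝ) := by simp
    rw [h0]
    refine tendsto_integral_filter_of_dominated_convergence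
      ((Metric.closedBall (0 : Euc N) (R + r)).indicator fun _ => 4 * B)
      (Eventually.of_forall fun q => (((hac _).sub (hac _)).pow 2).aestronglyMeasurable)
      (Eventually.of_forall fun q => Eventually.of_forall fun x => ?_)
      ((integrable_indicator_iff Metric.isClosed_closedBall.measurableSet).2
        (integrableOn_const (measure_closedBall_lt_top).ne))
      (Eventually.of_forall fun x => ?_)
    · by_cases hx : x ∈ Metric.closedBall (0 : Euc N) (R + r)
      · rw [indicator_of_mem hx, Real.norm_of_nonneg (sq_nonneg _)]
        have := add_sq_le_two (a q.1 x) (-a q.2 x)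
        rw [← sub_eq_add_neg, neg_sq] at this
        linarith [hab q.1 x, hab q.2 x]
      · rw [indicator_of_notMem hx]
        simp only [a]
        rw [avg_eq_zero hr (hφ0 _) hx, avg_eq_zero hr (hφ0 _) hx]
        simp
    · obtain ⟨l, hl⟩ := hw _ (memLp_kerR hr x)
      have hl' : Tendsto (fun n => a n x) atTop (𝓝 l) := by
        refine hl.congr fun n => ?_
        simp only [a, avg, mul_comm]
      have := ((hl'.comp tendsto_fst).sub (hl'.comp tendsto_snd)).pow 2
      rw [sub_self, zero_pow two_ne_zero] at this
      exact this
  have hev := hlim.eventually_lt_const (by positivity : 0 < ε / 16)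
  rw [prod_atTop_atTop_eq, eventually_atTop] at hev
  obtain ⟨⟨p, q⟩, hpq⟩ := hev
  refine ⟨max p q, fun m hm n hn => ?_⟩
  have h1 := hpq (m, n) ⟨(le_max_left _ _).trans hm, (le_max_right _ _).trans hn⟩
  have h2 : ∀ n, ∫ x, (a n x - φ (σ n) x) ^ 2 ≤ ε / 16 := fun n =>
    ((integral_avg_sub_sq_le ((hφ _).smooth.of_le (by exact_mod_cast le_top)) (hφ _).cpt hr).trans
      (mul_le_mul_of_nonneg_left (hD _) (by positivity))).trans hrε
  have h3 : ∫ x, (φ (σ m) x - a m x) ^ 2 = ∫ x, (a m x - φ (σ m) x) ^ 2 :=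
    integral_congr_ae (Eventually.of_forall fun x => by simp only; ring)
  have h4 := integral_sub_sq_le (hφ (σ m)).memLp (ham m) (hφ (σ n)).memLp
  have h5 := integral_sub_sq_le (ham m) (ham n) (hφ (σ n)).memLp
  have h6 := h2 m
  have h7 := h2 n
  simp only at h1
  linarith

end Compactness

section Admissible

variable {N : ℕ} {Ω : Set (Euc N)}

/-- `w` is an `L²` limit of test functions with Dirichlet energy at most `D` in the limit. -/
def Adm (Ω : Set (Euc N)) (w : Euc N → ℝ) (D : ℝ) : Prop :=
  MemLp w 2 ∧ ∀ ε > 0, ∃ φ, IsTest Ω φ ∧ ∫ x, (φ x - w x) ^ 2 < ε ∧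
    ∫ x, ‖fderiv ℝ φ x‖ ^ 2 < D + ε

theorem IsTest.adm {φ : Euc N → ℝ} (h : IsTest Ω φ) : Adm Ω φ (∫ x, ‖fderiv ℝ φ x‖ ^ 2) :=
  ⟨h.memLp, fun ε hε => ⟨φ, h, by simpa using hε, by linarith⟩⟩

theorem IsTest.const_mul {φ : Euc N → ℝ} (h : IsTest Ω φ) (s : ℝ) :
    IsTest Ω fun x => s * φ x where
  smooth := contDiff_const.mul h.smooth
  cpt := h.cpt.mul_left
  supp := tsupport_mul_subset_right.trans h.supp

theorem integral_norm_fderiv_const_mul_sq (φ : Euc N → ℝ) (s : ℝ) :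
    ∫ x, ‖fderiv ℝ (fun y => s * φ y) x‖ ^ 2 = s ^ 2 * ∫ x, ‖fderiv ℝ φ x‖ ^ 2 := by
  rw [← integral_const_mul]
  congr 1 with x
  have : fderiv ℝ (fun y => s * φ y) x = s • fderiv ℝ φ x := by
    exact congrFun (fderiv_const_smul_field (𝕜 := ℝ) (f := φ) s) x
  rw [this, norm_smul, mul_pow, Real.norm_eq_abs, sq_abs]

namespace Adm

theorem nonneg {w : Euc N → ℝ} {D : ℝ} (h : Adm Ω w D) : 0 ≤ D := by
  by_contra! hD
  obtain ⟨φ, -, -, h1⟩ := h.2 (-D) (by linarith)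
  have : 0 ≤ ∫ x, ‖fderiv ℝ φ x‖ ^ 2 := integral_nonneg fun _ => by positivity
  linarith

theorem const_mul {w : Euc N → ℝ} {D : ℝ} (h : Adm Ω w D) (s : ℝ) :
    Adm Ω (fun x => s * w x) (s ^ 2 * D) := by
  refine ⟨h.1.const_mul s, fun ε hε => ?_⟩
  obtain ⟨φ, h1, h2, h3⟩ := h.2 (ε / (s ^ 2 + 1)) (by positivity)
  refine ⟨_, h1.const_mul s, ?_, ?_⟩
  · have : (fun x => (s * φ x - s * w x) ^ 2) = fun x => s ^ 2 * (φ x - w x) ^ 2 := by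
      ext x; ring
    rw [this, integral_const_mul]
    rw [lt_div_iff₀ (by positivity)] at h2
    have : 0 ≤ ∫ x, (φ x - w x) ^ 2 := integral_nonneg fun _ => by positivity
    nlinarith
  · rw [integral_norm_fderiv_const_mul_sq]
    have h4 : s ^ 2 * (ε / (s ^ 2 + 1)) < ε := by
      rw [mul_div_assoc', div_lt_iff₀ (by positivity)]
      nlinarith
    nlinarith [sq_nonneg s]

theorem ae_eq_zero {w : Euc N → ℝ} {D : ℝ} (h : Adm Ω w D) (hΩ : MeasurableSet Ω) :
    ∀ᵐ x, x ∉ Ω → w x = 0 := by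
  have h0 : ∫ x in Ωᶜ, w x ^ 2 = 0 := by
    refine le_antisymm (le_of_forall_pos_le_add fun ε hε => ?_)
      (integral_nonneg fun _ => by positivity)
    obtain ⟨φ, h1, h2, -⟩ := h.2 ε hε
    have h3 : ∫ x in Ωᶜ, w x ^ 2 = ∫ x in Ωᶜ, (φ x - w x) ^ 2 :=
      setIntegral_congr_fun hΩ.compl fun x hx => by
        rw [image_eq_zero_of_notMem_tsupport fun h => hx (h1.supp h)]
        ring
    rw [h3, zero_add]
    exact (setIntegral_le_integral (h1.memLp.sub h.1).integrable_sq
      (Eventually.of_forall fun _ => by positivity)).trans h2.le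
  rw [setIntegral_eq_zero_iff_of_nonneg_ae (Eventually.of_forall fun _ => by positivity)
    h.1.integrable_sq.integrableOn] at h0
  rw [EventuallyEq, ae_restrict_iff' hΩ.compl] at h0
  filter_upwards [h0] with x hx hx'
  exact pow_eq_zero_iff two_ne_zero |>.1 (hx hx')

theorem comp_sub {w : Euc N → ℝ} {D : ℝ} (h : Adm Ω w D) {ψ : Euc N → ℝ}
    (hψ : IsTest univ ψ) (t : ℝ) {β₀ : ℝ → ℝ} (hβ₀ : ∀ s r, |β₀ s - β₀ r| ≤ |s - r|)
    {S : Set (Euc N)} (hS : IsCompact S) (hSΩ : S ⊆ Ω) (h0 : ∀ x ∉ S, β₀ (-(t * ψ x)) = 0)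
    (hβ : ∀ δ > 0, ∃ β : ℝ → ℝ, ContDiff ℝ (⊤ : ℕ∞) β ∧ (∀ s, |deriv β s| ≤ 1) ∧
      (∀ s, |β s - β₀ s| ≤ δ) ∧ ∀ x ∉ S, β (-(t * ψ x)) = 0) :
    Adm Ω (fun x => β₀ (w x - t * ψ x))
      (D + 2 * t * (∫ x, w x * lap ψ x) + t ^ 2 * ∫ x, ‖fderiv ℝ ψ x‖ ^ 2) := by
  have hβ₀c : Continuous β₀ := by
    have : LipschitzWith 1 β₀ := LipschitzWith.of_dist_le_mul fun s r => by
      simpa [Real.dist_eq] using hβ₀ s r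
    exact this.continuous
  have hψ2 : ContDiff ℝ 2 ψ := contDiff_infty.1 hψ.smooth 2
  have hlap : MemLp (lap ψ) 2 :=
    (continuous_lap hψ2).memLp_of_hasCompactSupport (hasCompactSupport_lap hψ.cpt)
  have hw' : MemLp (fun x => β₀ (w x - t * ψ x)) 2 := by
    have h1 : MemLp (fun x => β₀ (-(t * ψ x))) 2 :=
      (hβ₀c.comp (continuous_const.mul hψ.smooth.continuous).neg).memLp_of_hasCompactSupport
        (HasCompactSupport.intro hS h0)
    refine (h.1.norm.add h1.norm).mono (hβ₀c.comp_aestronglyMeasurable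
      (h.1.sub (hψ.memLp.const_mul t)).aestronglyMeasurable) (Eventually.of_forall fun x => ?_)
    have h2 := hβ₀ (w x - t * ψ x) (-(t * ψ x))
    have h3 := abs_sub_abs_le_abs_sub (β₀ (w x - t * ψ x)) (β₀ (-(t * ψ x)))
    rw [sub_neg_eq_add, sub_add_cancel] at h2
    have h5 := le_abs_self (|w x| + |β₀ (-(t * ψ x))|)
    simp only [Pi.add_apply, Real.norm_eq_abs]
    linarith
  refine ⟨hw', fun ε hε => ?_⟩
  set L := |t| * √(∫ x, lap ψ x ^ 2) with hL
  have hL0 : 0 ≤ L := by positivity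
  set ε' := min (ε / 4) ((ε / (8 * (L + 1))) ^ 2) with hε'
  have hε'0 : 0 < ε' := lt_min (by positivity) (by positivity)
  obtain ⟨φ, h1, h2, h3⟩ := h.2 ε' hε'0
  have h4 : ε' ≤ ε / 4 := min_le_left _ _
  have hT : IsCompact (tsupport φ ∪ S) := h1.cpt.isCompact.union hS
  set V := volume.real (tsupport φ ∪ S) with hV
  have hV0 : 0 ≤ V := measureReal_nonneg
  obtain ⟨β, hβ1, hβ2, hβ3, hβ4⟩ := hβ (√(ε / (8 * (V + 1)))) (by positivity)
  set δ := √(ε / (8 * (V + 1))) with hδ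
  have hδ2 : δ ^ 2 = ε / (8 * (V + 1)) := Real.sq_sqrt (by positivity)
  have hz : ∀ x ∉ tsupport φ ∪ S, φ x = 0 ∧ β (φ x - t * ψ x) = 0 ∧
      β₀ (φ x - t * ψ x) = 0 := by
    intro x hx
    rw [mem_union, not_or] at hx
    rw [image_eq_zero_of_notMem_tsupport hx.1, zero_sub]
    exact ⟨rfl, hβ4 x hx.2, h0 x hx.2⟩
  have hφ1 : ContDiff ℝ 1 φ := contDiff_infty.1 h1.smooth 1
  have hχ : ContDiff ℝ (⊤ : ℕ∞) fun x => φ x - t * ψ x :=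
    h1.smooth.sub (contDiff_const.mul hψ.smooth)
  have htest : IsTest Ω fun x => β (φ x - t * ψ x) := by
    have hs : tsupport (fun x => β (φ x - t * ψ x)) ⊆ tsupport φ ∪ S := by
      refine closure_minimal (fun x hx => ?_) hT.isClosed
      by_contra h
      exact hx (hz x h).2.1
    exact ⟨hβ1.comp hχ, hT.of_isClosed_subset (isClosed_tsupport _) hs,
      hs.trans (union_subset h1.supp hSΩ)⟩
  refine ⟨_, htest, ?_, ?_⟩
  · have i1 : Integrable fun x => (φ x - w x) ^ 2 := (h1.memLp.sub h.1).integrable_sq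
    have i2 : Integrable ((tsupport φ ∪ S).indicator fun _ => 2 * δ ^ 2) :=
      (integrable_indicator_iff hT.measurableSet).2 (integrableOn_const hT.measure_lt_top.ne)
    calc ∫ x, (β (φ x - t * ψ x) - β₀ (w x - t * ψ x)) ^ 2
        ≤ ∫ x, (2 * (φ x - w x) ^ 2 + (tsupport φ ∪ S).indicator (fun _ => 2 * δ ^ 2) x) := by
          refine integral_mono (htest.memLp.sub hw').integrable_sq ((i1.const_mul 2).add i2)
            fun x => ?_
          have h5 := hβ₀ (φ x - t * ψ x) (w x - t * ψ x)
          rw [sub_sub_sub_cancel_right] at h5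
          simp only
          by_cases hx : x ∈ tsupport φ ∪ S
          · rw [indicator_of_mem hx]
            have h6 := hβ3 (φ x - t * ψ x)
            have h7 := add_sq_le_two (β (φ x - t * ψ x) - β₀ (φ x - t * ψ x))
              (β₀ (φ x - t * ψ x) - β₀ (w x - t * ψ x))
            rw [sub_add_sub_cancel] at h7
            have h8 := sq_le_sq.2 h5
            have h9 := sq_le_sq.2 (h6.trans (le_abs_self δ))
            linarith
          · rw [indicator_of_notMem hx]
            obtain ⟨-, h6, h7⟩ := hz x hx
            rw [h7] at h5
            rw [h6]
            have h8 := sq_le_sq.2 h5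
            nlinarith [sq_nonneg (φ x - w x)]
      _ = 2 * (∫ x, (φ x - w x) ^ 2) + V * (2 * δ ^ 2) := by
          rw [integral_add (i1.const_mul 2) i2, integral_const_mul,
            integral_indicator_const _ hT.measurableSet, smul_eq_mul]
      _ < ε := by
          have h5 : V * (2 * δ ^ 2) < ε / 2 := by
            rw [hδ2, show V * (2 * (ε / (8 * (V + 1)))) = V * ε / (4 * (V + 1)) by
              field_simp; ring, div_lt_iff₀ (by positivity)]
            nlinarith
          linarith
  · have h5 : ∫ x, ‖fderiv ℝ (fun x => β (φ x - t * ψ x)) x‖ ^ 2 ≤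
        ∫ x, ‖fderiv ℝ (fun y => φ y + -t * ψ y) x‖ ^ 2 := by
      have he : (fun y => φ y + -t * ψ y) = fun x => φ x - t * ψ x := by ext x; ring
      rw [he]
      refine integral_mono
        (integrable_norm_fderiv_sq (contDiff_infty.1 htest.smooth 1) htest.cpt)
        (integrable_norm_fderiv_sq (contDiff_infty.1 hχ 1)
          (h1.cpt.sub (hψ.const_mul t).cpt)) fun x => ?_
      have hd := ((hβ1.differentiable (by simp) _).hasDerivAt).comp_hasFDerivAt x
        ((hχ.differentiable (by simp) x).hasFDerivAt)
      have hd' : fderiv ℝ (fun x => β (φ x - t * ψ x)) x = _ := hd.fderiv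
      simp only
      rw [hd', norm_smul]
      refine pow_le_pow_left₀ (by positivity) ?_ 2
      exact mul_le_of_le_one_left (norm_nonneg _) (hβ2 _)
    rw [integral_norm_fderiv_add_sq hφ1 h1.cpt hψ2 hψ.cpt] at h5
    have h6 := sq_integral_mul_le (h1.memLp.sub h.1) hlap
    have h7 : ∫ x, (φ - w) x * lap ψ x = (∫ x, φ x * lap ψ x) - ∫ x, w x * lap ψ x := by
      have i1 : Integrable fun x => φ x * lap ψ x := h1.memLp.integrable_mul hlap
      have i2 : Integrable fun x => w x * lap ψ x := h.1.integrable_mul hlap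
      rw [← integral_sub i1 i2]
      congr 1 with x
      simp only [Pi.sub_apply]; ring
    rw [h7] at h6
    have h8 : t * ((∫ x, φ x * lap ψ x) - ∫ x, w x * lap ψ x) ≤ ε / 8 := by
      refine le_of_abs_le (abs_le_of_sq_le_sq ?_ (by positivity))
      rw [mul_pow]
      have hl0 : 0 ≤ ∫ x, lap ψ x ^ 2 := integral_nonneg fun _ => by positivity
      have hLsq : L ^ 2 = t ^ 2 * ∫ x, lap ψ x ^ 2 := by
        rw [hL, mul_pow, sq_abs, Real.sq_sqrt hl0]
      calc t ^ 2 * ((∫ x, φ x * lap ψ x) - ∫ x, w x * lap ψ x) ^ 2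
          ≤ t ^ 2 * (ε' * ∫ x, lap ψ x ^ 2) := by
            refine mul_le_mul_of_nonneg_left (h6.trans ?_) (sq_nonneg t)
            exact mul_le_mul_of_nonneg_right h2.le hl0
        _ = ε' * L ^ 2 := by rw [hLsq]; ring
        _ ≤ (ε / (8 * (L + 1))) ^ 2 * (L + 1) ^ 2 := by
            gcongr
            · exact min_le_right _ _
            · linarith
        _ = (ε / 8) ^ 2 := by rw [← mul_pow]; congr 1; field_simp
    nlinarith

theorem abs {w : Euc N → ℝ} {D : ℝ} (h : Adm Ω w D) : Adm Ω (fun x => |w x|) D := by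
  have hψ : IsTest (univ : Set (Euc N)) fun _ => 0 :=
    ⟨contDiff_const, HasCompactSupport.zero, subset_univ _⟩
  have key := h.comp_sub hψ 0 (β₀ := fun s => |s|) (S := ∅) (fun s r => abs_abs_sub_abs_le_abs_sub s r)
    isCompact_empty (empty_subset _) (by simp) fun δ hδ => ?_
  · simpa using key
  have hpos : ∀ s : ℝ, 0 < s ^ 2 + δ ^ 2 := fun s => by positivity
  refine ⟨fun s => √(s ^ 2 + δ ^ 2) - δ, ?_, fun s => ?_, fun s => ?_, fun x _ => ?_⟩
  · exact (ContDiff.sqrt (by fun_prop) fun s => (hpos s).ne').sub contDiff_const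
  · have hd : HasDerivAt (fun s : ℝ => √(s ^ 2 + δ ^ 2) - δ) (2 * s / (2 * √(s ^ 2 + δ ^ 2))) s := by
      have h1 : HasDerivAt (fun s : ℝ => s ^ 2 + δ ^ 2) (2 * s) s := by
        simpa using (hasDerivAt_pow 2 s).add_const (δ ^ 2)
      exact (h1.sqrt (hpos s).ne').sub_const δ
    rw [hd.deriv, mul_div_mul_left _ _ two_ne_zero, abs_div, abs_of_nonneg (Real.sqrt_nonneg _)]
    refine div_le_one_of_le₀ (Real.abs_le_sqrt ?_) (Real.sqrt_nonneg _)
    linarith [sq_nonneg δ]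
  · have h1 : |s| ≤ √(s ^ 2 + δ ^ 2) := Real.abs_le_sqrt (by linarith [sq_nonneg δ])
    have h2 : √(s ^ 2 + δ ^ 2) ≤ |s| + δ := by
      rw [Real.sqrt_le_iff]
      refine ⟨by positivity, ?_⟩
      nlinarith [sq_abs s, abs_nonneg s]
    rw [abs_le]; constructor <;> linarith
  · simp [Real.sqrt_sq hδ.le]

theorem sub_test {w : Euc N → ℝ} {D : ℝ} (h : Adm Ω w D) {ψ : Euc N → ℝ} (hψ : IsTest Ω ψ)
    (t : ℝ) : Adm Ω (fun x => w x - t * ψ x)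
      (D + 2 * t * (∫ x, w x * lap ψ x) + t ^ 2 * ∫ x, ‖fderiv ℝ ψ x‖ ^ 2) := by
  have hz : ∀ x ∉ tsupport ψ, -(t * ψ x) = 0 := fun x hx => by
    rw [image_eq_zero_of_notMem_tsupport hx]; simp
  exact h.comp_sub ⟨hψ.smooth, hψ.cpt, subset_univ _⟩ t (β₀ := id) (fun s r => le_rfl)
    hψ.cpt.isCompact hψ.supp hz
    fun δ hδ => ⟨id, contDiff_id, by simp, by simpa using hδ.le, hz⟩

theorem posPart_sub {w : Euc N → ℝ} {D : ℝ} (h : Adm Ω w D) {ψ : Euc N → ℝ}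
    (hψ : IsTest univ ψ) (hψ0 : ∀ x, 0 ≤ ψ x) {t : ℝ} (ht : 0 ≤ t) :
    Adm Ω (fun x => max (w x - t * ψ x) 0)
      (D + 2 * t * (∫ x, w x * lap ψ x) + t ^ 2 * ∫ x, ‖fderiv ℝ ψ x‖ ^ 2) := by
  have hneg : ∀ x, -(t * ψ x) ≤ 0 := fun x => by
    have := mul_nonneg ht (hψ0 x); linarith
  refine h.comp_sub hψ t (β₀ := fun s => max s 0) (S := ∅)
    (fun s r => abs_max_sub_max_le_abs s r 0) isCompact_empty (empty_subset _)
    (fun x _ => max_eq_right (hneg x)) fun δ hδ => ?_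
  have hd : ∀ s : ℝ, HasDerivAt (fun s => s * expNegInvGlue (s / δ))
      (1 * expNegInvGlue (s / δ) + s * (((s / δ)⁻¹) ^ 2 * expNegInvGlue (s / δ) * (1 / δ))) s := by
    intro s
    have h1 := expNegInvGlue.hasDerivAt_polynomial_eval_inv_mul 1 (s / δ)
    simp only [Polynomial.eval_one, one_mul, Polynomial.derivative_one, sub_zero, mul_one,
      Polynomial.eval_pow, Polynomial.eval_X] at h1
    have h2 : HasDerivAt (fun s => expNegInvGlue (s / δ))
        (((s / δ)⁻¹) ^ 2 * expNegInvGlue (s / δ) * (1 / δ)) s :=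
      HasDerivAt.comp s (h₂ := expNegInvGlue) h1 ((hasDerivAt_id s).div_const δ)
    exact (hasDerivAt_id s).mul h2
  refine ⟨fun s => s * expNegInvGlue (s / δ), ?_, fun s => ?_, fun s => ?_, fun x _ => ?_⟩
  · exact contDiff_id.mul (expNegInvGlue.contDiff.comp (contDiff_id.div_const δ))
  · rw [(hd s).deriv]
    rcases le_or_gt s 0 with hs | hs
    · rw [expNegInvGlue.zero_of_nonpos (div_nonpos_of_nonpos_of_nonneg hs hδ.le)]; simp
    · have hs' : 0 < s / δ := by positivity
      have h1 : expNegInvGlue (s / δ) = Real.exp (-(δ / s)) := by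
        rw [expNegInvGlue, if_neg hs'.not_ge, inv_div]
      have h2 : 1 * expNegInvGlue (s / δ) + s * (((s / δ)⁻¹) ^ 2 * expNegInvGlue (s / δ) * (1 / δ))
          = (δ / s + 1) * Real.exp (-(δ / s)) := by
        rw [h1]; field_simp; ring
      rw [h2, abs_of_nonneg (by positivity)]
      calc (δ / s + 1) * Real.exp (-(δ / s)) ≤ Real.exp (δ / s) * Real.exp (-(δ / s)) := by
            gcongr; exact Real.add_one_le_exp _
        _ = 1 := by rw [← Real.exp_add]; simp
  · change |s * expNegInvGlue (s / δ) - max s 0| ≤ δ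
    rcases le_or_gt s 0 with hs | hs
    · rw [expNegInvGlue.zero_of_nonpos (div_nonpos_of_nonpos_of_nonneg hs hδ.le), max_eq_right hs]
      simpa using hδ.le
    · have hs' : 0 < s / δ := by positivity
      have h1 : expNegInvGlue (s / δ) = Real.exp (-(δ / s)) := by
        rw [expNegInvGlue, if_neg hs'.not_ge, inv_div]
      have h2 : -(δ / s) + 1 ≤ Real.exp (-(δ / s)) := Real.add_one_le_exp _
      have h3 : Real.exp (-(δ / s)) ≤ 1 := Real.exp_le_one_iff.2 (by
        have : 0 < δ / s := by positivity
        linarith)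
      rw [h1, max_eq_left hs.le, abs_le]
      have h4 : s * (δ / s) = δ := by field_simp
      constructor <;> nlinarith
  · change -(t * ψ x) * expNegInvGlue (-(t * ψ x) / δ) = 0
    rw [expNegInvGlue.zero_of_nonpos (div_nonpos_of_nonpos_of_nonneg (hneg x) hδ.le), mul_zero]

end Adm

end Admissible

section Primitive

/-- The primitive vanishing at the origin. -/
def prim (k : ℝ → ℝ) (t : ℝ) : ℝ := ∫ s in (0 : ℝ)..t, k s

theorem prim_zero (k : ℝ → ℝ) : prim k 0 = 0 := intervalIntegral.integral_same

theorem prim_add_le {k : ℝ → ℝ} (hk : Monotone k) (s t : ℝ) :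
    prim k s + k s * (t - s) ≤ prim k t := by
  have hi : ∀ a b, IntervalIntegrable k volume a b := fun a b => hk.intervalIntegrable
  have h1 : prim k t - prim k s = ∫ r in s..t, k r :=
    intervalIntegral.integral_interval_sub_left (hi _ _) (hi _ _)
  have h2 : ∀ a b, ∫ _ in a..b, k s = k s * (b - a) := fun a b => by
    rw [intervalIntegral.integral_const, smul_eq_mul, mul_comm]
  rcases le_total s t with hst | hst
  · have := intervalIntegral.integral_mono_on hst intervalIntegrable_const (hi s t)
      fun r hr => hk hr.1
    rw [h2] at this
    linarith
  · have := intervalIntegral.integral_mono_on hst (hi t s) intervalIntegrable_const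
      fun r hr => hk hr.2
    rw [h2] at this
    rw [intervalIntegral.integral_symm] at h1
    linarith

variable {k : ℝ → ℝ} {C : ℝ} (hk : Monotone k) (hk0 : ∀ t ≤ 0, k t = 0)
  (hkC : ∀ t, 0 ≤ t → k t ≤ C * t)

include hk hk0 in
theorem apply_nonneg_of_monotone (t : ℝ) : 0 ≤ k t := by
  rcases le_total t 0 with h | h
  · exact (hk0 t h).ge
  · exact (hk0 0 le_rfl).ge.trans (hk h)

include hk hk0 in
theorem prim_nonneg (t : ℝ) : 0 ≤ prim k t := by
  have := prim_add_le hk 0 t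
  rwa [prim_zero, hk0 0 le_rfl, zero_mul, add_zero] at this

include hk in
theorem prim_le_mul (t : ℝ) : prim k t ≤ k t * t := by
  have := prim_add_le hk t 0
  rw [prim_zero] at this
  linarith

include hk0 hkC in
theorem apply_le_mul_abs (hC : 0 ≤ C) (t : ℝ) : k t ≤ C * |t| := by
  rcases le_total t 0 with h | h
  · rw [hk0 t h]; positivity
  · rw [abs_of_nonneg h]; exact hkC t h

include hk hk0 hkC in
theorem abs_prim_sub_le (hC : 0 ≤ C) (s t : ℝ) :
    |prim k t - prim k s| ≤ C * ((|t| + |s|) * |t - s|) := by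
  have h1 := prim_add_le hk s t
  have h2 := prim_add_le hk t s
  have h3 := apply_le_mul_abs hk0 hkC hC s
  have h4 := apply_le_mul_abs hk0 hkC hC t
  have h5 := apply_nonneg_of_monotone hk hk0 s
  have h6 := apply_nonneg_of_monotone hk hk0 t
  have h7 : |k s * (t - s)| ≤ C * |s| * |t - s| := by
    rw [abs_mul, abs_of_nonneg h5]; gcongr
  have h8 : |k t * (t - s)| ≤ C * |t| * |t - s| := by
    rw [abs_mul, abs_of_nonneg h6]; gcongr
  have h9 : 0 ≤ C * |s| * |t - s| := by positivity
  have h10 : 0 ≤ C * |t| * |t - s| := by positivity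
  rw [abs_le] at h7 h8 ⊢
  constructor <;> linarith [h7.1, h8.2]

include hk hk0 in
theorem prim_le_abs (t : ℝ) : prim k t ≤ prim k |t| := by
  rcases le_total 0 t with h | h
  · rw [abs_of_nonneg h]
  · have := prim_le_mul hk t
    rw [hk0 t h, zero_mul] at this
    exact this.trans (prim_nonneg hk hk0 _)

include hk hk0 hkC in
theorem prim_le_sq (hC : 0 ≤ C) (t : ℝ) : prim k t ≤ C * t ^ 2 := by
  have h1 := abs_prim_sub_le hk hk0 hkC hC 0 t
  rw [prim_zero, sub_zero, sub_zero, abs_zero, add_zero, abs_mul_abs_self, ← sq] at h1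
  exact (le_abs_self _).trans h1

include hk in
theorem two_mul_prim_le (hr : ∀ s t, 0 < s → s ≤ t → k s * t ≤ k t * s) (hk0 : ∀ t ≤ 0, k t = 0)
    {s t : ℝ} (hs : 0 < s) (hst : s ≤ t) :
    2 * prim k t ≤ k t * t - (k t / t - k s / s) * s ^ 2 := by
  have ht := hs.trans_le hst
  have hi : ∀ a b, IntervalIntegrable k volume a b := fun a b => hk.intervalIntegrable
  have hlin : ∀ r b, 0 ≤ r → r ≤ b → 0 < b → k r ≤ k b / b * r := by
    intro r b hr0 hrb hb
    rcases hr0.eq_or_lt with rfl | hr0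
    · rw [hk0 0 le_rfl, mul_zero]
    · have := hr r b hr0 hrb
      rw [div_mul_eq_mul_div, le_div_iff₀ hb]
      exact this
  have h_int : ∀ a b c : ℝ, ∫ r in a..b, c * r = c * ((b ^ 2 - a ^ 2) / 2) := fun a b c => by
    rw [intervalIntegral.integral_const_mul, integral_id]
  have hi' : ∀ a b c : ℝ, IntervalIntegrable (fun r => c * r) volume a b := fun a b c =>
    (by fun_prop : Continuous fun r : ℝ => c * r).intervalIntegrable _ _
  have h1 := intervalIntegral.integral_mono_on hs.le (hi 0 s) (hi' 0 s (k s / s))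
    fun r hr => hlin r s hr.1 hr.2 hs
  have h2 := intervalIntegral.integral_mono_on hst (hi s t) (hi' s t (k t / t))
    fun r hr => hlin r t (hs.le.trans hr.1) hr.2 ht
  rw [h_int] at h1 h2
  have h3 : prim k t = (∫ r in (0 : ℝ)..s, k r) + ∫ r in s..t, k r :=
    (intervalIntegral.integral_add_adjacent_intervals (hi 0 s) (hi s t)).symm
  have h4 : k t / t * t ^ 2 = k t * t := by field_simp
  rw [h3]
  linarith

theorem measurable_prim {N : ℕ} {k : Euc N → ℝ → ℝ} (hkm : Measurable (Function.uncurry k))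
    {w : Euc N → ℝ} (hw : Measurable w) : Measurable fun x => prim (k x) (w x) := by
  have h1 : ∀ x, prim (k x) (w x) = w x * ∫ r in Ioc (0 : ℝ) 1, k x (r * w x) := by
    intro x
    rw [← intervalIntegral.integral_of_le zero_le_one,
      intervalIntegral.mul_integral_comp_mul_right]
    simp [prim]
  have h2 : Measurable fun z : Euc N × ℝ => k z.1 (z.2 * w z.1) :=
    hkm.comp (measurable_fst.prodMk (measurable_snd.mul (hw.comp measurable_fst)))
  simp only [h1]
  exact hw.mul (h2.stronglyMeasurable.integral_prod_right
    (ν := volume.restrict (Ioc (0 : ℝ) 1))).measurable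

end Primitive

section Minimization

variable {N : ℕ} {Ω : Set (Euc N)}

/-- A monotone nonlinearity of linear growth which vanishes on the negative half-line. -/
structure IsTrunc (k : Euc N → ℝ → ℝ) (C : ℝ) : Prop where
  meas : Measurable (Function.uncurry k)
  mono : ∀ x, Monotone (k x)
  zero : ∀ x t, t ≤ 0 → k x t = 0
  le : ∀ x t, 0 ≤ t → k x t ≤ C * t
  nonneg : 0 ≤ C

/-- The potential energy of `w` for the nonlinearity `k`. -/
def energy (k : Euc N → ℝ → ℝ) (w : Euc N → ℝ) : ℝ := ∫ x, prim (k x) (w x)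

theorem sq_integral_sq_sub_le {w v : Euc N → ℝ} (hw : MemLp w 2) (hv : MemLp v 2) :
    ((∫ x, w x ^ 2) - ∫ x, v x ^ 2) ^ 2 ≤
      (2 * (∫ x, w x ^ 2) + 2 * ∫ x, v x ^ 2) * ∫ x, (w x - v x) ^ 2 := by
  have h1 := sq_integral_mul_le (hw.add hv) (hw.sub hv)
  have i1 := hw.integrable_sq
  have i2 := hv.integrable_sq
  have h2 : ∫ x, (w + v) x * (w - v) x = (∫ x, w x ^ 2) - ∫ x, v x ^ 2 := by
    rw [← integral_sub i1 i2]
    congr 1 with x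
    simp only [Pi.add_apply, Pi.sub_apply]; ring
  rw [h2] at h1
  refine h1.trans (mul_le_mul_of_nonneg_right ?_ (integral_nonneg fun _ => by positivity))
  rw [← integral_const_mul, ← integral_const_mul, ← integral_add (i1.const_mul _) (i2.const_mul _)]
  exact integral_mono (hw.add hv).integrable_sq ((i1.const_mul _).add (i2.const_mul _))
    fun x => add_sq_le_two _ _

namespace IsTrunc

variable {k : Euc N → ℝ → ℝ} {C : ℝ}

theorem memLp_comp (h : IsTrunc k C) {w : Euc N → ℝ} (hw : MemLp w 2) :
    MemLp (fun x => k x (w x)) 2 := by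
  have hm : AEStronglyMeasurable fun x => k x (w x) := by
    have h1 : Measurable fun x => k x (hw.1.mk w x) :=
      h.meas.comp (measurable_id.prodMk hw.1.stronglyMeasurable_mk.measurable)
    refine h1.aestronglyMeasurable.congr ?_
    filter_upwards [hw.1.ae_eq_mk] with x hx
    rw [hx]
  refine (hw.norm.const_mul C).mono hm (Eventually.of_forall fun x => ?_)
  rw [Real.norm_of_nonneg (apply_nonneg_of_monotone (h.mono x) (h.zero x) _),
    Real.norm_of_nonneg (mul_nonneg h.nonneg (norm_nonneg _))]
  exact apply_le_mul_abs (h.zero x) (h.le x) h.nonneg _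

theorem integrable_prim (h : IsTrunc k C) {w : Euc N → ℝ} (hw : MemLp w 2) :
    Integrable fun x => prim (k x) (w x) := by
  have hm : AEStronglyMeasurable fun x => prim (k x) (w x) := by
    refine (measurable_prim h.meas hw.1.stronglyMeasurable_mk.measurable).aestronglyMeasurable.congr
      ?_
    filter_upwards [hw.1.ae_eq_mk] with x hx
    rw [hx]
  refine (hw.integrable_sq.const_mul C).mono' hm (Eventually.of_forall fun x => ?_)
  rw [Real.norm_of_nonneg (prim_nonneg (h.mono x) (h.zero x) _)]
  exact prim_le_sq (h.mono x) (h.zero x) (h.le x) h.nonneg _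

theorem energy_le (h : IsTrunc k C) {w : Euc N → ℝ} (hw : MemLp w 2) :
    energy k w ≤ C * ∫ x, w x ^ 2 := by
  rw [← integral_const_mul]
  exact integral_mono (h.integrable_prim hw) (hw.integrable_sq.const_mul C)
    fun x => prim_le_sq (h.mono x) (h.zero x) (h.le x) h.nonneg _

theorem energy_add_le (h : IsTrunc k C) {w v : Euc N → ℝ} (hw : MemLp w 2) (hv : MemLp v 2) :
    energy k w + ∫ x, k x (w x) * (v x - w x) ≤ energy k v := by
  have i1 : Integrable fun x => k x (w x) * (v x - w x) :=
    (h.memLp_comp hw).integrable_mul (hv.sub hw)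
  unfold energy
  rw [← integral_add (h.integrable_prim hw) i1]
  exact integral_mono ((h.integrable_prim hw).add i1) (h.integrable_prim hv)
    fun x => prim_add_le (h.mono x) _ _

theorem energy_le_abs (h : IsTrunc k C) {w : Euc N → ℝ} (hw : MemLp w 2) :
    energy k w ≤ energy k fun x => |w x| :=
  integral_mono (h.integrable_prim hw) (h.integrable_prim hw.norm)
    fun x => prim_le_abs (h.mono x) (h.zero x) _

theorem abs_energy_sub_le (h : IsTrunc k C) {w v : Euc N → ℝ} (hw : MemLp w 2)
    (hv : MemLp v 2) : |energy k w - energy k v| ≤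
      C * √((2 * (∫ x, w x ^ 2) + 2 * ∫ x, v x ^ 2) * ∫ x, (w x - v x) ^ 2) := by
  have i1 : Integrable fun x => (|w x| + |v x|) * |w x - v x| :=
    (hw.norm.add hv.norm).integrable_mul (hw.sub hv).norm
  have h1 : |energy k w - energy k v| ≤ C * ∫ x, (|w x| + |v x|) * |w x - v x| := by
    unfold energy
    rw [← integral_sub (h.integrable_prim hw) (h.integrable_prim hv), ← integral_const_mul]
    refine (abs_integral_le_integral_abs).trans (integral_mono
      ((h.integrable_prim hw).sub (h.integrable_prim hv)).abs (i1.const_mul C) fun x => ?_)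
    exact abs_prim_sub_le (h.mono x) (h.zero x) (h.le x) h.nonneg _ _
  refine h1.trans (mul_le_mul_of_nonneg_left (Real.le_sqrt_of_sq_le ?_) h.nonneg)
  have h2 := sq_integral_mul_le (hw.norm.add hv.norm) (hw.sub hv).norm
  have e1 : ∫ x, ‖(w - v) x‖ ^ 2 = ∫ x, (w x - v x) ^ 2 := by
    congr 1 with x
    rw [Real.norm_eq_abs, sq_abs, Pi.sub_apply]
  rw [e1] at h2
  refine h2.trans (mul_le_mul_of_nonneg_right ?_ (integral_nonneg fun _ => by positivity))
  have i1 := hw.integrable_sq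
  have i2 := hv.integrable_sq
  rw [← integral_const_mul, ← integral_const_mul, ← integral_add (i1.const_mul _) (i2.const_mul _)]
  refine integral_mono (hw.norm.add hv.norm).integrable_sq
    ((i1.const_mul _).add (i2.const_mul _)) fun x => ?_
  have := add_sq_le_two |w x| |v x|
  rwa [sq_abs, sq_abs] at this

end IsTrunc

theorem exists_isTest_ne_zero (hΩ : IsOpen Ω) (hne : Ω.Nonempty) :
    ∃ φ, IsTest Ω φ ∧ 0 < ∫ x, φ x ^ 2 := by
  obtain ⟨x₀, hx₀⟩ := hne
  obtain ⟨r, hr, hrΩ⟩ := Metric.isOpen_iff.1 hΩ x₀ hx₀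
  let b : ContDiffBump x₀ := ⟨r / 4, r / 2, by positivity, by linarith⟩
  have hb : IsTest Ω b := by
    refine ⟨b.contDiff, b.hasCompactSupport, ?_⟩
    rw [b.tsupport_eq]
    exact (Metric.closedBall_subset_ball (by change r / 2 < r; linarith)).trans hrΩ
  refine ⟨b, hb, ?_⟩
  refine (b.continuous.pow 2).integral_pos_of_hasCompactSupport_nonneg_nonzero ?_
    (fun x => by positivity) (x := x₀) ?_
  · exact b.hasCompactSupport.comp_left (g := fun s : ℝ => s ^ 2) (by simp)
  · have : b x₀ = 1 := b.one_of_mem_closedBall (Metric.mem_closedBall_self b.rIn_pos.le)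
    simp [this]

theorem exists_minimizer {k : Euc N → ℝ → ℝ} {C c : ℝ} (hΩ : IsOpen Ω) (hne : Ω.Nonempty)
    (hb : Bornology.IsBounded Ω) (h : IsTrunc k C) (hc : 0 < c) :
    ∃ w D, Adm Ω w D ∧ ∫ x, w x ^ 2 = c ∧
      ∀ v D', Adm Ω v D' → ∫ x, v x ^ 2 = c → D / 2 - energy k w ≤ D' / 2 - energy k v := by
  set S := {r | ∃ v D, Adm Ω v D ∧ ∫ x, v x ^ 2 = c ∧ r = D / 2 - energy k v} with hS
  have hSne : S.Nonempty := by
    obtain ⟨φ, h1, h2⟩ := exists_isTest_ne_zero hΩ hne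
    refine ⟨_, _, _, (h1.adm).const_mul √(c / ∫ x, φ x ^ 2), ?_, rfl⟩
    simp only [mul_pow]
    rw [integral_const_mul, Real.sq_sqrt (by positivity)]
    field_simp
  have hlow : ∀ v, MemLp v 2 → ∫ x, v x ^ 2 = c → energy k v ≤ C * c := fun v hv hvc => by
    rw [← hvc]; exact h.energy_le hv
  have hSb : BddBelow S := by
    refine ⟨-(C * c), ?_⟩
    rintro r ⟨v, D, h1, h2, rfl⟩
    have := hlow v h1.1 h2
    have := h1.nonneg
    linarith
  set m := sInf S with hm
  have hex : ∀ n : ℕ, ∃ v D, (Adm Ω v D ∧ ∫ x, v x ^ 2 = c) ∧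
      D / 2 - energy k v < m + 1 / ((n : ℝ) + 1) := by
    intro n
    obtain ⟨r, ⟨v, D, h1, h2, rfl⟩, h3⟩ := exists_lt_of_csInf_lt hSne
      (show sInf S < m + 1 / ((n : ℝ) + 1) by
        have : 0 < 1 / ((n : ℝ) + 1) := by positivity
        linarith)
    exact ⟨v, D, ⟨h1, h2⟩, h3⟩
  choose v D hv hvm using hex
  have hφ : ∀ n : ℕ, ∃ φ, IsTest Ω φ ∧ ∫ x, (φ x - v n x) ^ 2 < 1 / ((n : ℝ) + 1) ∧
      ∫ x, ‖fderiv ℝ φ x‖ ^ 2 < D n + 1 / ((n : ℝ) + 1) :=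
    fun n => (hv n).1.2 _ (by positivity)
  choose φ hφt hφv hφD using hφ
  have hle1 : ∀ n : ℕ, 1 / ((n : ℝ) + 1) ≤ 1 := fun n => by
    rw [div_le_one (by positivity)]
    linarith [(Nat.cast_nonneg n : (0 : ℝ) ≤ n)]
  have hφC : ∀ n, ∫ x, φ n x ^ 2 ≤ 2 * 1 + 2 * c := by
    intro n
    have h1 := integral_sub_sq_le (hφt n).memLp (hv n).1.1 
      (MemLp.zero : MemLp (fun _ : Euc N => (0 : ℝ)) 2)
    simp only [Pi.zero_apply, sub_zero] at h1
    rw [(hv n).2] at h1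
    linarith [hφv n, hle1 n]
  have hφE : ∀ n, ∫ x, ‖fderiv ℝ (φ n) x‖ ^ 2 ≤ 2 * (m + 1 + C * c) + 1 := by
    intro n
    linarith [hφD n, hvm n, hle1 n, hlow _ (hv n).1.1 (hv n).2]
  obtain ⟨σ, hσ, w, hw, hlim⟩ := exists_strong_subseq hb hφt hφC hφE
  have hε : Tendsto (fun n => 1 / ((σ n : ℝ) + 1)) atTop (𝓝 0) :=
    tendsto_one_div_add_atTop_nhds_zero_nat.comp hσ.tendsto_atTop
  have hvw : Tendsto (fun n => ∫ x, (v (σ n) x - w x) ^ 2) atTop (𝓝 0) := by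
    have h1 : Tendsto (fun n => 2 * (1 / ((σ n : ℝ) + 1)) + 2 * ∫ x, (φ (σ n) x - w x) ^ 2)
        atTop (𝓝 0) := by
      simpa using (hε.const_mul 2).add (hlim.const_mul 2)
    refine squeeze_zero (fun n => integral_nonneg fun _ => by positivity) (fun n => ?_) h1
    have h2 := integral_sub_sq_le (hv (σ n)).1.1 (hφt (σ n)).memLp hw
    have h3 : ∫ x, (v (σ n) x - φ (σ n) x) ^ 2 = ∫ x, (φ (σ n) x - v (σ n) x) ^ 2 := by
      congr 1 with x; ring
    linarith [hφv (σ n)]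
  have hprod : Tendsto (fun n => (2 * (∫ x, v (σ n) x ^ 2) + 2 * ∫ x, w x ^ 2) *
      ∫ x, (v (σ n) x - w x) ^ 2) atTop (𝓝 0) := by
    simp only [(hv _).2]
    simpa using hvw.const_mul (2 * c + 2 * ∫ x, w x ^ 2)
  have hwc : ∫ x, w x ^ 2 = c := by
    have h1 : (c - ∫ x, w x ^ 2) ^ 2 ≤ 0 := ge_of_tendsto' hprod fun n => by
      have := sq_integral_sq_sub_le (hv (σ n)).1.1 hw
      rwa [(hv (σ n)).2] at this ⊢
    have := pow_eq_zero_iff two_ne_zero |>.1 (le_antisymm h1 (sq_nonneg _))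
    linarith
  have hen : Tendsto (fun n => energy k (v (σ n))) atTop (𝓝 (energy k w)) := by
    rw [tendsto_iff_dist_tendsto_zero]
    have h1 := (hprod.sqrt).const_mul C
    rw [Real.sqrt_zero, mul_zero] at h1
    exact squeeze_zero (fun _ => dist_nonneg)
      (fun n => h.abs_energy_sub_le (hv (σ n)).1.1 hw) h1
  refine ⟨w, 2 * (m + energy k w), ⟨hw, fun ε hε0 => ?_⟩, hwc, fun u D' hu huc => ?_⟩
  · have h1 : Tendsto (fun n => 2 * (m + 1 / ((σ n : ℝ) + 1) + energy k (v (σ n))) +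
        1 / ((σ n : ℝ) + 1)) atTop (𝓝 (2 * (m + energy k w))) := by
      simpa using (((hε.const_add m).add hen).const_mul 2).add hε
    obtain ⟨n, hn1, hn2⟩ := ((h1.eventually_lt_const (lt_add_of_pos_right _ hε0)).and
      (hlim.eventually_lt_const hε0)).exists
    exact ⟨φ (σ n), hφt _, hn2, by linarith [hφD (σ n), hvm (σ n)]⟩
  · have := csInf_le hSb (show D' / 2 - energy k u ∈ S from ⟨u, D', hu, huc, rfl⟩)
    linarith

theorem Adm.congr_ae {w v : Euc N → ℝ} {D : ℝ} (h : Adm Ω w D) (hwv : w =ᵐ[volume] v) :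
    Adm Ω v D := by
  refine ⟨(memLp_congr_ae hwv).1 h.1, fun ε hε => ?_⟩
  obtain ⟨φ, h1, h2, h3⟩ := h.2 ε hε
  refine ⟨φ, h1, lt_of_eq_of_lt (integral_congr_ae ?_) h2, h3⟩
  filter_upwards [hwv] with x hx
  simp only [hx]

/-- The minimizer can be chosen measurable, nonnegative and vanishing outside the domain. -/
theorem exists_minimizer_nonneg {k : Euc N → ℝ → ℝ} {C c : ℝ} (hΩ : IsOpen Ω) (hne : Ω.Nonempty)
    (hb : Bornology.IsBounded Ω) (h : IsTrunc k C) (hc : 0 < c) :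
    ∃ w D, Measurable w ∧ (∀ x, 0 ≤ w x) ∧ (∀ x ∉ Ω, w x = 0) ∧ Adm Ω w D ∧
      ∫ x, w x ^ 2 = c ∧ ∀ v D', Adm Ω v D' → ∫ x, v x ^ 2 = c →
        D / 2 - energy k w ≤ D' / 2 - energy k v := by
  obtain ⟨w, D, hw, hwc, hmin⟩ := exists_minimizer hΩ hne hb h hc
  set u := Ω.indicator fun x => |hw.1.1.mk w x| with hu
  have hae : (fun x => |w x|) =ᵐ[volume] u := by
    filter_upwards [hw.ae_eq_zero hΩ.measurableSet, hw.1.1.ae_eq_mk] with x hx hx'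
    by_cases hxΩ : x ∈ Ω
    · rw [hu, indicator_of_mem hxΩ, hx']
    · rw [hu, indicator_of_notMem hxΩ, hx hxΩ, abs_zero]
  refine ⟨u, D, hw.1.1.stronglyMeasurable_mk.measurable.norm.indicator hΩ.measurableSet,
    fun x => indicator_nonneg (fun _ _ => abs_nonneg _) x,
    fun x hx => indicator_of_notMem hx _, hw.abs.congr_ae hae, ?_, fun v D' hv hvc => ?_⟩
  · rw [← hwc]
    refine integral_congr_ae ?_
    filter_upwards [hae] with x hx
    rw [← hx, sq_abs]
  · have h1 := h.energy_le_abs hw.1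
    have h2 : energy k (fun x => |w x|) = energy k u := by
      refine integral_congr_ae ?_
      filter_upwards [hae] with x hx
      simp only [← hx]
    linarith [hmin v D' hv hvc]

end Minimization

section EulerLagrange

theorem first_variation_nonneg {D P L E η α β : ℝ} {q : ℝ → ℝ}
    (hq : ∀ t > 0, 1 - 2 * α * t ≤ q t ∧ q t ≤ 1 - 2 * α * t + β * t ^ 2)
    (hineq : ∀ t > 0, 0 < q t →
      D * q t ≤ D + 2 * t * L + t ^ 2 * E - 2 * √(q t) * (P - t * η) + 2 * q t * P) :
    α * (P - D) ≤ L + η := by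
  have ht : Tendsto (fun t : ℝ => t) (𝓝[>] 0) (𝓝 0) := tendsto_id.mono_left nhdsWithin_le_nhds
  have hpos : ∀ᶠ t : ℝ in 𝓝[>] 0, 0 < t := self_mem_nhdsWithin
  have h1 : Tendsto (fun t => (1 - q t) / t) (𝓝[>] 0) (𝓝 (2 * α)) := by
    have h2 : Tendsto (fun t => 2 * α - β * t) (𝓝[>] 0) (𝓝 (2 * α)) := by
      simpa using (ht.const_mul β).const_sub (2 * α)
    refine tendsto_of_tendsto_of_tendsto_of_le_of_le' h2 tendsto_const_nhds ?_ ?_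
    · filter_upwards [hpos] with t ht0
      rw [le_div_iff₀ ht0]
      nlinarith [(hq t ht0).2]
    · filter_upwards [hpos] with t ht0
      rw [div_le_iff₀ ht0]
      nlinarith [(hq t ht0).1]
  have h3 : Tendsto q (𝓝[>] 0) (𝓝 1) := by
    have h4 := (h1.mul ht).const_sub 1
    rw [mul_zero, sub_zero] at h4
    refine h4.congr' ?_
    filter_upwards [hpos] with t ht0
    field_simp
    ring
  have h4 : Tendsto (fun t => √(q t)) (𝓝[>] 0) (𝓝 1) := by simpa using h3.sqrt
  have hqpos : ∀ᶠ t in 𝓝[>] 0, 0 < q t := h3.eventually_const_lt one_pos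
  have h5 : Tendsto (fun t => (1 - √(q t)) / t) (𝓝[>] 0) (𝓝 α) := by
    have h6 := h1.div (h4.const_add 1) (by norm_num)
    rw [show 2 * α / (1 + 1) = α by ring] at h6
    refine h6.congr' ?_
    filter_upwards [hpos, hqpos] with t ht0 hq0
    have hs := Real.sq_sqrt hq0.le
    have hs' : 0 < 1 + √(q t) := by positivity
    simp only [Pi.div_apply]
    field_simp
    nlinarith
  have hl : Tendsto (fun t => -(D / 2) * ((1 - q t) / t) +
      P * ((1 - q t) / t - (1 - √(q t)) / t)) (𝓝[>] 0)
      (𝓝 (-(D / 2) * (2 * α) + P * (2 * α - α))) :=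
    (h1.const_mul _).add ((h1.sub h5).const_mul P)
  have hr : Tendsto (fun t => L + t * (E / 2) + √(q t) * η) (𝓝[>] 0)
      (𝓝 (L + 0 * (E / 2) + 1 * η)) :=
    ((ht.mul_const _).const_add L).add (h4.mul_const η)
  have key := le_of_tendsto_of_tendsto hl hr (by
    filter_upwards [hpos, hqpos] with t ht0 hq0
    have h6 := hineq t ht0 hq0
    rw [← mul_le_mul_iff_left₀ ht0]
    have h7 : (-(D / 2) * ((1 - q t) / t) + P * ((1 - q t) / t - (1 - √(q t)) / t)) * t =
        -(D / 2) * (1 - q t) + P * ((1 - q t) - (1 - √(q t))) := by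
      field_simp
    rw [h7]
    nlinarith)
  linarith

variable {N : ℕ} {Ω : Set (Euc N)} {k : Euc N → ℝ → ℝ} {C c : ℝ} {w : Euc N → ℝ} {D : ℝ}

theorem minimizer_variation (h : IsTrunc k C) (hc : 0 < c) (hw : MemLp w 2)
    (hmin : ∀ v D', Adm Ω v D' → ∫ x, v x ^ 2 = c → D / 2 - energy k w ≤ D' / 2 - energy k v)
    {L E η a b : ℝ} (hv : ∀ t > 0, ∃ v, Adm Ω v (D + 2 * t * L + t ^ 2 * E) ∧
      c - 2 * t * a ≤ ∫ x, v x ^ 2 ∧ ∫ x, v x ^ 2 ≤ c - 2 * t * a + t ^ 2 * b ∧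
      (∫ x, k x (w x) * w x) - t * η ≤ ∫ x, k x (w x) * v x) :
    ((∫ x, k x (w x) * w x) - D) / c * a ≤ L + η := by
  choose! v hv1 hv2 hv3 hv4 using hv
  set P := ∫ x, k x (w x) * w x with hP
  have := first_variation_nonneg (D := D) (P := P) (L := L) (E := E) (η := η) (α := a / c)
    (β := b / c) (q := fun t => (∫ x, v t x ^ 2) / c) (fun t ht => ?_) fun t ht hq => ?_
  · rw [div_mul_comm]
    exact this
  · rw [le_div_iff₀ hc, div_le_iff₀ hc]
    have e1 : (1 - 2 * (a / c) * t) * c = c - 2 * t * a := by field_simp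
    have e2 : (1 - 2 * (a / c) * t + b / c * t ^ 2) * c = c - 2 * t * a + t ^ 2 * b := by
      field_simp
    rw [e1, e2]
    exact ⟨hv2 t ht, hv3 t ht⟩
  · set q := (∫ x, v t x ^ 2) / c with hqdef
    have hQ : ∫ x, v t x ^ 2 = q * c := by rw [hqdef]; field_simp
    have hs0 : 0 < √q := Real.sqrt_pos.2 hq
    have hsq : √q ^ 2 = q := Real.sq_sqrt hq.le
    have hm := hmin _ _ ((hv1 t ht).const_mul (√q)⁻¹) (by
      simp only [mul_pow]
      rw [integral_const_mul, hQ, inv_pow, hsq]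
      field_simp)
    have hvt := (hv1 t ht).1
    have h1 := h.energy_add_le hw (hvt.const_mul (√q)⁻¹)
    have i1 : Integrable fun x => k x (w x) * v t x := (h.memLp_comp hw).integrable_mul hvt
    have i2 : Integrable fun x => k x (w x) * w x := (h.memLp_comp hw).integrable_mul hw
    have h2 : ∫ x, k x (w x) * ((√q)⁻¹ * v t x - w x) =
        (√q)⁻¹ * (∫ x, k x (w x) * v t x) - P := by
      rw [hP, ← integral_const_mul, ← integral_sub (i1.const_mul _) i2]
      congr 1 with x
      ring
    rw [h2] at h1
    have h3 := mul_le_mul_of_nonneg_left (hv4 t ht) (inv_nonneg.2 hs0.le)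
    have h4 : D / 2 ≤ (√q)⁻¹ ^ 2 * (D + 2 * t * L + t ^ 2 * E) / 2 - (√q)⁻¹ * (P - t * η) + P := by
      linarith
    have h5 := mul_le_mul_of_nonneg_left h4 (mul_nonneg zero_le_two hq.le)
    have h6 : 2 * q * ((√q)⁻¹ ^ 2 * (D + 2 * t * L + t ^ 2 * E) / 2 - (√q)⁻¹ * (P - t * η) + P) =
        D + 2 * t * L + t ^ 2 * E - 2 * √q * (P - t * η) + 2 * q * P := by
      have e1 : q * (√q)⁻¹ ^ 2 = 1 := by
        rw [inv_pow, hsq]; exact mul_inv_cancel₀ hq.ne'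
      have e2 : q * (√q)⁻¹ = √q := by
        rw [← div_eq_mul_inv, Real.div_sqrt]
      linear_combination (D + 2 * t * L + t ^ 2 * E) * e1 - 2 * (P - t * η) * e2
    linarith

theorem firstEig_ge (hΩ : IsOpen Ω) (hne : Ω.Nonempty) {r : ℝ}
    (h : ∀ φ, IsTest Ω φ → 0 < ∫ x, φ x ^ 2 →
      r ≤ (∫ x, ‖fderiv ℝ φ x‖ ^ 2) / ∫ x, φ x ^ 2) : r ≤ firstEig Ω := by
  refine le_csInf ?_ ?_
  · obtain ⟨φ, h1, h2⟩ := exists_isTest_ne_zero hΩ hne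
    refine ⟨_, φ, h1.smooth, h1.cpt, h1.supp, ?_, rfl⟩
    rintro rfl
    simp at h2
  · rintro _ ⟨φ, h1, h2, h3, h4, rfl⟩
    refine h φ ⟨h1, h2, h3⟩ ?_
    obtain ⟨x, hx⟩ := Function.ne_iff.1 h4
    refine (h1.continuous.pow 2).integral_pos_of_hasCompactSupport_nonneg_nonzero ?_
      (fun x => by positivity) (x := x) (pow_ne_zero 2 hx)
    exact h2.comp_left (g := fun s : ℝ => s ^ 2) (by simp)

/-- Existence of a nonnegative weak solution with prescribed mass for the truncated problem. -/
theorem exists_weak_solution (hΩ : IsOpen Ω) (hne : Ω.Nonempty) (hb : Bornology.IsBounded Ω)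
    (h : IsTrunc k C) (hc : 0 < c) :
    ∃ w : Euc N → ℝ, ∃ lam : ℝ, MemLp w 2 ∧ Measurable w ∧ (∀ x, 0 ≤ w x) ∧ (∀ x ∉ Ω, w x = 0) ∧
      ∫ x, w x ^ 2 = c ∧
      (∀ φ, IsTest Ω φ → ∫ x, w x * lap φ x = ∫ x, φ x * (lam * w x - k x (w x))) ∧
      (∀ φ, IsTest univ φ → (∀ x, 0 ≤ φ x) →
        ∫ x, φ x * (lam * w x - k x (w x)) ≤ ∫ x, w x * lap φ x) ∧
      (∫ x, k x (w x) * w x) - 2 * energy k w - c * firstEig Ω ≤ lam * c := by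
  obtain ⟨w, D, hwm, hw0, hwΩ, hw, hwc, hmin⟩ := exists_minimizer_nonneg hΩ hne hb h hc
  have hk2 := h.memLp_comp hw.1
  set P := ∫ x, k x (w x) * w x with hP
  have iP : Integrable fun x => k x (w x) * w x := hk2.integrable_mul hw.1
  have hsplit : ∀ (U : Set (Euc N)) φ, IsTest U φ →
      ∫ x, φ x * ((P - D) / c * w x - k x (w x)) =
        (P - D) / c * (∫ x, w x * φ x) - ∫ x, k x (w x) * φ x := by
    intro U φ hφ
    have i1 : Integrable fun x => w x * φ x := hw.1.integrable_mul hφ.memLp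
    have i2 : Integrable fun x => k x (w x) * φ x := hk2.integrable_mul hφ.memLp
    rw [← integral_const_mul, ← integral_sub (i1.const_mul _) i2]
    congr 1 with x
    ring
  have hquad : ∀ (U : Set (Euc N)) φ, IsTest U φ → ∀ t, ∫ x, (w x - t * φ x) ^ 2 =
      c - 2 * t * (∫ x, w x * φ x) + t ^ 2 * ∫ x, φ x ^ 2 := by
    intro U φ hφ t
    have i0 := hw.1.integrable_sq
    have i1 : Integrable fun x => w x * φ x := hw.1.integrable_mul hφ.memLp
    have i2 := hφ.memLp.integrable_sq
    have i3 : Integrable fun x => w x ^ 2 - 2 * t * (w x * φ x) := i0.sub (i1.const_mul _)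
    rw [← hwc, ← integral_const_mul, ← integral_const_mul, ← integral_sub i0 (i1.const_mul _),
      ← integral_add i3 (i2.const_mul _)]
    congr 1 with x
    ring
  have hlin : ∀ (U : Set (Euc N)) φ, IsTest U φ → ∀ t, ∫ x, k x (w x) * (w x - t * φ x) =
      P - t * ∫ x, k x (w x) * φ x := by
    intro U φ hφ t
    have i2 : Integrable fun x => k x (w x) * φ x := hk2.integrable_mul hφ.memLp
    rw [hP, ← integral_const_mul, ← integral_sub iP (i2.const_mul _)]
    congr 1 with x
    ring
  refine ⟨w, (P - D) / c, hw.1, hwm, hw0, hwΩ, hwc, fun φ hφ => ?_, fun φ hφ hφ0 => ?_, ?_⟩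
  · rw [hsplit Ω φ hφ]
    have h1 := minimizer_variation h hc hw.1 hmin (L := ∫ x, w x * lap φ x)
      (E := ∫ x, ‖fderiv ℝ φ x‖ ^ 2) (η := ∫ x, k x (w x) * φ x) (a := ∫ x, w x * φ x)
      (b := ∫ x, φ x ^ 2) fun t _ => ⟨_, hw.sub_test hφ t,
        by rw [hquad Ω φ hφ]
           have : 0 ≤ t ^ 2 * ∫ x, φ x ^ 2 :=
            mul_nonneg (sq_nonneg t) (integral_nonneg fun _ => by positivity)
           linarith,
        (hquad Ω φ hφ t).le, (hlin Ω φ hφ t).ge⟩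
    have h2 := minimizer_variation h hc hw.1 hmin (L := -∫ x, w x * lap φ x)
      (E := ∫ x, ‖fderiv ℝ φ x‖ ^ 2) (η := -∫ x, k x (w x) * φ x) (a := -∫ x, w x * φ x)
      (b := ∫ x, φ x ^ 2) fun t _ => ⟨fun x => w x - -t * φ x, by
        have := hw.sub_test hφ (-t)
        convert this using 1
        ring,
        by rw [hquad Ω φ hφ]
           have : 0 ≤ (-t) ^ 2 * ∫ x, φ x ^ 2 :=
            mul_nonneg (sq_nonneg _) (integral_nonneg fun _ => by positivity)
           linarith,
        by rw [hquad Ω φ hφ]; linarith, by rw [hlin Ω φ hφ]; linarith⟩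
    linarith
  · rw [hsplit univ φ hφ]
    have h1 := minimizer_variation h hc hw.1 hmin (L := ∫ x, w x * lap φ x)
      (E := ∫ x, ‖fderiv ℝ φ x‖ ^ 2) (η := ∫ x, k x (w x) * φ x) (a := ∫ x, w x * φ x)
      (b := ∫ x, φ x ^ 2) fun t ht => ?_
    · linarith
    have hadm := hw.posPart_sub hφ hφ0 ht.le
    have hsub : MemLp (fun x => w x - t * φ x) 2 := hw.1.sub (hφ.memLp.const_mul t)
    refine ⟨_, hadm, ?_, ?_, ?_⟩
    · have i1 : Integrable fun x => w x * φ x := hw.1.integrable_mul hφ.memLp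
      rw [← hwc, ← integral_const_mul, ← integral_sub hw.1.integrable_sq (i1.const_mul _)]
      refine integral_mono (hw.1.integrable_sq.sub (i1.const_mul _)) hadm.1.integrable_sq
        fun x => ?_
      simp only
      have hp := mul_nonneg ht.le (hφ0 x)
      rcases le_total (t * φ x) (w x) with hx | hx
      · rw [max_eq_left (sub_nonneg.2 hx)]
        nlinarith [sq_nonneg (t * φ x)]
      · rw [max_eq_right (sub_nonpos.2 hx)]
        nlinarith [mul_nonneg (hw0 x) (sub_nonneg.2 hx), mul_nonneg (hw0 x) hp]
    · rw [← hquad univ φ hφ t]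
      refine integral_mono hadm.1.integrable_sq hsub.integrable_sq fun x => ?_
      simp only
      rcases le_total 0 (w x - t * φ x) with hx | hx
      · rw [max_eq_left hx]
      · rw [max_eq_right hx, zero_pow two_ne_zero]
        positivity
    · rw [← hlin univ φ hφ t]
      refine integral_mono (hk2.integrable_mul hsub) (hk2.integrable_mul hadm.1) fun x => ?_
      exact mul_le_mul_of_nonneg_left (le_max_left _ _)
        (apply_nonneg_of_monotone (h.mono x) (h.zero x) _)
  · have h1 : (D - 2 * energy k w) / c ≤ firstEig Ω := by
      refine firstEig_ge hΩ hne fun φ hφ hφ0 => ?_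
      set Q := ∫ x, φ x ^ 2 with hQ
      have h2 := hmin _ _ (hφ.adm.const_mul √(c / Q)) (by
        simp only [mul_pow]
        rw [integral_const_mul, Real.sq_sqrt (by positivity), ← hQ]
        field_simp)
      have h3 : 0 ≤ energy k fun x => √(c / Q) * φ x :=
        integral_nonneg fun x => prim_nonneg (h.mono x) (h.zero x) _
      rw [Real.sq_sqrt (by positivity)] at h2
      rw [div_le_div_iff₀ hc hφ0]
      have h4 : D - 2 * energy k w ≤ c / Q * ∫ x, ‖fderiv ℝ φ x‖ ^ 2 := by linarith
      rw [div_mul_eq_mul_div, le_div_iff₀ hφ0] at h4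
      linarith
    rw [div_le_iff₀ hc] at h1
    rw [div_mul_cancel₀ _ hc.ne']
    linarith

end EulerLagrange

section Solution

variable {N : ℕ} {Ω : Set (Euc N)} {f : Euc N → ℝ → ℝ} {d : Euc N → ℝ} {g : Euc N → ℝ → ℝ} {p : ℝ}
  {u : ℝ → Euc N → ℝ}

theorem avg_congr_ae {w v : Euc N → ℝ} (h : w =ᵐ[volume] v) (r : ℝ) (x : Euc N) :
    avg w r x = avg v r x := by
  refine integral_congr_ae ?_
  filter_upwards [h] with y hy
  simp only [hy]

theorem rep_congr_ae {w v : Euc N → ℝ} (h : w =ᵐ[volume] v) (x : Euc N) : rep w x = rep v x := by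
  unfold rep
  simp only [avg_congr_ae h]

theorem integrable_of_memLp_two (hb : Bornology.IsBounded Ω) {w : Euc N → ℝ} (hw : MemLp w 2)
    (h0 : ∀ x ∉ Ω, w x = 0) : Integrable w := by
  have : IsFiniteMeasure ((volume : Measure (Euc N)).restrict Ω) :=
    ⟨by rw [Measure.restrict_apply_univ]; exact hb.measure_lt_top⟩
  have h1 : IntegrableOn w Ω := (hw.restrict Ω).integrable one_le_two
  rwa [integrableOn_iff_integrable_of_support_subset] at h1
  intro x hx
  by_contra h
  exact hx (h0 x h)

theorem integrable_of_abs_le (hb : Bornology.IsBounded Ω) {w : Euc N → ℝ} (hw : Measurable w)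
    {B : ℝ} (hB : ∀ x, |w x| ≤ B) (h0 : ∀ x ∉ Ω, w x = 0) : Integrable w := by
  have h1 : IntegrableOn w Ω := Measure.integrableOn_of_bounded (M := B) hb.measure_lt_top.ne
    hw.aestronglyMeasurable (Eventually.of_forall hB)
  rwa [integrableOn_iff_integrable_of_support_subset] at h1
  intro x hx
  by_contra h
  exact hx (h0 x h)

/-- `w` is a bounded weak solution of the truncated problem, and a weak subsolution on the
whole space. -/
structure IsWeakSol (Ω : Set (Euc N)) (k : Euc N → ℝ → ℝ) (K lam : ℝ) (w : Euc N → ℝ) :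
    Prop where
  meas : Measurable w
  nonneg : ∀ x, 0 ≤ w x
  le : ∀ x, w x ≤ K
  off : ∀ x ∉ Ω, w x = 0
  weak : ∀ φ, IsTest Ω φ → ∫ x, w x * lap φ x = ∫ x, φ x * (lam * w x - k x (w x))
  sub : ∀ φ, IsTest univ φ → (∀ x, 0 ≤ φ x) →
    ∫ x, φ x * (lam * w x - k x (w x)) ≤ ∫ x, w x * lap φ x

theorem two_mul_prim_le_mul {k : ℝ → ℝ} (hk : Monotone k) (hk0 : ∀ t ≤ 0, k t = 0)
    (hr : ∀ s t, 0 < s → s ≤ t → k s * t ≤ k t * s) (t : ℝ) : 2 * prim k t ≤ k t * t := by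
  rcases le_or_gt t 0 with h | h
  · have h1 := prim_le_mul hk t
    rw [hk0 t h, zero_mul] at h1 ⊢
    linarith
  · have := two_mul_prim_le hk hr hk0 h le_rfl
    rwa [sub_self, zero_mul, sub_zero] at this

theorem exists_bounded_weak_solution (h : Standing N Ω f d g p u) (hp : p < 2 + 4 / N) {c : ℝ}
    (hc : 0 < c) : ∃ k K C lam w, IsTrunc k C ∧ 0 < K ∧ (∀ x ∉ Ω, ∀ t, k x t = 0) ∧
      (∀ x ∈ Ω, ∀ t, 0 ≤ t → t ≤ K → k x t = f x t) ∧ IsWeakSol Ω k K lam w ∧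
      ∫ x, w x ^ 2 = c ∧ -firstEig Ω < lam := by
  obtain ⟨A, hA0, hA⟩ := exists_sup_bound (N := N)
  set L := |firstEig Ω| + 1 with hL
  have hL0 : 0 < L := by positivity
  obtain ⟨K, hK1, hK2, hK0⟩ := (h.eventually_ratio_le.and
    ((h.eventually_growth hp hA0 hL0.le hc).and (eventually_gt_atTop 0))).exists
  obtain ⟨k, hkm, hkmono, hk0, hkC, hkr, hkoff, hkf⟩ := h.exists_trunc hK0
  have hC0 : 0 ≤ f 0 K / K := div_nonneg (h.nonneg h.zero_mem hK0.le) hK0.le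
  have hk : IsTrunc k (f 0 K / K) := ⟨hkm, hkmono, hk0, hkC, hC0⟩
  obtain ⟨w, lam, hw2, hwm, hw0, hwΩ, hwc, hweak, hsub, hlam⟩ :=
    exists_weak_solution h.isOpen h.conn.nonempty h.bdd hk hc
  have hwi := integrable_of_memLp_two h.bdd hw2 hwΩ
  have hki : Integrable fun x => k x (w x) :=
    integrable_of_memLp_two h.bdd (hk.memLp_comp hw2) fun x hx => hkoff x hx _
  have iP : Integrable fun x => k x (w x) * w x := (hk.memLp_comp hw2).integrable_mul hw2
  have iF := hk.integrable_prim hw2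
  have hpt : ∀ x, 0 ≤ k x (w x) * w x - 2 * prim (k x) (w x) := fun x =>
    sub_nonneg.2 (two_mul_prim_le_mul (hkmono x) (hk0 x) (hkr x) _)
  have hgap : ∫ x, (k x (w x) * w x - 2 * prim (k x) (w x)) =
      (∫ x, k x (w x) * w x) - 2 * energy k w := by
    rw [integral_sub iP (iF.const_mul 2), integral_const_mul]; rfl
  have hgap0 : 0 ≤ (∫ x, k x (w x) * w x) - 2 * energy k w := by
    rw [← hgap]; exact integral_nonneg hpt
  have hlam0 : -firstEig Ω ≤ lam := by
    have : -firstEig Ω * c ≤ lam * c := by linarith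
    exact le_of_mul_le_mul_right this hc
  have hwK : ∀ᵐ x, w x ≤ K := by
    set B := 2 * K ^ (p - 2) + L with hB
    have hB0 : 0 < B := by positivity
    have h1 := hA w (fun x => lam * w x - k x (w x)) hwi hw2 hw0 ((hwi.const_mul lam).sub hki) B hB0
      (fun x => by
        have h2 := hkC x _ (hw0 x)
        have h3 := mul_le_mul_of_nonneg_right hK1 (hw0 x)
        have h4 : -lam ≤ L := by linarith [le_abs_self (firstEig Ω)]
        have h5 := mul_le_mul_of_nonneg_right h4 (hw0 x)
        have h6 : B * w x = 2 * K ^ (p - 2) * w x + L * w x := by rw [hB]; ring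
        linarith) hsub
    filter_upwards [h1] with x hx
    rw [hwc] at hx
    exact (sq_lt_sq₀ (hw0 x) hK0.le).1 (hx.trans_lt hK2) |>.le
  have hlam1 : -firstEig Ω < lam := by
    refine lt_of_le_of_ne hlam0 fun heq => ?_
    have h1 : (∫ x, k x (w x) * w x) - 2 * energy k w = 0 := by
      rw [← heq] at hlam
      linarith
    rw [← hgap, integral_eq_zero_iff_of_nonneg hpt (iP.sub (iF.const_mul 2))] at h1
    have h2 := h.ae_ratio_strictMono
    rw [ae_restrict_iff' h.isOpen.measurableSet] at h2
    have h3 : ∫ x, w x ^ 2 = 0 := by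
      refine integral_eq_zero_of_ae ?_
      filter_upwards [h1, h2, hwK] with x hx1 hx2 hx3
      by_contra hne
      have hpos : 0 < w x := (hw0 x).lt_of_ne fun h => hne (by simp [← h])
      have hxΩ : x ∈ Ω := by
        by_contra hx
        rw [hwΩ x hx] at hpos
        exact lt_irrefl _ hpos
      have h4 := (hx2 hxΩ).2 (w x / 2) (w x) (by linarith) (by linarith)
      rw [← hkf x hxΩ _ (by linarith) (by linarith), ← hkf x hxΩ _ hpos.le hx3] at h4
      have h5 := two_mul_prim_le (hkmono x) (hkr x) (hk0 x) (half_pos hpos) (half_le_self hpos.le)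
      have h6 := mul_pos (sub_pos.2 h4) (pow_pos (half_pos hpos) 2)
      simp only [Pi.zero_apply] at hx1
      linarith
    linarith
  have hae : w =ᵐ[volume] fun x => min (w x) K := by
    filter_upwards [hwK] with x hx
    rw [min_eq_left hx]
  have e1 : ∀ φ : Euc N → ℝ, ∫ x, min (w x) K * lap φ x = ∫ x, w x * lap φ x := fun φ =>
    integral_congr_ae (by filter_upwards [hae] with x hx; rw [← hx])
  have e2 : ∀ φ : Euc N → ℝ, ∫ x, φ x * (lam * min (w x) K - k x (min (w x) K)) =
      ∫ x, φ x * (lam * w x - k x (w x)) := fun φ =>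
    integral_congr_ae (by filter_upwards [hae] with x hx; rw [← hx])
  refine ⟨k, K, _, lam, fun x => min (w x) K, hk, hK0, hkoff, hkf,
    ⟨hwm.min measurable_const, fun x => le_min (hw0 x) hK0.le, fun x => min_le_right _ _,
      fun x hx => ?_, fun φ hφ => ?_, fun φ hφ hφ0 => ?_⟩, ?_, hlam1⟩
  · rw [hwΩ x hx, min_eq_left hK0.le]
  · rw [e1, e2, hweak φ hφ]
  · rw [e1, e2]
    exact hsub φ hφ hφ0
  · rw [← hwc]
    exact integral_congr_ae (by filter_upwards [hae] with x hx; rw [← hx])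

namespace IsWeakSol

variable {k : Euc N → ℝ → ℝ} {K C lam : ℝ} {w : Euc N → ℝ}

theorem abs_rhs_le (hw : IsWeakSol Ω k K lam w) (hk : IsTrunc k C) (x : Euc N) :
    |lam * w x - k x (w x)| ≤ (|lam| + C) * K := by
  have h1 := hw.nonneg x
  have h2 := hk.le x _ h1
  have h3 := apply_nonneg_of_monotone (hk.mono x) (hk.zero x) (w x)
  have h4 : |lam * w x| ≤ |lam| * K := by
    rw [abs_mul, abs_of_nonneg h1]
    exact mul_le_mul_of_nonneg_left (hw.le x) (abs_nonneg _)
  have h5 : C * w x ≤ C * K := mul_le_mul_of_nonneg_left (hw.le x) hk.nonneg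
  calc |lam * w x - k x (w x)| ≤ |lam * w x| + |k x (w x)| := abs_sub _ _
    _ ≤ (|lam| + C) * K := by rw [abs_of_nonneg h3]; linarith

theorem measurable_rhs (hw : IsWeakSol Ω k K lam w) (hk : IsTrunc k C) :
    Measurable fun x => lam * w x - k x (w x) :=
  (hw.meas.const_mul lam).sub (hk.meas.comp (measurable_id.prodMk hw.meas))

theorem integrable (hw : IsWeakSol Ω k K lam w) (hb : Bornology.IsBounded Ω) : Integrable w :=
  integrable_of_abs_le hb hw.meas
    (fun x => by rw [abs_of_nonneg (hw.nonneg x)]; exact hw.le x) hw.off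

theorem integrable_rhs (hw : IsWeakSol Ω k K lam w) (hk : IsTrunc k C)
    (hb : Bornology.IsBounded Ω) (hkoff : ∀ x ∉ Ω, ∀ t, k x t = 0) :
    Integrable fun x => lam * w x - k x (w x) :=
  integrable_of_abs_le hb (hw.measurable_rhs hk) (hw.abs_rhs_le hk)
    fun x hx => by rw [hw.off x hx, hkoff x hx]; ring

/-- The representative of a weak solution which is differentiable in the domain. -/
theorem exists_rep (hw : IsWeakSol Ω k K lam w) (hk : IsTrunc k C) (hΩ : IsOpen Ω)
    (hb : Bornology.IsBounded Ω) (hK : 0 < K) (hkoff : ∀ x ∉ Ω, ∀ t, k x t = 0) :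
    ∃ v, v =ᵐ[volume] w ∧ IsWeakSol Ω k K lam v ∧ ContDiffOn ℝ 1 v Ω ∧ ∀ x ∈ Ω, rep v x = v x := by
  have hwi := hw.integrable hb
  have hC1 := contDiffOn_one_rep hΩ hwi (hw.measurable_rhs hk) (hw.integrable_rhs hk hb hkoff)
    (hw.abs_rhs_le hk) hw.weak
  have hrep := rep_ae_eq hwi
  set v := Ω.indicator (rep w) with hv
  have hvΩ : ∀ x ∈ Ω, v x = rep w x := fun x hx => indicator_of_mem hx _
  have hvoff : ∀ x ∉ Ω, v x = 0 := fun x hx => indicator_of_notMem hx _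
  have hae : v =ᵐ[volume] w := by
    filter_upwards [hrep] with x hx
    by_cases hxΩ : x ∈ Ω
    · rw [hvΩ x hxΩ, hx]
    · rw [hvoff x hxΩ, hw.off x hxΩ]
  have hvm : Measurable v := by
    classical
    have := hC1.continuousOn.measurable_piecewise (g := 0) continuousOn_const hΩ.measurableSet
    rwa [piecewise_eq_indicator] at this
  have h0 : ∀ x ∈ Ω, 0 ≤ rep w x := nonneg_of_ae_nonneg hΩ hC1.continuousOn (by
    filter_upwards [ae_restrict_of_ae hrep] with x hx
    rw [hx]; exact hw.nonneg x)
  have h1 : ∀ x ∈ Ω, 0 ≤ K - rep w x :=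
    nonneg_of_ae_nonneg hΩ (continuousOn_const.sub hC1.continuousOn) (by
      filter_upwards [ae_restrict_of_ae hrep] with x hx
      rw [hx]; exact sub_nonneg.2 (hw.le x))
  have e1 : ∀ φ : Euc N → ℝ, ∫ x, v x * lap φ x = ∫ x, w x * lap φ x := fun φ =>
    integral_congr_ae (by filter_upwards [hae] with x hx; rw [hx])
  have e2 : ∀ φ : Euc N → ℝ, ∫ x, φ x * (lam * v x - k x (v x)) =
      ∫ x, φ x * (lam * w x - k x (w x)) := fun φ =>
    integral_congr_ae (by filter_upwards [hae] with x hx; rw [hx])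
  refine ⟨v, hae, ⟨hvm, fun x => ?_, fun x => ?_, hvoff, fun φ hφ => ?_, fun φ hφ hφ0 => ?_⟩,
    hC1.congr hvΩ, fun x hx => ?_⟩
  · by_cases hx : x ∈ Ω
    · rw [hvΩ x hx]; exact h0 x hx
    · rw [hvoff x hx]
  · by_cases hx : x ∈ Ω
    · rw [hvΩ x hx]; exact sub_nonneg.1 (h1 x hx)
    · rw [hvoff x hx]; exact hK.le
  · rw [e1, e2, hw.weak φ hφ]
  · rw [e1, e2]
    exact hw.sub φ hφ hφ0
  · rw [rep_congr_ae hae, hvΩ x hx]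

theorem isPosSolution (h : Standing N Ω f d g p u) (hw : IsWeakSol Ω k K lam w) (hk : IsTrunc k C)
    (hkoff : ∀ x ∉ Ω, ∀ t, k x t = 0)
    (hkf : ∀ x ∈ Ω, ∀ t, 0 ≤ t → t ≤ K → k x t = f x t) (hC1 : ContDiffOn ℝ 1 w Ω)
    (hrep : ∀ x ∈ Ω, rep w x = w x) (hne : ∃ x ∈ Ω, w x ≠ 0) : IsPosSolution Ω f lam w := by
  have hΩ := h.isOpen
  have hwi := hw.integrable h.bdd
  have hGm := hw.measurable_rhs hk
  have hGi := hw.integrable_rhs hk h.bdd hkoff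
  have hGB := hw.abs_rhs_le hk
  have hGf : ∀ x ∈ Ω, lam * w x - k x (w x) = lam * w x - f x (w x) := fun x hx => by
    rw [hkf x hx _ (hw.nonneg x) (hw.le x)]
  have hG1 : ContDiffOn ℝ 1 (fun x => lam * w x - k x (w x)) Ω := by
    refine ContDiffOn.congr ?_ hGf
    exact (contDiffOn_const.mul hC1).sub
      (h.f_c1.comp (contDiffOn_id.prodMk hC1) fun x hx => ⟨hx, mem_univ _⟩)
  have hr2 := contDiffOn_two_rep hΩ hwi hGm hGB hG1 hw.weak
  have hM0 : 0 ≤ (|lam| + C) * K := (abs_nonneg _).trans (hGB 0)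
  refine ⟨hr2.congr fun x hx => (hrep x hx).symm, ?_, fun x hx => ?_, fun x hx => ?_,
    fun x hx => ?_⟩
  · intro x hx
    refine ContinuousAt.continuousWithinAt ?_
    by_cases hxΩ : x ∈ Ω
    · exact hC1.continuousOn.continuousAt (hΩ.mem_nhds hxΩ)
    · obtain ⟨θ, hθ0, hθ1, hcone⟩ := h.exterior_cone
      have := tendsto_zero_of_avg_decay hw.nonneg hw.le hwi hw.off hθ0 hθ1 (hcone x hxΩ)
        fun y hy r hr => by
          have := rep_le_avg_add_sq hwi hGi hM0 (fun z => (abs_le.1 (hGB z)).1) hw.sub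
            (tendsto_rep_of_weak hΩ hwi hGm hGB hw.weak hy) hr
          rwa [hrep y hy] at this
      unfold ContinuousAt
      rwa [hw.off x hxΩ]
  · have := strong_maximum hΩ h.conn.isPreconnected hwi hw.nonneg hGm hGi hGB hw.weak
      (abs_nonneg lam) (fun y => by
        have h1 := apply_nonneg_of_monotone (hk.mono y) (hk.zero y) (w y)
        have h2 := mul_le_mul_of_nonneg_right (le_abs_self lam) (hw.nonneg y)
        linarith) (hr2.continuousOn)
    rcases this with h1 | h1
    · exact (hw.nonneg x).lt_of_ne fun h0 => h1 x hx (by rw [hrep x hx, ← h0])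
    · obtain ⟨y, hy, hy0⟩ := hne
      exact absurd (by rw [← hrep y hy, h1 y hy]) hy0
  · rw [frontier, hΩ.interior_eq] at hx
    exact hw.off x hx.2
  · have h1 : lap w x = lap (rep w) x := lap_congr_of_eventuallyEq (by
      filter_upwards [hΩ.mem_nhds hx] with y hy
      rw [hrep y hy])
    rw [h1, lap_rep hΩ hwi hGi hG1.continuousOn hr2 hw.weak hx, hGf x hx]
    ring

end IsWeakSol

end Solution

/-- in the mass-subcritical case `2 < p < 2 + 4/N`, every mass
`c ∈ (0, ∞)` is attained by a positive solution. -/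
theorem statement2 {N : ℕ} {Ω : Set (Euc N)} {f : Euc N → ℝ → ℝ} {d : Euc N → ℝ}
    {g : Euc N → ℝ → ℝ} {p : ℝ} {u : ℝ → Euc N → ℝ}
    (H : Standing N Ω f d g p u) (hp : p < 2 + 4 / (N : ℝ)) :
    ∀ c : ℝ, 0 < c →
      ∃ lam : ℝ, - firstEig Ω < lam ∧ (∫ x in Ω, (u lam x) ^ 2) = c := by
  intro c hc
  obtain ⟨k, K, C, lam, w, hk, hK, hkoff, hkf, hw, hwc, hlam⟩ :=
    exists_bounded_weak_solution H hp hc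
  obtain ⟨v, hvw, hv, hC1, hrep⟩ := hw.exists_rep hk H.isOpen H.bdd hK hkoff
  have hvc : ∫ x, v x ^ 2 = c := by
    rw [← hwc]
    exact integral_congr_ae (by filter_upwards [hvw] with x hx; rw [hx])
  have hne : ∃ x ∈ Ω, v x ≠ 0 := by
    by_contra! h
    have h0 : ∀ x, v x = 0 := fun x => by
      by_cases hx : x ∈ Ω
      exacts [h x hx, hv.off x hx]
    simp only [h0, ne_eq, OfNat.ofNat_ne_zero, not_false_eq_true, zero_pow, integral_zero] at hvc
    exact hc.ne hvc
  have heq := (H.sol lam hlam).2 v (hv.isPosSolution H hk hkoff hkf hC1 hrep hne)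
  refine ⟨lam, hlam, ?_⟩
  rw [← hvc, ← setIntegral_eq_integral_of_forall_compl_eq_zero (s := Ω) (f := fun x => v x ^ 2)
    fun x hx => by rw [hv.off x hx, zero_pow two_ne_zero]]
  exact setIntegral_congr_fun H.isOpen.measurableSet fun x hx => by
    rw [← heq (subset_closure hx)]
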